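/- arXiv:1809.05931 — 6 statements merged into one kernel-verified Lean document; each statement's English description precedes it below -/
import Mathlib

section
/- As n → ∞, γₙ(1 − λ⁽ⁿ⁾ m⁽ⁿ⁾ η_β⁽ⁿ⁾) converges to b + m + βσλ; in particular this limit is strictly positive. -/
open MeasureTheory Filter Set

noncomputable def convIter (f : ℝ → ℝ) : ℕ → ℝ → ℝ
  | 0 => f
  | (k + 1) => fun t => ∫ s in (0:ℝ)..t, convIter f k (t - s) * f s

noncomputable def resolventFn (a : ℝ) (f : ℝ → ℝ) (t : ℝ) : ℝ :=
  ∑' k : ℕ, a ^ (k + 1) * convIter f k t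

lemma tail_aux (μ : Measure ℝ) [IsProbabilityMeasure μ] (h0 : μ (Set.Iio 0) = 0) (k : ℕ)
    (hint : Integrable (fun t : ℝ => t ^ (k+1)) μ) :
    IntegrableOn (fun t : ℝ => t ^ k * (μ (Set.Ioi t)).toReal) (Set.Ioi 0) ∧
    ∫ t in Set.Ioi (0:ℝ), t ^ k * (μ (Set.Ioi t)).toReal = (1/((k:ℝ)+1)) * ∫ t, t ^ (k+1) ∂μ := by
  have hnn : ∀ᵐ t ∂μ, (0:ℝ) ≤ t := by
    rw [ae_iff]
    simpa [Set.Iio] using h0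
  have key := lintegral_comp_eq_lintegral_meas_lt_mul μ (f := fun t : ℝ => t)
    (g := fun t : ℝ => t ^ k) hnn measurable_id.aemeasurable
    (fun t _ => (continuous_pow k).intervalIntegrable _ _)
    (by
      filter_upwards [ae_restrict_mem measurableSet_Ioi] with t ht
      exact pow_nonneg (le_of_lt ht) k)
  have hR : ∫⁻ t in Set.Ioi (0:ℝ), μ {a : ℝ | t < a} * ENNReal.ofReal (t ^ k)
      = ∫⁻ t in Set.Ioi (0:ℝ), ENNReal.ofReal (t ^ k * (μ (Set.Ioi t)).toReal) := by
    refine setLIntegral_congr_fun measurableSet_Ioi (fun t ht => ?_)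
    have : (0:ℝ) ≤ t ^ k := pow_nonneg (le_of_lt ht) k
    rw [ENNReal.ofReal_mul this, ENNReal.ofReal_toReal (measure_ne_top _ _), mul_comm]
    rfl
  have hI : Integrable (fun t : ℝ => (1/((k:ℝ)+1)) * t ^ (k+1)) μ := hint.const_mul _
  have hInn : 0 ≤ᵐ[μ] (fun t : ℝ => (1/((k:ℝ)+1)) * t ^ (k+1)) := by
    filter_upwards [hnn] with t ht
    show (0:ℝ) ≤ _
    positivity
  have hL : ∫⁻ t, ENNReal.ofReal (∫ s in (0:ℝ)..t, s ^ k) ∂μ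
      = ENNReal.ofReal ((1/((k:ℝ)+1)) * ∫ t, t ^ (k+1) ∂μ) := by
    rw [← integral_const_mul, ofReal_integral_eq_lintegral_ofReal hI hInn]
    refine lintegral_congr (fun t => ?_)
    rw [integral_pow]
    congr 1
    simp
    ring
  rw [hL, hR] at key
  have hm : Measurable (fun t : ℝ => t ^ k * (μ (Set.Ioi t)).toReal) := by
    have : Antitone (fun t : ℝ => (μ (Set.Ioi t)).toReal) := fun a b hab =>
      ENNReal.toReal_mono (measure_ne_top _ _) (measure_mono (Set.Ioi_subset_Ioi hab))
    exact (measurable_id.pow_const k).mul this.measurable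
  have hmnn : 0 ≤ᵐ[volume.restrict (Set.Ioi (0:ℝ))]
      (fun t : ℝ => t ^ k * (μ (Set.Ioi t)).toReal) := by
    filter_upwards [ae_restrict_mem measurableSet_Ioi] with t ht
    exact mul_nonneg (pow_nonneg (le_of_lt ht) k) ENNReal.toReal_nonneg
  constructor
  · refine ⟨hm.aestronglyMeasurable, ?_⟩
    rw [hasFiniteIntegral_iff_ofReal hmnn, ← key]
    exact ENNReal.ofReal_lt_top
  · rw [integral_eq_lintegral_of_nonneg_ae hmnn hm.aestronglyMeasurable, ← key,
      ENNReal.toReal_ofReal]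
    rw [← integral_const_mul]
    exact integral_nonneg_of_ae hInn

lemma exp_aux {x : ℝ} (hx : 0 ≤ x) :
    0 ≤ x - (1 - Real.exp (-x)) ∧ x - (1 - Real.exp (-x)) ≤ x ∧
    x - (1 - Real.exp (-x)) ≤ x ^ 2 := by
  have h1 := Real.add_one_le_exp (-x)
  have h2 : Real.exp (-x) ≤ 1 := Real.exp_le_one_iff.2 (by linarith)
  refine ⟨by linarith, by linarith, ?_⟩
  have h3 := Real.add_one_le_exp x
  have h4 : Real.exp (-x) * Real.exp x = 1 := by rw [← Real.exp_add]; simp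
  have h5 := Real.exp_pos (-x)
  nlinarith [mul_le_mul_of_nonneg_left h3 h5.le]

theorem stmt2
    (β α : ℝ) (hβ : 0 ≤ β) (hα : α ∈ Set.Ioo (1:ℝ) 2)
    (Λ : ℕ → Measure ℝ) (hΛprob : ∀ n, IsProbabilityMeasure (Λ n))
    (hΛsupp : ∀ n, Λ n (Set.Iio 0) = 0)
    (lam m γ : ℕ → ℝ)
    (hlam_pos : ∀ n, 0 < lam n) (hm_pos : ∀ n, 0 < m n) (hγ_pos : ∀ n, 0 < γ n)
    (hγ_top : Tendsto γ atTop atTop)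
    (Λbar : ℕ → ℝ → ℝ) (hΛbar : ∀ n t, Λbar n t = (Λ n (Set.Ioi t)).toReal)
    (Λbarβ : ℕ → ℝ → ℝ)
    (hΛbarβ : ∀ n t, Λbarβ n t = Real.exp (-(β * t) / γ n) * Λbar n t)
    (ηβ : ℕ → ℝ) (hηβ : ∀ n, ηβ n = ∫ t in Set.Ioi (0:ℝ), Λbarβ n t)
    (lam0 η0 σ0 bm : ℝ) (hlam0 : 0 < lam0) (hη0 : 0 < η0) (hσ0 : 0 < σ0)
    (hbm_pos : 0 < bm + β * σ0 * lam0)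
    (hmom1 : ∀ n, Integrable (fun t => t) (Λ n))
    (hmom2 : ∀ n, Integrable (fun t => t ^ 2) (Λ n))
    (hlam_lim : Tendsto lam atTop (nhds lam0))
    (hm_lim : Tendsto m atTop (nhds 1))
    (hmean_lim : Tendsto (fun n => ∫ t, t ∂(Λ n)) atTop (nhds η0))
    (hsec_lim : Tendsto (fun n => (1/2) * ∫ t, t ^ 2 ∂(Λ n)) atTop (nhds σ0))
    (hγ_lim : Tendsto (fun n => γ n * (1 - lam n * m n * ∫ t, t ∂(Λ n))) atTop (nhds bm))
    (C₀ : ℝ) (hC₀ : 0 < C₀)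
    (Λstar : Measure ℝ) (hstar_prob : IsProbabilityMeasure Λstar)
    (hstar_supp : Λstar (Set.Iio 0) = 0)
    (hstar_mom : Integrable (fun t => t ^ (2 * α)) Λstar)
    (hdom : ∀ n, ∀ t : ℝ, 0 ≤ t → Λbar n t ≤ C₀ * (Λstar (Set.Ioi t)).toReal)
 :
    Tendsto (fun n => γ n * (1 - lam n * m n * ηβ n)) atTop
        (nhds (bm + β * σ0 * lam0)) ∧
      0 < bm + β * σ0 * lam0 := by
  refine ⟨?_, hbm_pos⟩
  have hst2 : Integrable (fun t : ℝ => t ^ (1+1)) Λstar := by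
    refine ((integrable_const (1:ℝ)).add hstar_mom).mono'
      (continuous_pow 2).aestronglyMeasurable ?_
    have hnn : ∀ᵐ t ∂Λstar, (0:ℝ) ≤ t := by
      rw [ae_iff]
      simpa [Set.Iio] using hstar_supp
    filter_upwards [hnn] with t ht
    have hp : (0:ℝ) ≤ t ^ (2 * α) := Real.rpow_nonneg ht _
    rw [Real.norm_of_nonneg (by positivity)]
    show t ^ 2 ≤ 1 + t ^ (2 * α)
    rcases le_total t 1 with h | h
    · nlinarith
    · have := Real.rpow_le_rpow_of_exponent_le h (show (2:ℝ) ≤ 2 * α by linarith [hα.1])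
      rw [Real.rpow_two] at this
      linarith
  have hS := (tail_aux Λstar hstar_supp 1 hst2).1
  have hT0 := fun n => tail_aux (Λ n) (hΛsupp n) 0 (by simpa using hmom1 n)
  have hT1 := fun n => tail_aux (Λ n) (hΛsupp n) 1 (by simpa using hmom2 n)
  simp only [pow_zero, one_mul, zero_add, pow_one, Nat.cast_zero, div_one, ← hΛbar] at hT0
  simp only [pow_one, Nat.cast_one, ← hΛbar] at hT1
  have hnnb : ∀ n t, 0 ≤ Λbar n t := fun n t => by rw [hΛbar]; exact ENNReal.toReal_nonneg
  have hmb : ∀ n, Measurable (Λbar n) := fun n => by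
    have : Antitone (Λbar n) := fun a b hab => by
      rw [hΛbar, hΛbar]
      exact ENNReal.toReal_mono (measure_ne_top _ _) (measure_mono (Set.Ioi_subset_Ioi hab))
    exact this.measurable
  have hmβ : ∀ n, Measurable (fun t => Real.exp (-(β * t) / γ n) * Λbar n t) := fun n =>
    (by fun_prop : Measurable (fun t => Real.exp (-(β * t) / γ n))).mul (hmb n)
  have hIβ : ∀ n, IntegrableOn (fun t => Real.exp (-(β * t) / γ n) * Λbar n t) (Set.Ioi 0) := by
    intro n
    refine (hT0 n).1.mono' (hmβ n).aestronglyMeasurable ?_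
    filter_upwards [ae_restrict_mem measurableSet_Ioi] with t ht
    have ht' : (0:ℝ) < t := ht
    rw [Real.norm_of_nonneg (mul_nonneg (Real.exp_pos _).le (hnnb n t))]
    have : Real.exp (-(β * t) / γ n) ≤ 1 := Real.exp_le_one_iff.2
      (div_nonpos_of_nonpos_of_nonneg (by nlinarith) (hγ_pos n).le)
    nlinarith [hnnb n t]
  let F : ℕ → ℝ → ℝ := fun n t =>
    β * (t * Λbar n t) - γ n * (Λbar n t - Real.exp (-(β * t) / γ n) * Λbar n t)
  have hFI : ∀ n, ∫ t in Set.Ioi (0:ℝ), F n t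
      = β * ((1/2) * ∫ t, t ^ 2 ∂(Λ n)) - γ n * ((∫ t, t ∂(Λ n)) - ηβ n) := by
    intro n
    have e1 : ηβ n = ∫ t in Set.Ioi (0:ℝ), Real.exp (-(β * t) / γ n) * Λbar n t := by
      rw [hηβ]; simp only [hΛbarβ]
    have h2 := (hT1 n).2
    norm_num at h2
    have h2' : (1/2 : ℝ) * ∫ t, t ^ 2 ∂(Λ n) = ∫ t in Set.Ioi (0:ℝ), t * Λbar n t := by
      rw [h2]
    rw [h2', ← (show _ = ∫ t, t ∂(Λ n) by simpa using (hT0 n).2), e1,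
      ← integral_sub (hT0 n).1 (hIβ n), ← integral_const_mul, ← integral_const_mul]
    exact integral_sub ((hT1 n).1.const_mul β) (((hT0 n).1.sub (hIβ n)).const_mul (γ n))
  have hFb : ∀ n t, 0 < t → 0 ≤ F n t ∧ F n t ≤ β * t * Λbar n t ∧
      F n t ≤ (β * t) ^ 2 / γ n * Λbar n t := by
    intro n t ht
    have hg := hγ_pos n
    obtain ⟨a, b, c⟩ := exp_aux (x := β * t / γ n) (by positivity)
    have hF : F n t = (γ n * (β * t / γ n - (1 - Real.exp (-(β * t / γ n))))) * Λbar n t := by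
      simp only [F, neg_div]
      field_simp
    rw [hF]
    refine ⟨mul_nonneg (mul_nonneg hg.le a) (hnnb n t),
      mul_le_mul_of_nonneg_right ?_ (hnnb n t), mul_le_mul_of_nonneg_right ?_ (hnnb n t)⟩
    · refine (mul_le_mul_of_nonneg_left b hg.le).trans (le_of_eq ?_)
      field_simp
    · refine (mul_le_mul_of_nonneg_left c hg.le).trans (le_of_eq ?_)
      field_simp
  have hlim : Tendsto (fun n => ∫ t in Set.Ioi (0:ℝ), F n t) atTop (nhds 0) := by
    have := tendsto_integral_of_dominated_convergence
      (μ := volume.restrict (Set.Ioi (0:ℝ))) (F := F) (f := fun _ => (0:ℝ))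
      (fun t => β * C₀ * (t ^ 1 * (Λstar (Set.Ioi t)).toReal))
      (fun n => (((measurable_id.mul (hmb n)).const_mul β).sub
        (((hmb n).sub (hmβ n)).const_mul (γ n))).aestronglyMeasurable)
      (hS.const_mul (β * C₀)) ?_ ?_
    · simpa using this
    · intro n
      filter_upwards [ae_restrict_mem measurableSet_Ioi] with t ht
      have ht' : (0:ℝ) < t := ht
      obtain ⟨a, b, -⟩ := hFb n t ht
      rw [Real.norm_of_nonneg a]
      refine b.trans ((mul_le_mul_of_nonneg_left (hdom n t ht'.le) (by positivity)).trans
        (le_of_eq (by ring)))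
    · filter_upwards [ae_restrict_mem measurableSet_Ioi] with t ht
      have h0 : Tendsto (fun n => (β * t) ^ 2 / γ n) atTop (nhds 0) :=
        tendsto_const_nhds.div_atTop hγ_top
      refine squeeze_zero (fun n => (hFb n t ht).1) (fun n => ?_) h0
      refine (hFb n t ht).2.2.trans ?_
      have : Λbar n t ≤ 1 := by
        rw [hΛbar]
        exact measureReal_le_one
      have hg := hγ_pos n
      exact mul_le_of_le_one_right (by positivity) this
  have hA : Tendsto (fun n => γ n * (1 - lam n * m n * ∫ t, t ∂(Λ n)) + lam n * m n *
      (β * ((1/2) * ∫ t, t ^ 2 ∂(Λ n)) - ∫ t in Set.Ioi (0:ℝ), F n t)) atTop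
      (nhds (bm + lam0 * 1 * (β * σ0 - 0))) :=
    hγ_lim.add ((hlam_lim.mul hm_lim).mul ((hsec_lim.const_mul β).sub hlim))
  have e : bm + lam0 * 1 * (β * σ0 - 0) = bm + β * σ0 * lam0 := by ring
  rw [e] at hA
  refine hA.congr (fun n => ?_)
  rw [hFI]
  ring
end

section
/- There exist an integer n₀ ≥ 1 and a constant C > 0 such that for every n > n₀, sup_{t ≥ 0} R_β⁽ⁿ⁾(t) ≤ C. -/
open MeasureTheory Filter Set

lemma aux_renewal (φ : ℝ → ENNReal) (hm : Measurable φ) (hsupp : ∀ x < 0, φ x = 0)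
    (hanti : ∀ x y, 0 ≤ x → x ≤ y → φ y ≤ φ x) (K : ENNReal) (hK : ∀ x, φ x ≤ K)
    (hint : ∫⁻ x, φ x ≤ 1) (h : ℝ) (hh : 0 < h) (hKh : K * ENNReal.ofReal h ≤ 1 / 2)
    (g : ℕ → ℝ → ENNReal) (g0 : g 0 = φ) (gs : ∀ k, g (k + 1) = lconvolution φ (g k) volume)
    (N : ℕ) (t : ℝ) :
    ∑ k ∈ Finset.range N, g k t ≤ K + (K * 2 + (ENNReal.ofReal h)⁻¹ * 2) := by
  set H : ℝ → ENNReal := (Ici (0:ℝ)).indicator 1 with hH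
  set I : ℝ → ENNReal := (Ico (0:ℝ) h).indicator 1 with hI
  have Hm : Measurable H := measurable_one.indicator measurableSet_Ici
  have Im : Measurable I := measurable_one.indicator measurableSet_Ico
  have gm : ∀ k, Measurable (g k) := by
    intro k
    induction k with
    | zero => rw [g0]; exact hm
    | succ k ih => rw [gs]; exact measurable_lconvolution _ hm ih
  set F : ℝ → ENNReal := lconvolution φ H volume with hF
  have Fm : Measurable F := measurable_lconvolution _ hm Hm
  have F1 : ∀ x, F x ≤ 1 := by
    intro x
    refine le_trans ?_ hint
    rw [hF, lconvolution_def]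
    refine lintegral_mono fun y => ?_
    have : H (-y + x) ≤ 1 := by
      rw [hH]; exact indicator_le_self' (by simp) _
    exact mul_le_of_le_one_right' this
  have F0 : ∀ x < 0, F x = 0 := by
    intro x hx
    rw [hF, lconvolution_def, lintegral_eq_zero_iff (by fun_prop)]
    refine Eventually.of_forall fun y => ?_
    by_cases hy : y < 0
    · simp [hsupp y hy]
    · have : H (-y + x) = 0 := by
        rw [hH, indicator_of_notMem]; simp; linarith
      simp [this]
  have Fh : ∀ x < h, F x ≤ 1 / 2 := by
    intro x hx
    refine le_trans ?_ hKh
    have : K * ENNReal.ofReal h = ∫⁻ y, (Icc (0:ℝ) h).indicator (fun _ => K) y := by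
      rw [lintegral_indicator measurableSet_Icc]; simp
    rw [this, hF, lconvolution_def]
    refine lintegral_mono fun y => ?_
    by_cases hy : y ∈ Icc 0 h
    · rw [indicator_of_mem hy]
      have : H (-y + x) ≤ 1 := by
        rw [hH]; exact indicator_le_self' (by simp) _
      exact (mul_le_of_le_one_right' this).trans (hK y)
    · rw [indicator_of_notMem hy]
      by_cases hy0 : y < 0
      · simp [hsupp y hy0]
      · have : H (-y + x) = 0 := by
          rw [hH, indicator_of_notMem]
          simp only [mem_Icc, not_and, not_le] at hy
          have := hy (by linarith)
          simp; linarith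
        simp [this]
  set Fb : ℝ → ENNReal := fun x => H x - F x with hFb
  have Fbm : Measurable Fb := Hm.sub Fm
  have hsum : ∀ x, H x = F x + Fb x := by
    intro x
    rw [hFb]
    refine (add_tsub_cancel_of_le ?_).symm
    by_cases hx : x < 0
    · simp [F0 x hx]
    · rw [hH, indicator_of_mem (by simpa using hx)]; exact F1 x
  have hIF : ∀ x, I x ≤ 2 * Fb x := by
    intro x
    by_cases hx : x ∈ Ico 0 h
    · rw [hI, indicator_of_mem hx, hFb, hH]
      simp only
      rw [indicator_of_mem (by exact hx.1)]
      have h2 : (1:ENNReal) / 2 ≤ 1 - F x := by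
        have : (1:ENNReal) - 1/2 ≤ 1 - F x := tsub_le_tsub_left (Fh x hx.2) 1
        simpa using this
      calc (1 : ENNReal) = 2 * (1 / 2) := by
            rw [one_div, ENNReal.mul_inv_cancel] <;> simp
        _ ≤ _ := by gcongr; exact h2
    · rw [hI, indicator_of_notMem hx]; exact zero_le
  have tel : ∀ N t, ∑ k ∈ Finset.range N, lconvolution (g k) Fb volume t
      + lconvolution (g N) H volume t = F t := by
    intro N t
    induction N with
    | zero => simp [g0, hF]
    | succ N ih =>
      rw [← ih, Finset.sum_range_succ, add_assoc]
      congr 1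
      have e1 : lconvolution (g (N+1)) H volume = lconvolution (g N) F volume := by
        rw [gs, lconvolution_comm (f := φ), hF, lconvolution_assoc (gm N) hm Hm]
      rw [e1, lconvolution_def, lconvolution_def, lconvolution_def,
        ← lintegral_add_left (by have := gm N; fun_prop)]
      refine lintegral_congr fun y => ?_
      rw [hsum, mul_add, add_comm]
  set S : ℕ → ℝ → ENNReal := fun N t => ∑ k ∈ Finset.range N, g k t with hS
  have Sm : ∀ N, Measurable (S N) := fun N => Finset.measurable_sum _ fun k _ => gm k
  have hSI : ∀ N t, lconvolution I (S N) volume t ≤ 2 := by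
    intro N t
    rw [lconvolution_comm, lconvolution_def]
    calc ∫⁻ y, S N y * I (-y + t) ≤ ∫⁻ y, 2 * (∑ k ∈ Finset.range N, g k y * Fb (-y+t)) := by
          refine lintegral_mono fun y => ?_
          simp only [hS]
          rw [← Finset.sum_mul, mul_left_comm]
          gcongr
          exact hIF _
      _ = 2 * ∑ k ∈ Finset.range N, lconvolution (g k) Fb volume t := by
          rw [lintegral_const_mul _ (by fun_prop), lintegral_finsetSum _ (fun k _ => by have := gm k; fun_prop)]
          rfl
      _ ≤ 2 * 1 := by
          gcongr
          exact le_trans (le_trans le_self_add (tel N t).le) (F1 t)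
      _ = 2 := by simp
  have hφ : ∀ x, φ x ≤ K * I x + (ENNReal.ofReal h)⁻¹ * lconvolution φ I volume x := by
    intro x
    by_cases hx0 : x < 0
    · simp [hsupp x hx0]
    by_cases hx : x < h
    · refine le_trans ?_ le_self_add
      rw [hI, indicator_of_mem (show x ∈ Ico 0 h from ⟨by linarith, hx⟩)]
      simpa using hK x
    · refine le_trans ?_ le_add_self
      have : φ x * ENNReal.ofReal h ≤ lconvolution φ I volume x := by
        calc φ x * ENNReal.ofReal h = ∫⁻ y, (Ioc (x-h) x).indicator (fun _ => φ x) y := by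
              rw [lintegral_indicator measurableSet_Ioc]; simp
          _ ≤ _ := by
              rw [lconvolution_def]
              refine lintegral_mono fun y => ?_
              by_cases hy : y ∈ Ioc (x-h) x
              · rw [indicator_of_mem hy, hI, indicator_of_mem]
                · simpa using hanti y x (by have := hy.1; linarith) hy.2
                · constructor
                  · have := hy.2; linarith
                  · have := hy.1; linarith
              · rw [indicator_of_notMem hy]; exact zero_le
      calc φ x = (ENNReal.ofReal h)⁻¹ * (φ x * ENNReal.ofReal h) := by
            rw [mul_comm (φ x), ← mul_assoc, ENNReal.inv_mul_cancel, one_mul]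
            · simpa using hh
            · simp
        _ ≤ _ := by gcongr
  have hφS : ∀ N t, lconvolution φ (S N) volume t ≤ K * 2 + (ENNReal.ofReal h)⁻¹ * 2 := by
    intro N t
    have SN := Sm N
    have cm : Measurable (lconvolution φ I volume) := measurable_lconvolution _ hm Im
    calc lconvolution φ (S N) volume t
        ≤ ∫⁻ y, (K * (I y * S N (-y + t)) + (ENNReal.ofReal h)⁻¹ * (lconvolution φ I volume y * S N (-y+t))) := by
          rw [lconvolution_def]
          refine lintegral_mono fun y => ?_
          simp only
          rw [← mul_assoc, ← mul_assoc, ← add_mul]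
          gcongr
          exact hφ y
      _ = K * lconvolution I (S N) volume t
          + (ENNReal.ofReal h)⁻¹ * lconvolution (lconvolution φ I volume) (S N) volume t := by
          rw [lintegral_add_left (by fun_prop), lintegral_const_mul _ (by fun_prop),
            lintegral_const_mul _ (by fun_prop)]
          rfl
      _ ≤ _ := by
          gcongr
          · exact hSI N t
          · rw [← lconvolution_assoc hm Im SN, lconvolution_def]
            calc _ ≤ ∫⁻ y, φ y * 2 := by
                  refine lintegral_mono fun y => ?_
                  simp only
                  gcongr
                  exact hSI N _
              _ = (∫⁻ y, φ y) * 2 := by rw [lintegral_mul_const _ hm]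
              _ ≤ 1 * 2 := by gcongr
              _ = 2 := by simp
  cases N with
  | zero => simp
  | succ N =>
    rw [Finset.sum_range_succ', add_comm, g0]
    refine add_le_add (hK t) (le_trans (le_of_eq ?_) (hφS N t))
    simp only [gs, hS, lconvolution_def, Finset.mul_sum]
    rw [lintegral_finsetSum _ (fun k _ => by have := gm k; fun_prop)]

lemma aux_resolvent (f : ℝ → ℝ) (hm : Measurable f) (f0 : ∀ x, 0 ≤ f x)
    (fanti : ∀ x y, 0 ≤ x → x ≤ y → f y ≤ f x) (f1 : ∀ x, 0 ≤ x → f x ≤ 1)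
    (a K : ℝ) (ha : 0 < a) (haK : a ≤ K)
    (hint : ∫⁻ x in Ioi (0:ℝ), ENNReal.ofReal (a * f x) ≤ 1) (t : ℝ) (ht : 0 ≤ t) :
    resolventFn a f t ≤ 7 * K := by
  have hK : 0 < K := ha.trans_le haK
  set φ : ℝ → ENNReal := (Ici (0:ℝ)).indicator (fun x => ENNReal.ofReal (a * f x)) with hφ
  have φm : Measurable φ := Measurable.indicator (by fun_prop) measurableSet_Ici
  let g : ℕ → ℝ → ENNReal := fun k => Nat.rec φ (fun _ p => lconvolution φ p volume) k
  have g0 : g 0 = φ := rfl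
  have gs : ∀ k, g (k+1) = lconvolution φ (g k) volume := fun k => rfl
  have key := aux_renewal φ φm (fun x hx => by rw [hφ, indicator_of_notMem]; simpa using hx)
    (fun x y hx hxy => by
      rw [hφ, indicator_of_mem (show x ∈ Ici 0 from hx),
        indicator_of_mem (show y ∈ Ici 0 from hx.trans hxy)]
      exact ENNReal.ofReal_le_ofReal (mul_le_mul_of_nonneg_left (fanti x y hx hxy) ha.le))
    (ENNReal.ofReal K)
    (fun x => by
      by_cases hx : x ∈ Ici (0:ℝ)
      · rw [hφ, indicator_of_mem hx]
        refine ENNReal.ofReal_le_ofReal ?_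
        have := f1 x hx
        have := f0 x
        nlinarith
      · rw [hφ, indicator_of_notMem hx]; exact zero_le)
    (by
      rw [hφ, lintegral_indicator measurableSet_Ici, setLIntegral_congr Ioi_ae_eq_Ici.symm]
      exact hint)
    (1 / (2 * K)) (by positivity)
    (by
      rw [← ENNReal.ofReal_mul hK.le]
      have : K * (1 / (2 * K)) = 1 / 2 := by field_simp
      rw [this, ENNReal.ofReal_div_of_pos (by norm_num)]
      simp) g g0 gs
  have hc : ∀ k t, 0 ≤ t → 0 ≤ convIter f k t ∧
      ENNReal.ofReal (a ^ (k+1) * convIter f k t) ≤ g k t := by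
    intro k
    induction k with
    | zero =>
      intro t ht
      refine ⟨f0 t, ?_⟩
      rw [g0, hφ, indicator_of_mem (show t ∈ Ici 0 from ht)]
      simp [convIter]
    | succ k ih =>
      intro t ht
      have hnn : ∀ s ∈ Ioc 0 t, 0 ≤ convIter f k (t - s) * f s := fun s hs =>
        mul_nonneg (ih (t - s) (by have := hs.2; linarith)).1 (f0 s)
      have e : convIter f (k+1) t = ∫ s in Ioc 0 t, convIter f k (t - s) * f s := by
        simp only [convIter]
        rw [intervalIntegral.integral_of_le ht]
      rw [e]
      refine ⟨setIntegral_nonneg measurableSet_Ioc hnn, ?_⟩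
      rw [ENNReal.ofReal_mul (by positivity)]
      have h1 : ENNReal.ofReal (∫ s in Ioc 0 t, convIter f k (t - s) * f s)
          ≤ ∫⁻ s in Ioc 0 t, ENNReal.ofReal (convIter f k (t - s) * f s) := by
        by_cases hi : IntegrableOn (fun s => convIter f k (t - s) * f s) (Ioc 0 t)
        · rw [ofReal_integral_eq_lintegral_ofReal hi]
          exact (ae_restrict_iff' measurableSet_Ioc).2 (Eventually.of_forall hnn)
        · rw [integral_undef hi]; simp
      calc _ ≤ ENNReal.ofReal (a ^ (k+1+1)) *
              ∫⁻ s in Ioc 0 t, ENNReal.ofReal (convIter f k (t - s) * f s) := by gcongr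
        _ = ∫⁻ s in Ioc 0 t, ENNReal.ofReal (a ^ (k+1+1)) *
              ENNReal.ofReal (convIter f k (t - s) * f s) := by
            rw [lintegral_const_mul' _ _ ENNReal.ofReal_ne_top]
        _ ≤ ∫⁻ s in Ioc 0 t, φ s * g k (-s + t) := by
            refine setLIntegral_mono' measurableSet_Ioc fun s hs => ?_
            have h2 := (ih (t - s) (by have := hs.2; linarith))
            rw [hφ, indicator_of_mem (show s ∈ Ici 0 from hs.1.le),
              ← ENNReal.ofReal_mul (by positivity), neg_add_eq_sub]
            have : a ^ (k+1+1) * (convIter f k (t - s) * f s)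
              = (a * f s) * (a ^ (k+1) * convIter f k (t-s)) := by ring
            rw [this, ENNReal.ofReal_mul (mul_nonneg ha.le (f0 s))]
            gcongr
            exact h2.2
        _ ≤ _ := setLIntegral_le_lintegral _ _
  refine Real.tsum_le_of_sum_range_le
    (fun k => mul_nonneg (by positivity) (hc k t ht).1) fun N => ?_
  have h3 : ENNReal.ofReal (∑ k ∈ Finset.range N, a ^ (k+1) * convIter f k t)
      ≤ ENNReal.ofReal (7 * K) := by
    rw [ENNReal.ofReal_sum_of_nonneg (fun k _ => mul_nonneg (by positivity) (hc k t ht).1)]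
    refine (Finset.sum_le_sum fun k _ => (hc k t ht).2).trans ((key N t).trans (le_of_eq ?_))
    rw [← ENNReal.ofReal_inv_of_pos (by positivity), ← ENNReal.ofReal_ofNat 2,
      ← ENNReal.ofReal_mul hK.le, ← ENNReal.ofReal_mul (by positivity),
      ← ENNReal.ofReal_add (by positivity) (by positivity),
      ← ENNReal.ofReal_add (by positivity) (by positivity)]
    congr 1
    field_simp
    norm_num
  exact (ENNReal.ofReal_le_ofReal_iff (by positivity)).1 h3

lemma aux_moment (μ : Measure ℝ) [IsProbabilityMeasure μ] (h0 : μ (Iio 0) = 0) (p : ℝ)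
    (hp : 0 < p) (hi : Integrable (fun t : ℝ => t ^ p) μ) :
    IntegrableOn (fun t : ℝ => t ^ (p - 1) * (μ (Ioi t)).toReal) (Ioi 0) ∧
    p * ∫ t in Ioi (0:ℝ), t ^ (p - 1) * (μ (Ioi t)).toReal = ∫ t, t ^ p ∂μ := by
  have hnn : ∀ᵐ t ∂μ, 0 ≤ t := by
    rw [ae_iff]; simpa [Iio_def] using h0
  have key := lintegral_rpow_eq_lintegral_meas_lt_mul μ (f := fun t => t) hnn
    measurable_id.aemeasurable hp
  have hpp : 0 ≤ᵐ[μ] fun t : ℝ => t ^ p := hnn.mono fun t ht => Real.rpow_nonneg ht p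
  have tm : Measurable (fun t : ℝ => (μ (Ioi t)).toReal) := by
    apply Antitone.measurable
    intro x y hxy
    exact ENNReal.toReal_mono (measure_ne_top _ _) (measure_mono (Ioi_subset_Ioi hxy))
  have m2 : Measurable (fun t : ℝ => t ^ (p - 1) * (μ (Ioi t)).toReal) := by fun_prop
  have nn2 : 0 ≤ᵐ[volume.restrict (Ioi (0:ℝ))] fun t : ℝ => t ^ (p - 1) * (μ (Ioi t)).toReal :=
    (ae_restrict_iff' measurableSet_Ioi).2 (Eventually.of_forall fun t ht =>
      mul_nonneg (Real.rpow_nonneg (le_of_lt ht) _) ENNReal.toReal_nonneg)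
  have e : ∫⁻ t in Ioi (0:ℝ), μ {a : ℝ | t < a} * ENNReal.ofReal (t ^ (p - 1))
      = ∫⁻ t in Ioi (0:ℝ), ENNReal.ofReal (t ^ (p - 1) * (μ (Ioi t)).toReal) := by
    refine setLIntegral_congr_fun measurableSet_Ioi fun t ht => ?_
    rw [ENNReal.ofReal_mul (Real.rpow_nonneg (le_of_lt ht) _),
      ENNReal.ofReal_toReal (measure_ne_top _ _), mul_comm]
    rfl
  rw [e, ← ofReal_integral_eq_lintegral_ofReal hi hpp] at key
  have hI : IntegrableOn (fun t : ℝ => t ^ (p - 1) * (μ (Ioi t)).toReal) (Ioi 0) := by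
    refine ⟨m2.aestronglyMeasurable, ?_⟩
    rw [hasFiniteIntegral_iff_ofReal nn2, lt_top_iff_ne_top]
    intro htop
    rw [htop, ENNReal.mul_top (by simpa using hp)] at key
    exact ENNReal.ofReal_ne_top key
  refine ⟨hI, ?_⟩
  rw [← ofReal_integral_eq_lintegral_ofReal hI nn2, ← ENNReal.ofReal_mul hp.le,
    ENNReal.ofReal_eq_ofReal_iff (integral_nonneg_of_ae hpp)
      (mul_nonneg hp.le (integral_nonneg_of_ae nn2))] at key
  exact key.symm

theorem stmt4
    (β α : ℝ) (hβ : 0 ≤ β) (hα : α ∈ Set.Ioo (1:ℝ) 2)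
    (Λ : ℕ → Measure ℝ) (hΛprob : ∀ n, IsProbabilityMeasure (Λ n))
    (hΛsupp : ∀ n, Λ n (Set.Iio 0) = 0)
    (lam m γ : ℕ → ℝ)
    (hlam_pos : ∀ n, 0 < lam n) (hm_pos : ∀ n, 0 < m n) (hγ_pos : ∀ n, 0 < γ n)
    (hγ_top : Tendsto γ atTop atTop)
    (Λbar : ℕ → ℝ → ℝ) (hΛbar : ∀ n t, Λbar n t = (Λ n (Set.Ioi t)).toReal)
    (Λbarβ : ℕ → ℝ → ℝ)
    (hΛbarβ : ∀ n t, Λbarβ n t = Real.exp (-(β * t) / γ n) * Λbar n t)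
    (ηβ : ℕ → ℝ) (hηβ : ∀ n, ηβ n = ∫ t in Set.Ioi (0:ℝ), Λbarβ n t)
    (lam0 η0 σ0 bm : ℝ) (hlam0 : 0 < lam0) (hη0 : 0 < η0) (hσ0 : 0 < σ0)
    (hbm_pos : 0 < bm + β * σ0 * lam0)
    (hmom1 : ∀ n, Integrable (fun t => t) (Λ n))
    (hmom2 : ∀ n, Integrable (fun t => t ^ 2) (Λ n))
    (hlam_lim : Tendsto lam atTop (nhds lam0))
    (hm_lim : Tendsto m atTop (nhds 1))
    (hmean_lim : Tendsto (fun n => ∫ t, t ∂(Λ n)) atTop (nhds η0))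
    (hsec_lim : Tendsto (fun n => (1/2) * ∫ t, t ^ 2 ∂(Λ n)) atTop (nhds σ0))
    (hγ_lim : Tendsto (fun n => γ n * (1 - lam n * m n * ∫ t, t ∂(Λ n))) atTop (nhds bm))
    (C₀ : ℝ) (hC₀ : 0 < C₀)
    (Λstar : Measure ℝ) (hstar_prob : IsProbabilityMeasure Λstar)
    (hstar_supp : Λstar (Set.Iio 0) = 0)
    (hstar_mom : Integrable (fun t => t ^ (2 * α)) Λstar)
    (hdom : ∀ n, ∀ t : ℝ, 0 ≤ t → Λbar n t ≤ C₀ * (Λstar (Set.Ioi t)).toReal)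
    (Rβ : ℕ → ℝ → ℝ) (hRβ : ∀ n t, Rβ n t = resolventFn (lam n * m n) (Λbarβ n) t)
 :
    ∃ n₀ : ℕ, 1 ≤ n₀ ∧ ∃ C : ℝ, 0 < C ∧
      ∀ n : ℕ, n₀ < n → ∀ t : ℝ, 0 ≤ t → Rβ n t ≤ C := by
  have hT1 : ∀ n t, Λbar n t ≤ 1 := fun n t => by
    rw [hΛbar]; exact ENNReal.toReal_le_of_le_ofReal zero_le_one (by simpa using prob_le_one)
  have hT0 : ∀ n t, 0 ≤ Λbar n t := fun n t => by rw [hΛbar]; exact ENNReal.toReal_nonneg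
  have hTanti : ∀ n, Antitone (Λbar n) := by
    intro n x y hxy
    rw [hΛbar, hΛbar]
    exact ENNReal.toReal_mono (measure_ne_top _ _) (measure_mono (Ioi_subset_Ioi hxy))
  have hTm : ∀ n, Measurable (Λbar n) := fun n => (hTanti n).measurable
  have hfun : ∀ n, Λbar n = fun t => (Λ n (Ioi t)).toReal := fun n => funext (hΛbar n)
  have hM1 : ∀ n, IntegrableOn (Λbar n) (Ioi 0) ∧
      ∫ t in Ioi (0:ℝ), Λbar n t = ∫ t, t ∂(Λ n) := by
    intro n
    have := aux_moment (Λ n) (hΛsupp n) 1 one_pos (by simpa using hmom1 n)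
    rw [hfun]
    simpa using this
  have hM2 : ∀ n, IntegrableOn (fun t => t * Λbar n t) (Ioi 0) ∧
      ∫ t in Ioi (0:ℝ), t * Λbar n t = (1/2) * ∫ t, t ^ 2 ∂(Λ n) := by
    intro n
    have := aux_moment (Λ n) (hΛsupp n) 2 two_pos (by simpa using hmom2 n)
    norm_num at this
    rw [hfun]
    refine ⟨this.1, ?_⟩
    rw [← this.2]; ring
  have hstar2 : IntegrableOn (fun t : ℝ => t * (Λstar (Ioi t)).toReal) (Ioi 0) := by
    have hnn : ∀ᵐ t ∂Λstar, 0 ≤ t := by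
      rw [ae_iff]; simpa [Iio_def] using hstar_supp
    have h2 : Integrable (fun t : ℝ => t ^ (2:ℝ)) Λstar := by
      refine Integrable.mono' ((integrable_const (1:ℝ)).add hstar_mom)
        (by fun_prop) ?_
      filter_upwards [hnn] with t ht
      rw [Real.norm_of_nonneg (Real.rpow_nonneg ht _)]
      simp only [Pi.add_apply]
      have hpos := Real.rpow_nonneg ht (2 * α)
      rcases le_total t 1 with h | h
      · have := Real.rpow_le_one ht h (by norm_num : (0:ℝ) ≤ 2)
        linarith
      · have := Real.rpow_le_rpow_of_exponent_le h (by linarith [hα.1] : (2:ℝ) ≤ 2 * α)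
        linarith
    have := (aux_moment Λstar hstar_supp 2 two_pos h2).1
    norm_num at this
    exact this
  have hD : Tendsto (fun n => ∫ t in Ioi (0:ℝ),
      (β * t - γ n * (1 - Real.exp (-(β * t) / γ n))) * Λbar n t) atTop (nhds 0) := by
    rw [show nhds (0:ℝ) = nhds (∫ _t in Ioi (0:ℝ), (0:ℝ)) by simp]
    have hlow : ∀ n t, 0 ≤ t → 0 ≤ β * t - γ n * (1 - Real.exp (-(β * t) / γ n)) := by
      intro n t ht
      have h1 := Real.add_one_le_exp (-(β * t) / γ n)
      have h2 : γ n * (1 - Real.exp (-(β * t) / γ n)) ≤ γ n * (β * t / γ n) := by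
        refine mul_le_mul_of_nonneg_left ?_ (hγ_pos n).le
        rw [neg_div] at *
        linarith
      rw [mul_div_cancel₀ _ (hγ_pos n).ne'] at h2
      linarith
    refine tendsto_integral_of_dominated_convergence
      (fun t => β * C₀ * (t * (Λstar (Ioi t)).toReal)) ?_ (hstar2.const_mul _) ?_ ?_
    · intro n
      have := hTm n
      exact Measurable.aestronglyMeasurable (by fun_prop)
    · intro n
      refine (ae_restrict_iff' measurableSet_Ioi).2 (Eventually.of_forall fun t ht => ?_)
      have ht' : 0 ≤ t := le_of_lt ht
      rw [Real.norm_of_nonneg (mul_nonneg (hlow n t ht') (hT0 n t))]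
      have h1 : Real.exp (-(β * t) / γ n) ≤ 1 := by
        rw [Real.exp_le_one_iff]
        exact div_nonpos_of_nonpos_of_nonneg (by nlinarith) (hγ_pos n).le
      have h2 : 0 ≤ γ n * (1 - Real.exp (-(β * t) / γ n)) :=
        mul_nonneg (hγ_pos n).le (by linarith)
      calc _ ≤ (β * t) * (C₀ * (Λstar (Ioi t)).toReal) :=
            mul_le_mul (by linarith) (hdom n t ht') (hT0 n t) (mul_nonneg hβ ht')
        _ = _ := by ring
    · refine (ae_restrict_iff' measurableSet_Ioi).2 (Eventually.of_forall fun t ht => ?_)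
      have ht' : 0 ≤ t := le_of_lt ht
      have hlim : Tendsto (fun n => (β * t) ^ 2 / γ n) atTop (nhds 0) :=
        hγ_top.const_div_atTop _
      refine squeeze_zero' (Eventually.of_forall fun n => mul_nonneg (hlow n t ht') (hT0 n t)) ?_ hlim
      filter_upwards [hγ_top.eventually_ge_atTop (β * t)] with n hn
      have hg := hγ_pos n
      have hbt : 0 ≤ β * t := mul_nonneg hβ ht'
      have hx : |(-(β * t) / γ n)| ≤ 1 := by
        rw [abs_div, abs_neg, abs_of_nonneg hbt, abs_of_pos hg]
        exact (div_le_one hg).2 hn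
      have h1 := le_of_abs_le (Real.abs_exp_sub_one_sub_id_le hx)
      have h2 := mul_le_mul_of_nonneg_left h1 hg.le
      have e1 : γ n * (Real.exp (-(β * t) / γ n) - 1 - -(β * t) / γ n)
        = β * t - γ n * (1 - Real.exp (-(β * t) / γ n)) := by
        field_simp; ring
      have e2 : γ n * (-(β * t) / γ n) ^ 2 = (β * t) ^ 2 / γ n := by
        field_simp
      rw [e1, e2] at h2
      exact (mul_le_of_le_one_right (hlow n t ht') (hT1 n t)).trans h2
  have hβm : ∀ n, Measurable (Λbarβ n) := by
    intro n
    have := hTm n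
    rw [funext (hΛbarβ n)]
    fun_prop
  have hβ0 : ∀ n t, 0 ≤ Λbarβ n t := fun n t => by
    rw [hΛbarβ]; exact mul_nonneg (Real.exp_pos _).le (hT0 n t)
  have hexp : ∀ n t, 0 ≤ t → Real.exp (-(β * t) / γ n) ≤ 1 := by
    intro n t ht
    rw [Real.exp_le_one_iff]
    exact div_nonpos_of_nonpos_of_nonneg (by nlinarith) (hγ_pos n).le
  have hβi : ∀ n, IntegrableOn (Λbarβ n) (Ioi 0) := by
    intro n
    refine Integrable.mono' (hM1 n).1 (hβm n).aestronglyMeasurable ?_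
    refine (ae_restrict_iff' measurableSet_Ioi).2 (Eventually.of_forall fun t ht => ?_)
    rw [Real.norm_of_nonneg (hβ0 n t), hΛbarβ]
    exact mul_le_of_le_one_left (hT0 n t) (hexp n t (le_of_lt ht))
  have hDe : ∀ n, ∫ t in Ioi (0:ℝ), (β * t - γ n * (1 - Real.exp (-(β * t) / γ n))) * Λbar n t
      = β * ((1/2) * ∫ t, t ^ 2 ∂(Λ n)) - γ n * (∫ t, t ∂(Λ n)) + γ n * ηβ n := by
    intro n
    have e : ∀ t, (β * t - γ n * (1 - Real.exp (-(β * t) / γ n))) * Λbar n t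
      = β * (t * Λbar n t) - γ n * Λbar n t + γ n * Λbarβ n t := by
      intro t; rw [hΛbarβ]; ring
    simp_rw [e]
    rw [integral_add, integral_sub, integral_const_mul, integral_const_mul, integral_const_mul,
      (hM2 n).2, (hM1 n).2, hηβ]
    · exact (hM2 n).1.const_mul _
    · exact (hM1 n).1.const_mul _
    · exact ((hM2 n).1.const_mul _).sub ((hM1 n).1.const_mul _)
    · exact (hβi n).const_mul _
  have ha_lim : Tendsto (fun n => lam n * m n) atTop (nhds lam0) := by
    simpa using hlam_lim.mul hm_lim
  have hfin : Tendsto (fun n => γ n * (1 - lam n * m n * ηβ n)) atTop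
      (nhds (bm + lam0 * (β * σ0 - 0))) := by
    have := hγ_lim.add (ha_lim.mul ((hsec_lim.const_mul β).sub hD))
    refine this.congr fun n => ?_
    rw [hDe]; ring
  have hpos : 0 < bm + lam0 * (β * σ0 - 0) := by
    have : bm + lam0 * (β * σ0 - 0) = bm + β * σ0 * lam0 := by ring
    rw [this]; exact hbm_pos
  have hev := (hfin.eventually (lt_mem_nhds hpos)).and
    (ha_lim.eventually (gt_mem_nhds (lt_add_one lam0)))
  obtain ⟨n₁, hn₁⟩ := eventually_atTop.1 hev
  refine ⟨n₁ + 1, by omega, 7 * (lam0 + 1), by positivity, fun n hn t ht => ?_⟩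
  obtain ⟨h1, h2⟩ := hn₁ n (by omega)
  have ha : 0 < lam n * m n := mul_pos (hlam_pos n) (hm_pos n)
  rw [hRβ]
  refine aux_resolvent (Λbarβ n) (hβm n) (hβ0 n) ?_ ?_ _ _ ha h2.le ?_ t ht
  · intro x y hx hxy
    rw [hΛbarβ, hΛbarβ]
    refine mul_le_mul (Real.exp_le_exp.2 ?_) (hTanti n hxy) (hT0 n y) (Real.exp_pos _).le
    refine div_le_div_of_nonneg_right ?_ (hγ_pos n).le
    nlinarith
  · intro x hx
    rw [hΛbarβ]
    exact mul_le_one₀ (hexp n x hx) (hT0 n x) (hT1 n x)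
  · rw [← ofReal_integral_eq_lintegral_ofReal ((hβi n).const_mul _)
      (Eventually.of_forall fun x => mul_nonneg ha.le (hβ0 n x)), integral_const_mul, ← hηβ]
    refine ENNReal.ofReal_le_one.2 ?_
    have := (pos_iff_pos_of_mul_pos h1).1 (hγ_pos n)
    linarith
end

section
/- The limit lim_{n→∞} ∫₀^∞ R_β⁽ⁿ⁾(γₙ t) dt = 1/(b+m+βσλ) holds (in particular this limit is finite). Moreover, there exist a constant C > 0 and an integer n₀ ≥ 1 such that for every n > n₀ and every real κ ≥ 1, ∫₀^∞ (R_β⁽ⁿ⁾(γₙ t))^κ dt ≤ C^κ. -/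
open MeasureTheory Filter Set

open scoped ENNReal

noncomputable def Kit (G : ℝ → ℝ≥0∞) : ℕ → ℝ → ℝ≥0∞
  | 0 => G
  | (k + 1) => fun t => ∫⁻ s, Kit G k (t - s) * G s

theorem Kit_meas (G : ℝ → ℝ≥0∞) (hG : Measurable G) (k : ℕ) : Measurable (Kit G k) := by
  induction k with
  | zero => exact hG
  | succ k ih =>
    have : Measurable (fun p : ℝ × ℝ => Kit G k (p.1 - p.2) * G p.2) := by fun_prop
    exact this.lintegral_prod_right'

theorem Kit_neg (G : ℝ → ℝ≥0∞) (h0 : ∀ t < 0, G t = 0) (k : ℕ) : ∀ t < 0, Kit G k t = 0 := by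
  induction k with
  | zero => exact h0
  | succ k ih =>
    intro t ht
    show ∫⁻ s, Kit G k (t - s) * G s = 0
    rw [← lintegral_zero (μ := (volume : Measure ℝ))]
    congr 1
    ext s
    by_cases hs : s < 0
    · simp [h0 s hs]
    · rw [ih (t - s) (by linarith)]; simp

theorem Kit_bdd (G : ℝ → ℝ≥0∞) (hG : Measurable G) (A : ℝ≥0∞) (hA : ∀ t, G t ≤ A) (k : ℕ) :
    ∀ t, Kit G k t ≤ A * (∫⁻ s, G s) ^ k := by
  induction k with
  | zero => intro t; simpa [Kit] using hA t
  | succ k ih =>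
    intro t
    show ∫⁻ s, Kit G k (t - s) * G s ≤ _
    calc ∫⁻ s, Kit G k (t - s) * G s ≤ ∫⁻ s, (A * (∫⁻ s, G s) ^ k) * G s := by
          gcongr; exact ih _
      _ = _ := by rw [lintegral_const_mul _ hG, pow_succ, mul_assoc]

theorem Kit_int (G : ℝ → ℝ≥0∞) (hG : Measurable G) (k : ℕ) :
    ∫⁻ t, Kit G k t = (∫⁻ s, G s) ^ (k + 1) := by
  induction k with
  | zero => simp [Kit]
  | succ k ih =>
    show ∫⁻ t, ∫⁻ s, Kit G k (t - s) * G s = _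
    have hm := Kit_meas G hG k
    have h2 : Measurable (fun p : ℝ × ℝ => Kit G k (p.1 - p.2) * G p.2) := by fun_prop
    rw [lintegral_lintegral_swap (by exact h2.aemeasurable)]
    calc ∫⁻ s, ∫⁻ t, Kit G k (t - s) * G s = ∫⁻ s, (∫⁻ t, Kit G k t) * G s := by
          congr 1; ext s
          rw [lintegral_mul_const _ (by fun_prop), lintegral_sub_right_eq_self (Kit G k) s]
      _ = _ := by rw [lintegral_const_mul _ hG, ih, ← pow_succ]

noncomputable def RR (G : ℝ → ℝ≥0∞) (t : ℝ) : ℝ≥0∞ := ∑' k, Kit G k t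

theorem RR_meas (G : ℝ → ℝ≥0∞) (hG : Measurable G) : Measurable (RR G) :=
  Measurable.tsum (Kit_meas G hG)

theorem RR_int (G : ℝ → ℝ≥0∞) (hG : Measurable G) :
    ∫⁻ t, RR G t = (∫⁻ s, G s) * (1 - ∫⁻ s, G s)⁻¹ := by
  unfold RR
  rw [lintegral_tsum (fun k => (Kit_meas G hG k).aemeasurable)]
  simp_rw [Kit_int G hG, pow_succ']
  rw [ENNReal.tsum_mul_left, ENNReal.tsum_geometric]

theorem RR_neg (G : ℝ → ℝ≥0∞) (h0 : ∀ t < 0, G t = 0) : ∀ t < 0, RR G t = 0 := by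
  intro t ht
  simp [RR, Kit_neg G h0 _ t ht]

theorem RR_eq (G : ℝ → ℝ≥0∞) (hG : Measurable G) (t : ℝ) :
    RR G t = G t + ∫⁻ s, RR G (t - s) * G s := by
  unfold RR
  simp_rw [← ENNReal.tsum_mul_right]
  rw [lintegral_tsum (fun k => by have := Kit_meas G hG k; fun_prop),
    tsum_eq_zero_add' ENNReal.summable]
  rfl

theorem window (G : ℝ → ℝ≥0∞) (hG : Measurable G) (h0 : ∀ t < 0, G t = 0)
    (A : ℝ) (hA0 : 0 < A) (hA : ∀ t, G t ≤ ENNReal.ofReal A) (h1 : ∫⁻ s, G s < 1) (t : ℝ) :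
    ∫⁻ u in Ioc (t - 1 / (2 * A)) t, RR G u ≤ 2 := by
  have hδ : 0 < 1 / (2 * A) := by positivity
  set δ := 1 / (2 * A) with hδdef
  have hRm := RR_meas G hG
  have hfin : ∫⁻ t, RR G t ≠ ∞ := by
    rw [RR_int G hG]
    refine ENNReal.mul_ne_top (h1.trans ENNReal.one_lt_top).ne ?_
    exact ENNReal.inv_ne_top.2 (tsub_pos_of_lt h1).ne'
  have hIfin : ∀ x, ∫⁻ u in Iic x, RR G u ≠ ∞ := fun x =>
    ne_top_of_le_ne_top hfin (setLIntegral_le_lintegral _ _)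
  set I : ℝ → ℝ≥0∞ := fun x => ∫⁻ u in Iic x, RR G u with hI
  have hImono : Monotone I := fun x y hxy => lintegral_mono_set (Iic_subset_Iic.2 hxy)
  -- integrated Volterra equation
  have hvol : I t = (∫⁻ u in Iic t, G u) + ∫⁻ s, I (t - s) * G s := by
    have h2 : Measurable (fun p : ℝ × ℝ => RR G (p.1 - p.2) * G p.2) := by fun_prop
    calc I t = ∫⁻ u in Iic t, (G u + ∫⁻ s, RR G (u - s) * G s) := by
          simp only [hI]; congr 1; ext u; exact RR_eq G hG u
      _ = (∫⁻ u in Iic t, G u) + ∫⁻ u in Iic t, ∫⁻ s, RR G (u - s) * G s := by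
          rw [lintegral_add_left hG]
      _ = _ := by
          rw [lintegral_lintegral_swap (by exact h2.aemeasurable)]
          congr 2; ext s
          rw [lintegral_mul_const _ (by fun_prop)]
          congr 1
          simp only [hI]
          rw [← lintegral_indicator measurableSet_Iic, ← lintegral_indicator measurableSet_Iic,
            ← lintegral_sub_right_eq_self (indicator (Iic (t - s)) _) s]
          congr 1; ext u
          simp only [indicator, mem_Iic, sub_le_sub_iff_right]
  set p := ∫⁻ s in Iio δ, G s with hp
  set q := ∫⁻ s in Ici δ, G s with hq
  have hpq : p + q = ∫⁻ s, G s := by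
    have := lintegral_add_compl (μ := volume) G (measurableSet_Iio (a := δ))
    rwa [compl_Iio] at this
  have hp2 : p ≤ ENNReal.ofReal (1/2) := by
    have : p = ∫⁻ s in Ico 0 δ, G s := by
      rw [hp, ← lintegral_indicator measurableSet_Iio, ← lintegral_indicator measurableSet_Ico]
      congr 1; ext s
      by_cases hs : s < 0
      · simp [indicator, h0 s hs]
      · simp [indicator, not_lt.1 hs]
    rw [this]
    calc ∫⁻ s in Ico 0 δ, G s ≤ ∫⁻ s in Ico 0 δ, ENNReal.ofReal A := by gcongr; exact hA _
      _ = ENNReal.ofReal (1/2) := by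
        rw [setLIntegral_const, Real.volume_Ico, ← ENNReal.ofReal_mul hA0.le]
        congr 1; rw [hδdef]; field_simp; norm_num
  have hineq : I t ≤ 1 + (I t * p + I (t - δ) * q) := by
    refine hvol.le.trans (add_le_add ?_ ?_)
    · exact (setLIntegral_le_lintegral _ _).trans h1.le
    · rw [← lintegral_add_compl _ (measurableSet_Iio (a := δ)), compl_Iio, hp, hq,
        ← lintegral_const_mul _ hG, ← lintegral_const_mul _ hG]
      gcongr ?_ + ?_
      · refine lintegral_mono fun s => ?_
        by_cases hs : s < 0
        · simp [h0 s hs]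
        · gcongr
          exact hImono (by linarith)
      · refine setLIntegral_mono (by fun_prop) fun s hs => ?_
        gcongr
        exact hImono (by linarith [mem_Ici.1 hs])
  have hsplit : I t = I (t - δ) + ∫⁻ u in Ioc (t - δ) t, RR G u := by
    rw [hI]
    simp only
    rw [← lintegral_union measurableSet_Ioc]
    · rw [Iic_union_Ioc_eq_Iic (by linarith)]
    · rw [Set.disjoint_left]; intro x hx hx2; exact absurd hx2.1 (not_lt.2 hx)
  set W := ∫⁻ u in Ioc (t - δ) t, RR G u with hW
  have hWfin : W ≠ ∞ := ne_top_of_le_ne_top hfin (setLIntegral_le_lintegral _ _)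
  have hJfin := hIfin (t - δ)
  have hJ' : I (t - δ) ≠ ∞ := hJfin
  have hpfin : p ≠ ∞ := ne_top_of_le_ne_top ENNReal.ofReal_ne_top hp2
  have hq1 : p + q ≤ 1 := by rw [hpq]; exact h1.le
  have hqfin : q ≠ ∞ := ne_top_of_le_ne_top ENNReal.one_ne_top (le_trans le_add_self hq1)
  rw [hsplit] at hineq
  generalize I (t - δ) = J at *
  clear_value W p q
  lift W to NNReal using hWfin
  lift p to NNReal using hpfin
  lift q to NNReal using hqfin
  lift J to NNReal using hJ'
  norm_cast at hineq hq1 ⊢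
  have hp3 : (p : ℝ) ≤ 1/2 := by
    have := ENNReal.toReal_mono ENNReal.ofReal_ne_top hp2
    rwa [ENNReal.toReal_ofReal (by norm_num), ENNReal.coe_toReal] at this
  rw [← NNReal.coe_le_coe] at hineq hq1 ⊢
  push_cast at *
  have hJ0 := J.2
  have hW0 := W.2
  nlinarith [mul_nonneg J.coe_nonneg (sub_nonneg.2 hq1), mul_nonneg W.coe_nonneg (sub_nonneg.2 hp3)]

theorem RR_sup (G : ℝ → ℝ≥0∞) (hG : Measurable G) (h0 : ∀ t < 0, G t = 0)
    (hanti : AntitoneOn G (Ici 0))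
    (A : ℝ) (hA0 : 0 < A) (hA : ∀ t, G t ≤ ENNReal.ofReal A) (h1 : ∫⁻ s, G s < 1) (t : ℝ) :
    RR G t ≤ ENNReal.ofReal (7 * A) := by
  have hδ : 0 < 1 / (2 * A) := by positivity
  have hw := window G hG h0 A hA0 hA h1 t
  set δ := 1 / (2 * A) with hδdef
  have hRm := RR_meas G hG
  have h2A : ENNReal.ofReal (2 * A) * ENNReal.ofReal δ = 1 := by
    rw [← ENNReal.ofReal_mul (by positivity), hδdef]
    rw [mul_one_div_cancel (by positivity)]; simp
  have hpt : ∀ s, G s ≤ (Ico 0 δ).indicator (fun _ => ENNReal.ofReal A) s +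
      ENNReal.ofReal (2 * A) * ∫⁻ r in Ioc 0 δ, G (s - r) := by
    intro s
    by_cases hs : s < 0
    · simp [h0 s hs]
    by_cases hs2 : s < δ
    · rw [indicator_of_mem (show s ∈ Ico 0 δ from ⟨not_lt.1 hs, hs2⟩)]
      exact (hA s).trans le_self_add
    · refine le_trans ?_ le_add_self
      calc G s = ENNReal.ofReal (2 * A) * ∫⁻ r in Ioc 0 δ, G s := by
            rw [setLIntegral_const, Real.volume_Ioc, sub_zero, mul_comm (G s), ← mul_assoc, h2A,
              one_mul]
        _ ≤ _ := by
            refine mul_le_mul_right ?_ _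
            refine setLIntegral_mono (hG.comp (measurable_const.sub measurable_id)) fun r hr => ?_
            exact hanti (by simp only [mem_Ici]; linarith [hr.2])
              (by simp only [mem_Ici]; linarith) (by linarith [hr.1])
  have hB : ∫⁻ s, RR G (t - s) * (Ico 0 δ).indicator (fun _ => ENNReal.ofReal A) s ≤
      2 * ENNReal.ofReal A := by
    calc _ = (∫⁻ u in Ioc (t - δ) t, RR G u) * ENNReal.ofReal A := by
          rw [← lintegral_mul_const _ hRm, ← lintegral_indicator measurableSet_Ioc,
            ← lintegral_sub_left_eq_self (indicator (Ioc (t - δ) t) _) t]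
          congr 1; ext s
          by_cases hs : s ∈ Ico 0 δ
          · rw [indicator_of_mem hs, indicator_of_mem]
            exact ⟨by linarith [hs.2], by linarith [hs.1]⟩
          · rw [indicator_of_notMem hs, indicator_of_notMem, mul_zero]
            intro h; exact hs ⟨by linarith [h.2], by linarith [h.1]⟩
      _ ≤ _ := by gcongr
  have hC : ∫⁻ s, RR G (t - s) * ∫⁻ r in Ioc 0 δ, G (s - r) ≤ 2 := by
    have h2 : Measurable (fun p : ℝ × ℝ => RR G (t - p.1) * G (p.1 - p.2)) := by fun_prop
    calc ∫⁻ s, RR G (t - s) * ∫⁻ r in Ioc 0 δ, G (s - r)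
        = ∫⁻ s, ∫⁻ r in Ioc 0 δ, RR G (t - s) * G (s - r) := by
          congr 1; ext s; rw [lintegral_const_mul _ (by fun_prop)]
      _ = ∫⁻ r in Ioc 0 δ, ∫⁻ s, RR G (t - s) * G (s - r) := by
          rw [lintegral_lintegral_swap (by exact h2.aemeasurable)]
      _ = ∫⁻ r in Ioc 0 δ, ∫⁻ s, RR G (t - r - s) * G s := by
          congr 1; ext r
          rw [← lintegral_sub_right_eq_self (fun s => RR G (t - r - s) * G s) r]
          congr 1; ext s; congr 2; ring
      _ ≤ ∫⁻ r in Ioc 0 δ, RR G (t - r) := by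
          gcongr with r
          rw [RR_eq G hG (t - r)]
          exact le_add_self
      _ = ∫⁻ u in Ico (t - δ) t, RR G u := by
          rw [← lintegral_indicator measurableSet_Ioc, ← lintegral_indicator measurableSet_Ico,
            ← lintegral_sub_left_eq_self (indicator (Ico (t - δ) t) _) t]
          congr 1; ext s
          by_cases hs : s ∈ Ioc 0 δ
          · rw [indicator_of_mem hs, indicator_of_mem]
            exact ⟨by linarith [hs.2], by linarith [hs.1]⟩
          · rw [indicator_of_notMem hs, indicator_of_notMem]
            intro h; exact hs ⟨by linarith [h.2], by linarith [h.1]⟩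
      _ = ∫⁻ u in Ioc (t - δ) t, RR G u := setLIntegral_congr Ico_ae_eq_Ioc
      _ ≤ 2 := hw
  have hm3 : Measurable (fun s => ∫⁻ r in Ioc 0 δ, G (s - r)) := by
    have : Measurable (fun p : ℝ × ℝ => G (p.1 - p.2)) := by fun_prop
    exact this.lintegral_prod_right'
  rw [RR_eq G hG t]
  calc G t + ∫⁻ s, RR G (t - s) * G s
      ≤ ENNReal.ofReal A + ∫⁻ s, (RR G (t - s) * (Ico 0 δ).indicator (fun _ => ENNReal.ofReal A) s
        + ENNReal.ofReal (2 * A) * (RR G (t - s) * ∫⁻ r in Ioc 0 δ, G (s - r))) := by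
        gcongr with s
        · exact hA t
        · refine (mul_le_mul_right (hpt s) _).trans (le_of_eq ?_)
          rw [mul_add, mul_left_comm]
    _ = ENNReal.ofReal A + ((∫⁻ s, RR G (t - s) * (Ico 0 δ).indicator (fun _ => ENNReal.ofReal A) s)
        + ENNReal.ofReal (2 * A) * ∫⁻ s, (RR G (t - s) * ∫⁻ r in Ioc 0 δ, G (s - r))) := by
        rw [lintegral_add_right, lintegral_const_mul]
        · fun_prop
        · fun_prop
    _ ≤ ENNReal.ofReal A + (2 * ENNReal.ofReal A + ENNReal.ofReal (2 * A) * 2) := by gcongr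
    _ = ENNReal.ofReal (7 * A) := by
        have : (2 : ℝ≥0∞) = ENNReal.ofReal 2 := by simp
        rw [this, ← ENNReal.ofReal_mul (by norm_num), ← ENNReal.ofReal_mul (by positivity),
          ← ENNReal.ofReal_add (by positivity) (by positivity),
          ← ENNReal.ofReal_add (by positivity) (by positivity)]
        congr 1; ring

theorem Kit_conv (f : ℝ → ℝ) (hf : Measurable f) (a B : ℝ) (ha : 0 ≤ a)
    (hf0 : ∀ t, 0 ≤ t → 0 ≤ f t) (hfB : ∀ t, 0 ≤ t → f t ≤ B) (G : ℝ → ℝ≥0∞)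
    (hG : G = (Ici 0).indicator (fun t => ENNReal.ofReal (a * f t)))
    (hfin : ∫⁻ s, G s ≠ ∞) (k : ℕ) :
    ∀ t, 0 ≤ t → a ^ (k + 1) * convIter f k t = (Kit G k t).toReal := by
  have hGm : Measurable G := by
    rw [hG]; exact Measurable.indicator (by fun_prop) measurableSet_Ici
  have hG0 : ∀ t < 0, G t = 0 := by
    intro t ht; rw [hG, indicator_of_notMem]; simpa using ht
  have hGpos : ∀ t, 0 ≤ t → G t = ENNReal.ofReal (a * f t) := by
    intro t ht; rw [hG, indicator_of_mem]; exact ht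
  have hGB : ∀ t, G t ≤ ENNReal.ofReal (a * B) := by
    intro t
    by_cases ht : t < 0
    · simp [hG0 t ht]
    · rw [hGpos t (not_lt.1 ht)]
      exact ENNReal.ofReal_le_ofReal (mul_le_mul_of_nonneg_left (hfB t (not_lt.1 ht)) ha)
  have hKfin : ∀ k t, Kit G k t < ∞ := fun k t =>
    (Kit_bdd G hGm _ hGB k t).trans_lt
      (ENNReal.mul_lt_top ENNReal.ofReal_lt_top (ENNReal.pow_lt_top hfin.lt_top))
  induction k with
  | zero =>
    intro t ht
    simp only [zero_add, pow_one, convIter, Kit]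
    rw [hGpos t ht, ENNReal.toReal_ofReal (mul_nonneg ha (hf0 t ht))]
  | succ k ih =>
    intro t ht
    have hKm := Kit_meas G hGm k
    show a ^ (k + 1 + 1) * (∫ s in (0:ℝ)..t, convIter f k (t - s) * f s)
      = (∫⁻ s, Kit G k (t - s) * G s).toReal
    rw [intervalIntegral.integral_of_le ht, ← integral_const_mul]
    calc ∫ s in Ioc 0 t, a ^ (k + 1 + 1) * (convIter f k (t - s) * f s)
        = ∫ s in Ioc 0 t, (Kit G k (t - s) * G s).toReal := by
          refine setIntegral_congr_fun measurableSet_Ioc fun s hs => ?_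
          rw [ENNReal.toReal_mul, ← ih (t - s) (by linarith [hs.2]), hGpos s hs.1.le,
            ENNReal.toReal_ofReal (mul_nonneg ha (hf0 s hs.1.le))]
          ring
      _ = (∫⁻ s in Ioc 0 t, Kit G k (t - s) * G s).toReal := by
          refine integral_toReal (by fun_prop) (ae_of_all _ fun s => ?_)
          refine ENNReal.mul_lt_top (hKfin _ _) ?_
          exact (hGB s).trans_lt ENNReal.ofReal_lt_top
      _ = (∫⁻ s, Kit G k (t - s) * G s).toReal := by
          congr 1
          rw [setLIntegral_congr (Ioc_ae_eq_Icc), ← lintegral_indicator measurableSet_Icc]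
          congr 1; ext s
          by_cases hs : s ∈ Icc 0 t
          · rw [indicator_of_mem hs]
          · rw [indicator_of_notMem hs]
            by_cases h : s < 0
            · simp [hG0 s h]
            · have : t - s < 0 := by
                by_contra h'
                exact hs ⟨not_lt.1 h, by linarith⟩
              rw [Kit_neg G hG0 k _ this]; simp

/-- Real-valued summary of the resolvent facts. -/
theorem resolvent_facts (f : ℝ → ℝ) (hf : Antitone f) (hf0 : ∀ t, 0 ≤ f t) (hf1 : f 0 ≤ 1)
    (a : ℝ) (ha : 0 < a) (hint : IntegrableOn f (Ioi 0)) (h1 : a * ∫ t in Ioi (0:ℝ), f t < 1) :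
    (∀ t, 0 ≤ t → 0 ≤ resolventFn a f t ∧ resolventFn a f t ≤ 7 * a) ∧
    IntegrableOn (resolventFn a f) (Ioi 0) ∧
    ∫ t in Ioi (0:ℝ), resolventFn a f t =
      (a * ∫ t in Ioi (0:ℝ), f t) / (1 - a * ∫ t in Ioi (0:ℝ), f t) := by
  have hfm : Measurable f := hf.measurable
  have hfB : ∀ t, 0 ≤ t → f t ≤ 1 := fun t ht => (hf ht).trans hf1
  obtain ⟨G, hG⟩ : ∃ G : ℝ → ℝ≥0∞, G = (Ici 0).indicator (fun t => ENNReal.ofReal (a * f t)) :=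
    ⟨_, rfl⟩
  have hGm : Measurable G := by
    rw [hG]; exact Measurable.indicator (by fun_prop) measurableSet_Ici
  have hG0 : ∀ t < 0, G t = 0 := by
    intro t ht; rw [hG, indicator_of_notMem]; simpa using ht
  have hGpos : ∀ t, 0 ≤ t → G t = ENNReal.ofReal (a * f t) := by
    intro t ht; rw [hG, indicator_of_mem]; exact ht
  have hGB : ∀ t, G t ≤ ENNReal.ofReal a := by
    intro t
    by_cases ht : t < 0
    · simp [hG0 t ht]
    · rw [hGpos t (not_lt.1 ht)]
      exact ENNReal.ofReal_le_ofReal (by nlinarith [hfB t (not_lt.1 ht)])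
  have hanti : AntitoneOn G (Ici 0) := by
    intro x hx y hy hxy
    rw [hGpos x hx, hGpos y hy]
    exact ENNReal.ofReal_le_ofReal (mul_le_mul_of_nonneg_left (hf hxy) ha.le)
  have hGint : ∫⁻ s, G s = ENNReal.ofReal (a * ∫ t in Ioi (0:ℝ), f t) := by
    rw [hG, lintegral_indicator measurableSet_Ici, ← setLIntegral_congr Ioi_ae_eq_Ici,
      ← integral_const_mul, ofReal_integral_eq_lintegral_ofReal (hint.const_mul a)]
    exact ae_of_all _ fun t => mul_nonneg ha.le (hf0 t)
  set r := a * ∫ t in Ioi (0:ℝ), f t with hr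
  have hr0 : 0 ≤ r := mul_nonneg ha.le (integral_nonneg hf0)
  have hG1 : ∫⁻ s, G s < 1 := by
    rw [hGint]; exact ENNReal.ofReal_lt_one.2 h1
  have hGfin : ∫⁻ s, G s ≠ ∞ := (hG1.trans ENNReal.one_lt_top).ne
  have hres : ∀ t, 0 ≤ t → resolventFn a f t = (RR G t).toReal := by
    intro t ht
    unfold resolventFn RR
    rw [ENNReal.tsum_toReal_eq]
    · congr 1; ext k
      exact Kit_conv f hfm a 1 ha.le (fun t _ => hf0 t) hfB G hG hGfin k t ht
    · intro k
      exact ((Kit_bdd G hGm _ hGB k t).trans_lt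
        (ENNReal.mul_lt_top ENNReal.ofReal_lt_top (ENNReal.pow_lt_top hGfin.lt_top))).ne
  have hsup := RR_sup G hGm hG0 hanti a ha hGB hG1
  have hRint := RR_int G hGm
  have hRIoi : ∫⁻ t in Ioi 0, RR G t = ENNReal.ofReal (r / (1 - r)) := by
    have : ∫⁻ t in Ioi 0, RR G t = ∫⁻ t, RR G t := by
      rw [setLIntegral_congr Ioi_ae_eq_Ici, ← lintegral_indicator measurableSet_Ici]
      congr 1; ext t
      by_cases ht : t < 0
      · rw [RR_neg G hG0 t ht, indicator_of_notMem]; simpa using ht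
      · rw [indicator_of_mem]; exact not_lt.1 ht
    rw [this, hRint, hGint, div_eq_mul_inv, ENNReal.ofReal_mul hr0,
      ENNReal.ofReal_inv_of_pos (by linarith), ENNReal.ofReal_sub _ hr0, ENNReal.ofReal_one]
  have hRm := RR_meas G hGm
  refine ⟨fun t ht => ?_, ?_, ?_⟩
  · rw [hres t ht]
    exact ⟨ENNReal.toReal_nonneg, ENNReal.toReal_le_of_le_ofReal (by positivity) (hsup t)⟩
  · have : IntegrableOn (fun t => (RR G t).toReal) (Ioi 0) := by
      refine integrable_toReal_of_lintegral_ne_top hRm.aemeasurable ?_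
      rw [hRIoi]; exact ENNReal.ofReal_ne_top
    exact this.congr_fun (fun t ht => (hres t (le_of_lt ht)).symm) measurableSet_Ioi
  · rw [setIntegral_congr_fun measurableSet_Ioi (fun t ht => hres t (le_of_lt ht)),
      integral_toReal hRm.aemeasurable
        (ae_of_all _ fun t => (hsup t).trans_lt ENNReal.ofReal_lt_top), hRIoi,
      ENNReal.toReal_ofReal (div_nonneg hr0 (by linarith))]

theorem tail_gen (μ : Measure ℝ) [IsProbabilityMeasure μ] (hs : μ (Iio 0) = 0) (g H : ℝ → ℝ)
    (hg : Continuous g) (hg0 : ∀ t, 0 < t → 0 ≤ g t) (hH : ∀ x, 0 ≤ x → ∫ t in (0:ℝ)..x, g t = H x)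
    (hHi : Integrable H μ) :
    IntegrableOn (fun t => g t * (μ (Ioi t)).toReal) (Ioi 0) ∧
    ∫ t in Ioi (0:ℝ), g t * (μ (Ioi t)).toReal = ∫ t, H t ∂μ := by
  have hpos : ∀ᵐ x ∂μ, 0 ≤ x := by
    rw [ae_iff]; simpa [Iio] using hs
  have hHpos : ∀ᵐ x ∂μ, 0 ≤ H x := by
    filter_upwards [hpos] with x hx
    rw [← hH x hx, intervalIntegral.integral_of_le hx]
    exact setIntegral_nonneg measurableSet_Ioc fun t ht => hg0 t ht.1
  have key := lintegral_comp_eq_lintegral_meas_lt_mul (f := fun x => x) (g := g) μ hpos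
    measurable_id.aemeasurable (fun t _ => hg.intervalIntegrable _ _)
    ((ae_restrict_iff' measurableSet_Ioi).2 (ae_of_all _ fun t ht => hg0 t ht))
  have h1 : ∫⁻ x, ENNReal.ofReal (∫ t in (0:ℝ)..x, g t) ∂μ = ENNReal.ofReal (∫ x, H x ∂μ) := by
    rw [ofReal_integral_eq_lintegral_ofReal hHi hHpos]
    refine lintegral_congr_ae ?_
    filter_upwards [hpos] with x hx
    rw [hH x hx]
  have h2 : ∫⁻ t in Ioi 0, ENNReal.ofReal (g t * (μ (Ioi t)).toReal)
      = ENNReal.ofReal (∫ x, H x ∂μ) := by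
    rw [← h1, key]
    refine setLIntegral_congr_fun measurableSet_Ioi fun t ht => ?_
    rw [ENNReal.ofReal_mul (hg0 t ht), ENNReal.ofReal_toReal (measure_ne_top _ _), mul_comm]
    rfl
  have hm : Measurable (fun t => (μ (Ioi t)).toReal) := by
    refine Antitone.measurable fun x y hxy => ?_
    exact ENNReal.toReal_mono (measure_ne_top _ _) (measure_mono (Ioi_subset_Ioi hxy))
  have hm2 : Measurable (fun t => g t * (μ (Ioi t)).toReal) := hg.measurable.mul hm
  have hnn : 0 ≤ᵐ[volume.restrict (Ioi 0)] (fun t => g t * (μ (Ioi t)).toReal) :=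
    (ae_restrict_iff' measurableSet_Ioi).2
      (ae_of_all _ fun t ht => mul_nonneg (hg0 t ht) ENNReal.toReal_nonneg)
  constructor
  · refine ⟨hm2.aestronglyMeasurable, ?_⟩
    rw [hasFiniteIntegral_iff_ofReal hnn, h2]
    exact ENNReal.ofReal_lt_top
  · rw [integral_eq_lintegral_of_nonneg_ae hnn hm2.aestronglyMeasurable, h2,
      ENNReal.toReal_ofReal (integral_nonneg_of_ae hHpos)]

theorem tail_one (μ : Measure ℝ) [IsProbabilityMeasure μ] (hs : μ (Iio 0) = 0)
    (hi : Integrable (fun t => t) μ) :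
    IntegrableOn (fun t => (μ (Ioi t)).toReal) (Ioi 0) ∧
    ∫ t in Ioi (0:ℝ), (μ (Ioi t)).toReal = ∫ t, t ∂μ := by
  simpa using tail_gen μ hs (fun _ => 1) (fun t => t) continuous_const (fun _ _ => zero_le_one)
    (fun x _ => by simp) hi

theorem tail_two (μ : Measure ℝ) [IsProbabilityMeasure μ] (hs : μ (Iio 0) = 0)
    (hi : Integrable (fun t => t ^ 2) μ) :
    IntegrableOn (fun t => t * (μ (Ioi t)).toReal) (Ioi 0) ∧
    ∫ t in Ioi (0:ℝ), t * (μ (Ioi t)).toReal = (1 / 2) * ∫ t, t ^ 2 ∂μ := by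
  rw [← integral_const_mul]
  exact tail_gen μ hs (fun t => t) (fun t => 1 / 2 * t ^ 2) continuous_id (fun _ h => h.le)
    (fun x _ => by rw [integral_id]; ring) (hi.const_mul _)

theorem exp_bound (x g : ℝ) (hx : 0 ≤ x) (hg : 0 < g) :
    0 ≤ x - g * (1 - Real.exp (-x / g)) ∧ x - g * (1 - Real.exp (-x / g)) ≤ x ∧
    x - g * (1 - Real.exp (-x / g)) ≤ x ^ 2 / g := by
  obtain ⟨y, rfl⟩ : ∃ y, x = g * y := ⟨x / g, by field_simp⟩
  have hy : 0 ≤ y := by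
    by_contra h
    nlinarith [mul_neg_of_pos_of_neg hg (not_le.1 h)]
  have e1 : -(g * y) / g = -y := by field_simp
  rw [e1]
  have h1 := Real.add_one_le_exp (-y)
  have h2 := Real.add_one_le_exp y
  have h3 : Real.exp (-y) ≤ 1 := Real.exp_le_one_iff.2 (by linarith)
  have h4 : Real.exp (-y) * Real.exp y = 1 := by rw [← Real.exp_add]; simp
  have h6 := Real.exp_pos (-y)
  have h5 : Real.exp (-y) ≤ 1 - y + y ^ 2 := by
    have h7 : Real.exp (-y) * (1 + y) ≤ 1 := by
      rw [← h4]; gcongr; linarith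
    have h8 : Real.exp (-y) ≤ 1 / (1 + y) := by rwa [le_div_iff₀ (by linarith)]
    refine h8.trans ?_
    rw [div_le_iff₀ (by linarith)]
    nlinarith [pow_nonneg hy 3]
  have e2 : (g * y) ^ 2 / g = g * y ^ 2 := by field_simp
  rw [e2]
  refine ⟨?_, ?_, ?_⟩ <;> nlinarith

theorem stmt6
    (β α : ℝ) (hβ : 0 ≤ β) (hα : α ∈ Set.Ioo (1:ℝ) 2)
    (Λ : ℕ → Measure ℝ) (hΛprob : ∀ n, IsProbabilityMeasure (Λ n))
    (hΛsupp : ∀ n, Λ n (Set.Iio 0) = 0)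
    (lam m γ : ℕ → ℝ)
    (hlam_pos : ∀ n, 0 < lam n) (hm_pos : ∀ n, 0 < m n) (hγ_pos : ∀ n, 0 < γ n)
    (hγ_top : Tendsto γ atTop atTop)
    (Λbar : ℕ → ℝ → ℝ) (hΛbar : ∀ n t, Λbar n t = (Λ n (Set.Ioi t)).toReal)
    (Λbarβ : ℕ → ℝ → ℝ)
    (hΛbarβ : ∀ n t, Λbarβ n t = Real.exp (-(β * t) / γ n) * Λbar n t)
    (ηβ : ℕ → ℝ) (hηβ : ∀ n, ηβ n = ∫ t in Set.Ioi (0:ℝ), Λbarβ n t)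
    (lam0 η0 σ0 bm : ℝ) (hlam0 : 0 < lam0) (hη0 : 0 < η0) (hσ0 : 0 < σ0)
    (hbm_pos : 0 < bm + β * σ0 * lam0)
    (hmom1 : ∀ n, Integrable (fun t => t) (Λ n))
    (hmom2 : ∀ n, Integrable (fun t => t ^ 2) (Λ n))
    (hlam_lim : Tendsto lam atTop (nhds lam0))
    (hm_lim : Tendsto m atTop (nhds 1))
    (hmean_lim : Tendsto (fun n => ∫ t, t ∂(Λ n)) atTop (nhds η0))
    (hsec_lim : Tendsto (fun n => (1/2) * ∫ t, t ^ 2 ∂(Λ n)) atTop (nhds σ0))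
    (hγ_lim : Tendsto (fun n => γ n * (1 - lam n * m n * ∫ t, t ∂(Λ n))) atTop (nhds bm))
    (C₀ : ℝ) (hC₀ : 0 < C₀)
    (Λstar : Measure ℝ) (hstar_prob : IsProbabilityMeasure Λstar)
    (hstar_supp : Λstar (Set.Iio 0) = 0)
    (hstar_mom : Integrable (fun t => t ^ (2 * α)) Λstar)
    (hdom : ∀ n, ∀ t : ℝ, 0 ≤ t → Λbar n t ≤ C₀ * (Λstar (Set.Ioi t)).toReal)
    (Rβ : ℕ → ℝ → ℝ) (hRβ : ∀ n t, Rβ n t = resolventFn (lam n * m n) (Λbarβ n) t)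
 :
    Tendsto (fun n => ∫ t in Set.Ioi (0:ℝ), Rβ n (γ n * t)) atTop
        (nhds (1 / (bm + β * σ0 * lam0))) ∧
      ∃ C : ℝ, 0 < C ∧ ∃ n₀ : ℕ, 1 ≤ n₀ ∧ ∀ n : ℕ, n₀ < n → ∀ κ : ℝ, 1 ≤ κ →
        (∫ t in Set.Ioi (0:ℝ), (Rβ n (γ n * t)) ^ κ) ≤ C ^ κ := by
  have htail_anti : ∀ n, Antitone (Λbar n) := by
    intro n x y hxy
    rw [hΛbar, hΛbar]
    have := hΛprob n
    exact ENNReal.toReal_mono (measure_ne_top _ _) (measure_mono (Ioi_subset_Ioi hxy))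
  have htail0 : ∀ n t, 0 ≤ Λbar n t := by
    intro n t; rw [hΛbar]; exact ENNReal.toReal_nonneg
  have htail1 : ∀ n t, Λbar n t ≤ 1 := by
    intro n t; rw [hΛbar]
    have := hΛprob n
    exact ENNReal.toReal_le_of_le_ofReal zero_le_one (by simpa using prob_le_one)
  have hβanti : ∀ n, Antitone (Λbarβ n) := by
    intro n x y hxy
    rw [hΛbarβ, hΛbarβ]
    refine mul_le_mul (Real.exp_le_exp.2 ?_) (htail_anti n hxy) (htail0 n y) (Real.exp_pos _).le
    have := hγ_pos n
    gcongr
  have hβ0 : ∀ n t, 0 ≤ Λbarβ n t := by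
    intro n t; rw [hΛbarβ]; exact mul_nonneg (Real.exp_pos _).le (htail0 n t)
  have hβ1 : ∀ n, Λbarβ n 0 ≤ 1 := by
    intro n; rw [hΛbarβ]; simpa using htail1 n 0
  have hT1 : ∀ n, IntegrableOn (Λbar n) (Ioi 0) ∧
      ∫ t in Ioi (0:ℝ), Λbar n t = ∫ t, t ∂(Λ n) := by
    intro n
    have := hΛprob n
    have h := tail_one (Λ n) (hΛsupp n) (hmom1 n)
    have e : Λbar n = fun t => (Λ n (Ioi t)).toReal := funext (hΛbar n)
    rw [e]; exact h
  have hT2 : ∀ n, IntegrableOn (fun t => t * Λbar n t) (Ioi 0) ∧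
      ∫ t in Ioi (0:ℝ), t * Λbar n t = (1 / 2) * ∫ t, t ^ 2 ∂(Λ n) := by
    intro n
    have := hΛprob n
    have h := tail_two (Λ n) (hΛsupp n) (hmom2 n)
    have e : Λbar n = fun t => (Λ n (Ioi t)).toReal := funext (hΛbar n)
    rw [e]; exact h
  have hβint : ∀ n, IntegrableOn (Λbarβ n) (Ioi 0) := by
    intro n
    refine Integrable.mono' (hT1 n).1 (hβanti n).measurable.aestronglyMeasurable ?_
    refine (ae_restrict_iff' measurableSet_Ioi).2 (ae_of_all _ fun t ht => ?_)
    rw [Real.norm_of_nonneg (hβ0 n t), hΛbarβ]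
    refine mul_le_of_le_one_left (htail0 n t) (Real.exp_le_one_iff.2 ?_)
    have h1 : 0 ≤ β * t := mul_nonneg hβ (le_of_lt ht)
    exact div_nonpos_of_nonpos_of_nonneg (by linarith) (hγ_pos n).le
  have hstar2 : Integrable (fun t => t ^ 2) Λstar := by
    refine Integrable.mono' ((integrable_const (1:ℝ)).add hstar_mom) (by fun_prop) ?_
    have hpos : ∀ᵐ x ∂Λstar, 0 ≤ x := by
      rw [ae_iff]; simpa [Iio] using hstar_supp
    filter_upwards [hpos] with x hx
    rw [Real.norm_of_nonneg (by positivity)]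
    simp only [Pi.add_apply]
    have hx2 : 0 ≤ x ^ (2 * α) := Real.rpow_nonneg hx _
    by_cases h : x ≤ 1
    · nlinarith
    · have : x ^ (2:ℝ) ≤ x ^ (2 * α) :=
        Real.rpow_le_rpow_of_exponent_le (not_le.1 h).le (by linarith [hα.1])
      rw [Real.rpow_two] at this
      linarith
  have hS2 := (tail_two Λstar hstar_supp hstar2).1
  -- dominated convergence
  have hDCT : Tendsto (fun n => ∫ t in Ioi (0:ℝ),
      (β * t - γ n * (1 - Real.exp (-(β * t) / γ n))) * Λbar n t) atTop (nhds 0) := by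
    have h := tendsto_integral_of_dominated_convergence (μ := volume.restrict (Ioi (0:ℝ)))
      (F := fun n t => (β * t - γ n * (1 - Real.exp (-(β * t) / γ n))) * Λbar n t)
      (f := fun _ => (0:ℝ)) (fun t => (β * C₀) * (t * (Λstar (Ioi t)).toReal))
      (fun n => by
        have := (htail_anti n).measurable
        exact Measurable.aestronglyMeasurable (by fun_prop))
      (hS2.const_mul _)
      (fun n => by
        refine (ae_restrict_iff' measurableSet_Ioi).2 (ae_of_all _ fun t ht => ?_)
        have ht' : 0 ≤ t := le_of_lt ht
        have h1 : 0 ≤ β * t := mul_nonneg hβ ht'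
        obtain ⟨e1, e2, e3⟩ := exp_bound (β * t) (γ n) h1 (hγ_pos n)
        rw [Real.norm_of_nonneg (mul_nonneg e1 (htail0 n t))]
        calc _ ≤ (β * t) * (C₀ * (Λstar (Ioi t)).toReal) :=
              mul_le_mul e2 (hdom n t ht') (htail0 n t) h1
          _ = _ := by ring)
      (by
        refine (ae_restrict_iff' measurableSet_Ioi).2 (ae_of_all _ fun t ht => ?_)
        have ht' : 0 ≤ t := le_of_lt ht
        have h1 : 0 ≤ β * t := mul_nonneg hβ ht'
        have hlim : Tendsto (fun n => (β * t) ^ 2 / γ n) atTop (nhds 0) :=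
          hγ_top.const_div_atTop _
        refine tendsto_of_tendsto_of_tendsto_of_le_of_le tendsto_const_nhds hlim
          (fun n => ?_) (fun n => ?_)
        · exact mul_nonneg (exp_bound (β * t) (γ n) h1 (hγ_pos n)).1 (htail0 n t)
        · obtain ⟨e1, e2, e3⟩ := exp_bound (β * t) (γ n) h1 (hγ_pos n)
          exact (mul_le_of_le_one_right e1 (htail1 n t)).trans e3)
    simpa using h
  have hDeq : ∀ n, ∫ t in Ioi (0:ℝ),
      (β * t - γ n * (1 - Real.exp (-(β * t) / γ n))) * Λbar n t =
      β * ((1/2) * ∫ t, t ^ 2 ∂(Λ n)) - γ n * ((∫ t, t ∂(Λ n)) - ηβ n) := by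
    intro n
    have hsub : Integrable (fun t => γ n * (Λbar n t - Λbarβ n t)) (volume.restrict (Ioi 0)) :=
      ((hT1 n).1.sub (hβint n)).const_mul _
    rw [hηβ n, ← (hT1 n).2, ← (hT2 n).2, ← integral_sub (hT1 n).1 (hβint n),
      ← integral_const_mul, ← integral_const_mul,
      ← integral_sub ((hT2 n).1.const_mul _) hsub]
    congr 1; ext t
    rw [hΛbarβ]; ring
  have ha_lim : Tendsto (fun n => lam n * m n) atTop (nhds lam0) := by
    simpa using hlam_lim.mul hm_lim
  have hd_lim : Tendsto (fun n => γ n * (1 - lam n * m n * ηβ n)) atTop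
      (nhds (bm + β * σ0 * lam0)) := by
    have h1 := (hsec_lim.const_mul β).sub hDCT
    have h2 := hγ_lim.add (ha_lim.mul h1)
    have e : bm + lam0 * (β * σ0 - 0) = bm + β * σ0 * lam0 := by ring
    rw [e] at h2
    refine h2.congr fun n => ?_
    rw [hDeq n]; ring
  have hr_lim : Tendsto (fun n => lam n * m n * ηβ n) atTop (nhds 1) := by
    have h1 := tendsto_const_nhds (x := (1:ℝ)).sub (hd_lim.div_atTop hγ_top)
    rw [sub_zero] at h1
    refine h1.congr fun n => ?_
    have := (hγ_pos n).ne'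
    field_simp
    ring
  have hev : ∀ᶠ n in atTop, lam n * m n * ηβ n < 1 := by
    filter_upwards [hd_lim.eventually (lt_mem_nhds hbm_pos)] with n hn
    have := (pos_iff_pos_of_mul_pos hn).1 (hγ_pos n)
    linarith
  have hRfun : ∀ n, Rβ n = resolventFn (lam n * m n) (Λbarβ n) := fun n => funext (hRβ n)
  have hfacts : ∀ n, lam n * m n * ηβ n < 1 →
      (∀ t, 0 ≤ t → 0 ≤ Rβ n t ∧ Rβ n t ≤ 7 * (lam n * m n)) ∧
      IntegrableOn (Rβ n) (Ioi 0) ∧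
      ∫ t in Ioi (0:ℝ), Rβ n t = (lam n * m n * ηβ n) / (1 - lam n * m n * ηβ n) := by
    intro n hn
    rw [hRfun n, hηβ n]
    rw [hηβ n] at hn
    exact resolvent_facts (Λbarβ n) (hβanti n) (hβ0 n) (hβ1 n) (lam n * m n)
      (mul_pos (hlam_pos n) (hm_pos n)) (hβint n) hn
  have hscale : ∀ n, ∫ t in Ioi (0:ℝ), Rβ n (γ n * t) = (γ n)⁻¹ * ∫ t in Ioi (0:ℝ), Rβ n t := by
    intro n
    rw [integral_comp_mul_left_Ioi (Rβ n) 0 (hγ_pos n), mul_zero, smul_eq_mul]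
  have hmain : Tendsto (fun n => ∫ t in Ioi (0:ℝ), Rβ n (γ n * t)) atTop
      (nhds (1 / (bm + β * σ0 * lam0))) := by
    refine (hr_lim.div hd_lim hbm_pos.ne').congr' ?_
    filter_upwards [hev] with n hn
    rw [hscale n, (hfacts n hn).2.2]
    have h1 := (hγ_pos n).ne'
    have h2 : 1 - lam n * m n * ηβ n ≠ 0 := by linarith
    simp only [Pi.div_apply]
    field_simp
  refine ⟨hmain, ?_⟩
  set L := 1 / (bm + β * σ0 * lam0) with hL
  have hL0 : 0 < L := by positivity
  have hC1 : 1 ≤ max 1 (max (7 * (lam0 + 1)) (L + 1)) := le_max_left _ _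
  set C := max 1 (max (7 * (lam0 + 1)) (L + 1)) with hC
  have hC2 : 7 * (lam0 + 1) ≤ C := (le_max_left _ _).trans (le_max_right _ _)
  have hC3 : L + 1 ≤ C := (le_max_right _ _).trans (le_max_right _ _)
  have hC0 : 0 < C := by linarith
  have hev2 : ∀ᶠ n in atTop, lam n * m n < lam0 + 1 :=
    ha_lim.eventually (gt_mem_nhds (by linarith))
  have hev3 : ∀ᶠ n in atTop, ∫ t in Ioi (0:ℝ), Rβ n (γ n * t) < L + 1 :=
    hmain.eventually (gt_mem_nhds (by linarith))
  obtain ⟨N, hN⟩ := eventually_atTop.1 (hev.and (hev2.and hev3))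
  refine ⟨C, hC0, N + 1, by omega, fun n hn κ hκ => ?_⟩
  obtain ⟨h1, h2, h3⟩ := hN n (by omega)
  obtain ⟨f1, f2, f3⟩ := hfacts n h1
  have hγn := hγ_pos n
  have hint : IntegrableOn (fun t => Rβ n (γ n * t)) (Ioi 0) := by
    rw [integrableOn_Ioi_comp_mul_left_iff _ _ hγn, mul_zero]; exact f2
  calc ∫ t in Ioi (0:ℝ), (Rβ n (γ n * t)) ^ κ
      ≤ ∫ t in Ioi (0:ℝ), C ^ (κ - 1) * Rβ n (γ n * t) := by
        refine integral_mono_of_nonneg ?_ (hint.const_mul _) ?_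
        · refine (ae_restrict_iff' measurableSet_Ioi).2 (ae_of_all _ fun t ht => ?_)
          exact Real.rpow_nonneg (f1 _ (mul_nonneg hγn.le (le_of_lt ht))).1 _
        · refine (ae_restrict_iff' measurableSet_Ioi).2 (ae_of_all _ fun t ht => ?_)
          obtain ⟨g1, g2⟩ := f1 _ (mul_nonneg hγn.le (le_of_lt ht))
          have g3 : Rβ n (γ n * t) ≤ C := by linarith
          simp only
          generalize Rβ n (γ n * t) = x at *
          rcases g1.eq_or_lt with h0 | h0
          · rw [← h0, Real.zero_rpow (by linarith)]; simp
          · calc x ^ κ = x ^ (κ - 1) * x := by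
                  rw [← Real.rpow_add_one h0.ne']; ring_nf
              _ ≤ C ^ (κ - 1) * x := by
                  gcongr
    _ = C ^ (κ - 1) * ∫ t in Ioi (0:ℝ), Rβ n (γ n * t) := by rw [integral_const_mul]
    _ ≤ C ^ (κ - 1) * C := by
        gcongr
        linarith
    _ = C ^ κ := by
        rw [← Real.rpow_add_one hC0.ne']; ring_nf
end

section
/- For every u ∈ ℝ, lim_{n→∞} ∫₀^∞ e^{iut} R_β⁽ⁿ⁾(γₙ t) dt = ∫₀^∞ e^{iut} (1/(σλ)) exp(−((b+m)/(σλ) + β) t) dt, i.e. the Fourier transforms of the rescaled resolvents converge pointwise to 1/(b+m+βσλ − i u σλ). -/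
open MeasureTheory Filter Set

theorem aux_conv (f : ℝ → ℝ) (hf0 : ∀ t, 0 ≤ f t) (hf : IntegrableOn f (Ioi 0)) (k : ℕ) :
    IntegrableOn (convIter f k) (Ioi 0) ∧ (∀ t, 0 ≤ t → 0 ≤ convIter f k t) := by
  induction k with
  | zero => exact ⟨hf, fun t _ => hf0 t⟩
  | succ k ih =>
    refine ⟨?_, ?_⟩
    · have h := (integrable_posConvolution (μ := volume) (ν := volume) hf ih.1
        (ContinuousLinearMap.mul ℝ ℝ))
      have h2 : IntegrableOn (posConvolution f (convIter f k) (ContinuousLinearMap.mul ℝ ℝ) volume)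
        (Ioi 0) := h.integrableOn
      refine h2.congr_fun ?_ measurableSet_Ioi
      intro t ht
      simp only [posConvolution, indicator_of_mem ht, convIter]
      congr 1
      ext s
      simp [mul_comm]
    · intro t ht
      simp only [convIter]
      apply intervalIntegral.integral_nonneg ht
      intro s hs
      exact mul_nonneg (ih.2 _ (by linarith [hs.2])) (hf0 s)

theorem aux_mul_int (f : ℝ → ℝ) (hf : IntegrableOn f (Ioi 0)) (w : ℝ) :
    IntegrableOn (fun t : ℝ => Complex.exp (Complex.I * w * t) * (f t : ℂ)) (Ioi 0) := by
  have h1 : IntegrableOn (fun t : ℝ => (f t : ℂ)) (Ioi 0) := Integrable.ofReal hf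
  refine Integrable.bdd_mul (c := 1) h1 ?_ ?_
  · exact (Continuous.aestronglyMeasurable (by fun_prop))
  · refine Eventually.of_forall fun t => ?_
    have : Complex.I * w * t = ((w * t : ℝ) : ℂ) * Complex.I := by push_cast; ring
    rw [this, Complex.norm_exp_ofReal_mul_I]

theorem aux_four (f : ℝ → ℝ) (hf0 : ∀ t, 0 ≤ f t) (hf : IntegrableOn f (Ioi 0)) (w : ℝ) (k : ℕ) :
    ∫ t in Ioi (0:ℝ), Complex.exp (Complex.I * w * t) * (convIter f k t : ℂ) =
      (∫ t in Ioi (0:ℝ), Complex.exp (Complex.I * w * t) * (f t : ℂ)) ^ (k + 1) := by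
  induction k with
  | zero => simp [convIter]
  | succ k ih =>
    rw [pow_succ', ← ih]
    have h := integral_posConvolution (μ := volume) (ν := volume) (aux_mul_int f hf w)
      (aux_mul_int _ (aux_conv f hf0 hf k).1 w) (ContinuousLinearMap.mul ℝ ℂ)
    simp only [ContinuousLinearMap.mul_apply'] at h
    rw [← h]
    congr 1
    ext t
    simp only [convIter]
    rw [← intervalIntegral.integral_ofReal, ← intervalIntegral.integral_const_mul]
    congr 1
    ext s
    have : Complex.exp (Complex.I * w * t) =
        Complex.exp (Complex.I * w * s) * Complex.exp (Complex.I * w * (t - s : ℝ)) := by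
      rw [← Complex.exp_add]; congr 1; push_cast; ring
    rw [this]; push_cast; ring

theorem aux_resolvent_s8 (f : ℝ → ℝ) (hf0 : ∀ t, 0 ≤ f t) (hf : IntegrableOn f (Ioi 0)) (w a : ℝ)
    (ha : 0 ≤ a) (hlt : a * (∫ t in Ioi (0:ℝ), f t) < 1) :
    ∫ t in Ioi (0:ℝ), Complex.exp (Complex.I * w * t) * (resolventFn a f t : ℂ) =
      (a * ∫ t in Ioi (0:ℝ), Complex.exp (Complex.I * w * t) * (f t : ℂ)) *
      (1 - a * ∫ t in Ioi (0:ℝ), Complex.exp (Complex.I * w * t) * (f t : ℂ))⁻¹ := by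
  set F := ∫ t in Ioi (0:ℝ), Complex.exp (Complex.I * w * t) * (f t : ℂ) with hF
  have hn1 : ∀ t : ℝ, ‖Complex.exp (Complex.I * w * t)‖ = 1 := by
    intro t
    have : Complex.I * w * t = ((w * t : ℝ) : ℂ) * Complex.I := by push_cast; ring
    rw [this, Complex.norm_exp_ofReal_mul_I]
  have hI0 : 0 ≤ ∫ t in Ioi (0:ℝ), f t := integral_nonneg hf0
  have hreal : ∀ k, ∫ t in Ioi (0:ℝ), convIter f k t = (∫ t in Ioi (0:ℝ), f t) ^ (k+1) := by
    intro k
    have := aux_four f hf0 hf 0 k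
    simp only [Complex.ofReal_zero, mul_zero, zero_mul, Complex.exp_zero, one_mul] at this
    rw [integral_complex_ofReal, integral_complex_ofReal] at this
    exact_mod_cast this
  have hFle : ‖(a:ℂ) * F‖ < 1 := by
    refine lt_of_le_of_lt ?_ hlt
    rw [norm_mul, Complex.norm_real, Real.norm_of_nonneg ha]
    refine mul_le_mul_of_nonneg_left ?_ ha
    refine (norm_integral_le_integral_norm _).trans (le_of_eq ?_)
    congr 1; ext t
    rw [norm_mul, hn1, one_mul, Complex.norm_real, Real.norm_of_nonneg (hf0 t)]
  have hs := hasSum_integral_of_summable_integral_norm (μ := volume.restrict (Ioi (0:ℝ)))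
    (F := fun (k:ℕ) (t:ℝ) => (a:ℂ)^(k+1) * (Complex.exp (Complex.I * w * t) * (convIter f k t : ℂ)))
    (fun k => (aux_mul_int _ (aux_conv f hf0 hf k).1 w).const_mul _) ?_
  · have h2 : ∀ k : ℕ, ∫ t in Ioi (0:ℝ), (a:ℂ)^(k+1) *
        (Complex.exp (Complex.I * w * t) * (convIter f k t : ℂ)) = (a * F) * (a * F) ^ k := by
      intro k
      rw [integral_const_mul, aux_four f hf0 hf w k]
      rw [← hF]; ring
    simp only [h2] at hs
    have h3 := (hasSum_geometric_of_norm_lt_one hFle).mul_left (a * F)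
    rw [← h3.unique hs |>.symm]
    congr 1; ext t
    simp only [resolventFn]
    rw [Complex.ofReal_tsum, ← tsum_mul_left]
    congr 1; ext k; push_cast; ring
  · have h4 : ∀ k : ℕ, ∫ t in Ioi (0:ℝ), ‖(a:ℂ)^(k+1) *
        (Complex.exp (Complex.I * w * t) * (convIter f k t : ℂ))‖
        = (a * ∫ t in Ioi (0:ℝ), f t) * (a * ∫ t in Ioi (0:ℝ), f t)^k := by
      intro k
      rw [← pow_succ', mul_pow, ← hreal, ← integral_const_mul]
      refine setIntegral_congr_fun measurableSet_Ioi ?_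
      intro t ht
      simp only
      rw [norm_mul, norm_mul, hn1, one_mul, Complex.norm_real, norm_pow, Complex.norm_real,
        Real.norm_of_nonneg ha, Real.norm_of_nonneg ((aux_conv f hf0 hf k).2 t (le_of_lt ht))]
    simp only [h4]
    exact (summable_geometric_of_lt_one (mul_nonneg ha hI0) hlt).mul_left _

theorem aux_tail_meas (μ : Measure ℝ) [IsProbabilityMeasure μ] :
    Measurable (fun t : ℝ => (μ (Ioi t)).toReal) := by
  apply Antitone.measurable
  intro s t hst
  exact ENNReal.toReal_mono (measure_ne_top _ _) (measure_mono (Ioi_subset_Ioi hst))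

theorem aux_tail (μ : Measure ℝ) [IsProbabilityMeasure μ] (h0 : μ (Iio 0) = 0) (p : ℝ) (hp : 0 < p)
    (hi : Integrable (fun t => t ^ p) μ) :
    IntegrableOn (fun t => t ^ (p - 1) * (μ (Ioi t)).toReal) (Ioi 0) ∧
    ∫ t, t ^ p ∂μ = p * ∫ t in Ioi (0:ℝ), t ^ (p-1) * (μ (Ioi t)).toReal := by
  have hnn : 0 ≤ᵐ[μ] (fun t : ℝ => t) := by
    rw [Filter.EventuallyLE, ae_iff]
    convert h0 using 2
    ext t; simp
  have key := lintegral_rpow_eq_lintegral_meas_lt_mul μ hnn aemeasurable_id' hp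
  have hnnp : 0 ≤ᵐ[μ] (fun t : ℝ => t ^ p) := by
    filter_upwards [hnn] with t ht using Real.rpow_nonneg ht p
  have e1 : ∫⁻ t in Ioi (0:ℝ), μ {a : ℝ | t < a} * ENNReal.ofReal (t ^ (p - 1)) =
      ∫⁻ t in Ioi (0:ℝ), ENNReal.ofReal (t ^ (p-1) * (μ (Ioi t)).toReal) := by
    refine setLIntegral_congr_fun measurableSet_Ioi ?_
    intro t ht
    simp only
    rw [ENNReal.ofReal_mul (Real.rpow_nonneg (le_of_lt ht) _),
      ENNReal.ofReal_toReal (measure_ne_top _ _), mul_comm]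
    rfl
  rw [e1, ← ofReal_integral_eq_lintegral_ofReal hi hnnp] at key
  have hm : AEStronglyMeasurable (fun t : ℝ => t ^ (p - 1) * (μ (Ioi t)).toReal)
      (volume.restrict (Ioi 0)) := by
    have := aux_tail_meas μ
    exact (Measurable.aestronglyMeasurable (by fun_prop))
  have hnn2 : 0 ≤ᵐ[volume.restrict (Ioi 0)] (fun t : ℝ => t ^ (p - 1) * (μ (Ioi t)).toReal) := by
    filter_upwards [ae_restrict_mem measurableSet_Ioi] with t ht
    exact mul_nonneg (Real.rpow_nonneg (le_of_lt ht) _) ENNReal.toReal_nonneg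
  have hint : IntegrableOn (fun t => t ^ (p - 1) * (μ (Ioi t)).toReal) (Ioi 0) := by
    refine ⟨hm, ?_⟩
    rw [hasFiniteIntegral_iff_ofReal hnn2]
    by_contra hcon
    rw [not_lt, top_le_iff] at hcon
    rw [hcon, ENNReal.mul_top (by simpa using hp)] at key
    exact ENNReal.ofReal_ne_top key
  refine ⟨hint, ?_⟩
  rw [← ofReal_integral_eq_lintegral_ofReal hint hnn2, ← ENNReal.ofReal_mul hp.le] at key
  exact (ENNReal.ofReal_eq_ofReal_iff (integral_nonneg_of_ae hnnp)
    (mul_nonneg hp.le (integral_nonneg_of_ae hnn2))).1 key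

theorem aux_exp_bound (z : ℂ) (hz : 0 ≤ z.re) : ‖1 - Complex.exp (-z)‖ ≤ 2 * ‖z‖ := by
  rcases le_total ‖z‖ 1 with h | h
  · have := Complex.norm_exp_sub_one_le (x := -z) (by simpa using h)
    rw [norm_sub_rev]; simpa using this
  · have h1 : ‖Complex.exp (-z)‖ ≤ 1 := by
      rw [Complex.norm_exp]; simpa using hz
    calc _ ≤ ‖(1:ℂ)‖ + ‖Complex.exp (-z)‖ := norm_sub_le _ _
      _ ≤ 2 * ‖z‖ := by rw [norm_one]; linarith

theorem aux_exp_tendsto (γ : ℕ → ℝ) (hγ : ∀ n, 0 < γ n) (hγ_top : Tendsto γ atTop atTop) (z : ℂ) :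
    Tendsto (fun n => (γ n : ℂ) * (1 - Complex.exp (-(z / γ n))) - z) atTop (nhds 0) := by
  have h0 : Tendsto (fun n => ‖z‖ ^ 2 * (γ n)⁻¹) atTop (nhds 0) := by
    simpa using (tendsto_inv_atTop_zero.comp hγ_top).const_mul (‖z‖^2)
  refine squeeze_zero_norm' ?_ h0
  filter_upwards [hγ_top.eventually_ge_atTop ‖z‖] with n hn
  have hg := hγ n
  have hgc : (γ n : ℂ) ≠ 0 := by exact_mod_cast hg.ne'
  have hnz : ‖-(z / γ n)‖ = ‖z‖ / γ n := by
    rw [norm_neg, norm_div, Complex.norm_real, Real.norm_of_nonneg hg.le]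
  have := Complex.norm_exp_sub_one_sub_id_le (x := -(z / γ n)) (by
    rw [hnz]; exact (div_le_one hg).2 hn)
  have e : (γ n : ℂ) * (1 - Complex.exp (-(z / γ n))) - z =
      -(γ n : ℂ) * (Complex.exp (-(z / γ n)) - 1 - -(z / γ n)) := by
    field_simp; ring
  rw [e, norm_mul, norm_neg, Complex.norm_real, Real.norm_of_nonneg hg.le]
  rw [hnz] at this
  calc _ ≤ γ n * (‖z‖ / γ n)^2 := mul_le_mul_of_nonneg_left this hg.le
    _ = _ := by field_simp

theorem aux_limit (Λ : ℕ → Measure ℝ) (hΛprob : ∀ n, IsProbabilityMeasure (Λ n))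
    (hΛsupp : ∀ n, Λ n (Set.Iio 0) = 0)
    (a γ : ℕ → ℝ) (hγ_pos : ∀ n, 0 < γ n)
    (hγ_top : Tendsto γ atTop atTop)
    (lam0 σ0 bm : ℝ)
    (hmom1 : ∀ n, Integrable (fun t => t) (Λ n))
    (hmom2 : ∀ n, Integrable (fun t => t ^ 2) (Λ n))
    (ha_lim : Tendsto a atTop (nhds lam0))
    (hsec_lim : Tendsto (fun n => (1/2) * ∫ t, t ^ 2 ∂(Λ n)) atTop (nhds σ0))
    (hγ_lim : Tendsto (fun n => γ n * (1 - a n * ∫ t, t ∂(Λ n))) atTop (nhds bm))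
    (C₀ : ℝ) (Λstar : Measure ℝ) (hstar_prob : IsProbabilityMeasure Λstar)
    (hstar_supp : Λstar (Set.Iio 0) = 0)
    (hstar_mom : Integrable (fun t => t ^ (2:ℝ)) Λstar)
    (hdom : ∀ n, ∀ t : ℝ, 0 ≤ t → (Λ n (Ioi t)).toReal ≤ C₀ * (Λstar (Set.Ioi t)).toReal)
    (w : ℂ) (hw : 0 ≤ w.re) :
    Tendsto (fun n => (γ n : ℂ) * (1 - a n * ∫ t in Ioi (0:ℝ),
      Complex.exp (-(w * t / γ n)) * ((Λ n (Ioi t)).toReal : ℂ))) atTop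
      (nhds (bm + lam0 * (w * σ0))) := by
  have T1 : ∀ n, IntegrableOn (fun t => (Λ n (Ioi t)).toReal) (Ioi 0) ∧
      ∫ t, t ∂(Λ n) = ∫ t in Ioi (0:ℝ), (Λ n (Ioi t)).toReal := by
    intro n
    have := aux_tail (Λ n) (hΛsupp n) 1 one_pos (by simpa using hmom1 n)
    simpa using this
  have T2 : ∀ n, IntegrableOn (fun t => t * (Λ n (Ioi t)).toReal) (Ioi 0) ∧
      (1/2) * ∫ t, t^2 ∂(Λ n) = ∫ t in Ioi (0:ℝ), t * (Λ n (Ioi t)).toReal := by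
    intro n
    have := aux_tail (Λ n) (hΛsupp n) 2 two_pos (by simpa using hmom2 n)
    have e : (2:ℝ) - 1 = 1 := by norm_num
    simp only [e, Real.rpow_one, Real.rpow_two] at this
    refine ⟨this.1, ?_⟩
    rw [this.2]; ring
  have T3 : IntegrableOn (fun t => t * (Λstar (Ioi t)).toReal) (Ioi 0) := by
    have := (aux_tail Λstar hstar_supp 2 two_pos hstar_mom).1
    have e : (2:ℝ) - 1 = 1 := by norm_num
    simpa only [e, Real.rpow_one] using this
  have hnormT : ∀ n t, ‖((Λ n (Ioi t)).toReal : ℂ)‖ = (Λ n (Ioi t)).toReal := by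
    intro n t
    rw [Complex.norm_real, Real.norm_of_nonneg ENNReal.toReal_nonneg]
  have hmeasT : ∀ n, Measurable (fun t => ((Λ n (Ioi t)).toReal : ℂ)) := fun n =>
    Complex.measurable_ofReal.comp (aux_tail_meas (Λ n))
  have D : Tendsto (fun n => ∫ t in Ioi (0:ℝ),
      ((γ n : ℂ) * (1 - Complex.exp (-(w * t / γ n))) - w * t) * ((Λ n (Ioi t)).toReal : ℂ)) atTop
      (nhds (∫ t in Ioi (0:ℝ), (0:ℂ))) := by
    refine tendsto_integral_of_dominated_convergence
      (fun t => 3 * ‖w‖ * C₀ * (t * (Λstar (Ioi t)).toReal)) ?_ (T3.const_mul _) ?_ ?_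
    · intro n
      have := hmeasT n
      exact (Measurable.aestronglyMeasurable (by fun_prop))
    · intro n
      filter_upwards [ae_restrict_mem measurableSet_Ioi] with t ht
      have ht' : 0 < t := ht
      have hg := hγ_pos n
      rw [norm_mul, hnormT]
      have b1 : ‖(γ n : ℂ) * (1 - Complex.exp (-(w * t / γ n))) - w * t‖ ≤ 3 * ‖w‖ * t := by
        have hz : 0 ≤ (w * t / γ n).re := by
          have : w * t / γ n = ((t / γ n : ℝ) : ℂ) * w := by push_cast; ring
          rw [this, Complex.re_ofReal_mul]; positivity
        have hb := aux_exp_bound _ hz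
        rw [norm_div, norm_mul, Complex.norm_real, Complex.norm_real, Real.norm_of_nonneg hg.le,
          Real.norm_of_nonneg ht'.le] at hb
        calc _ ≤ ‖(γ n : ℂ) * (1 - Complex.exp (-(w * t / γ n)))‖ + ‖w * t‖ := norm_sub_le _ _
          _ ≤ γ n * (2 * (‖w‖ * t / γ n)) + ‖w‖ * t := by
              rw [norm_mul, norm_mul, Complex.norm_real, Complex.norm_real,
                Real.norm_of_nonneg hg.le, Real.norm_of_nonneg ht'.le]
              gcongr
          _ = _ := by field_simp; ring
      calc _ ≤ (3 * ‖w‖ * t) * (C₀ * (Λstar (Ioi t)).toReal) := by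
            refine mul_le_mul b1 (hdom n t ht'.le) ENNReal.toReal_nonneg (by positivity)
        _ = _ := by ring
    · filter_upwards with t
      have h1 := aux_exp_tendsto γ hγ_pos hγ_top (w * t)
      refine squeeze_zero_norm (fun n => ?_) (tendsto_zero_iff_norm_tendsto_zero.1 h1)
      rw [norm_mul, hnormT]
      refine mul_le_of_le_one_right (norm_nonneg _) ?_
      exact ENNReal.toReal_le_of_le_ofReal zero_le_one (by simpa using prob_le_one)
  rw [integral_zero] at D
  have hA : Tendsto (fun n => (a n : ℂ)) atTop (nhds (lam0 : ℂ)) :=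
    (Complex.continuous_ofReal.tendsto _).comp ha_lim
  have hB : Tendsto (fun n => ((γ n * (1 - a n * ∫ t, t ∂(Λ n)) : ℝ) : ℂ)) atTop (nhds (bm : ℂ)) :=
    (Complex.continuous_ofReal.tendsto _).comp hγ_lim
  have hS : Tendsto (fun n => (((1/2) * ∫ t, t ^ 2 ∂(Λ n) : ℝ) : ℂ)) atTop (nhds (σ0 : ℂ)) :=
    (Complex.continuous_ofReal.tendsto _).comp hsec_lim
  have hfin := hB.add (hA.mul (D.add (hS.const_mul w)))
  rw [zero_add] at hfin
  refine hfin.congr fun n => ?_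
  have hg := hγ_pos n
  have I1 : Integrable (fun t => ((Λ n (Ioi t)).toReal : ℂ)) (volume.restrict (Ioi 0)) :=
    Integrable.ofReal (T1 n).1
  have I2 : Integrable (fun t : ℝ => (t:ℂ) * ((Λ n (Ioi t)).toReal : ℂ))
      (volume.restrict (Ioi 0)) := by
    have := Integrable.ofReal (𝕜 := ℂ) (T2 n).1
    simpa using this
  have I3 : Integrable (fun t : ℝ => Complex.exp (-(w * t / γ n)) * ((Λ n (Ioi t)).toReal : ℂ))
      (volume.restrict (Ioi 0)) := by
    refine Integrable.bdd_mul (c := 1) I1 ?_ ?_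
    · exact (Measurable.aestronglyMeasurable (by fun_prop))
    · filter_upwards [ae_restrict_mem measurableSet_Ioi] with t ht
      have ht' : 0 < t := ht
      have : -(w * t / γ n) = ((-(t / γ n) : ℝ) : ℂ) * w := by push_cast; ring
      rw [Complex.norm_exp, this, Complex.re_ofReal_mul, Real.exp_le_one_iff]
      have : 0 ≤ t / γ n * w.re := by positivity
      linarith
  have E : ∫ t in Ioi (0:ℝ),
      ((γ n : ℂ) * (1 - Complex.exp (-(w * t / γ n))) - w * t) * ((Λ n (Ioi t)).toReal : ℂ)
      = γ n * (∫ t in Ioi (0:ℝ), ((Λ n (Ioi t)).toReal : ℂ)) - γ n * (∫ t in Ioi (0:ℝ),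
      Complex.exp (-(w * t / γ n)) * ((Λ n (Ioi t)).toReal : ℂ))
      - w * ∫ t in Ioi (0:ℝ), (t:ℂ) * ((Λ n (Ioi t)).toReal : ℂ) := by
    rw [← integral_const_mul, ← integral_const_mul, ← integral_const_mul,
      ← integral_sub (I1.const_mul _) (I3.const_mul _)]
    refine Eq.trans ?_ (integral_sub ((I1.const_mul (γ n : ℂ)).sub (I3.const_mul (γ n : ℂ)))
      (I2.const_mul w))
    congr 1; ext t; ring
  have c1 : ∫ t in Ioi (0:ℝ), ((Λ n (Ioi t)).toReal : ℂ) = ((∫ t, t ∂(Λ n) : ℝ) : ℂ) := by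
    rw [(T1 n).2, integral_complex_ofReal]
  have c2 : ∫ t in Ioi (0:ℝ), (t:ℂ) * ((Λ n (Ioi t)).toReal : ℂ) =
      (((1/2) * ∫ t, t^2 ∂(Λ n) : ℝ) : ℂ) := by
    rw [(T2 n).2, ← integral_complex_ofReal]; simp
  rw [E, c1, c2]
  push_cast
  ring

theorem stmt8
    (β α : ℝ) (hβ : 0 ≤ β) (hα : α ∈ Set.Ioo (1:ℝ) 2)
    (Λ : ℕ → Measure ℝ) (hΛprob : ∀ n, IsProbabilityMeasure (Λ n))
    (hΛsupp : ∀ n, Λ n (Set.Iio 0) = 0)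
    (lam m γ : ℕ → ℝ)
    (hlam_pos : ∀ n, 0 < lam n) (hm_pos : ∀ n, 0 < m n) (hγ_pos : ∀ n, 0 < γ n)
    (hγ_top : Tendsto γ atTop atTop)
    (Λbar : ℕ → ℝ → ℝ) (hΛbar : ∀ n t, Λbar n t = (Λ n (Set.Ioi t)).toReal)
    (Λbarβ : ℕ → ℝ → ℝ)
    (hΛbarβ : ∀ n t, Λbarβ n t = Real.exp (-(β * t) / γ n) * Λbar n t)
    (ηβ : ℕ → ℝ) (hηβ : ∀ n, ηβ n = ∫ t in Set.Ioi (0:ℝ), Λbarβ n t)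
    (lam0 η0 σ0 bm : ℝ) (hlam0 : 0 < lam0) (hη0 : 0 < η0) (hσ0 : 0 < σ0)
    (hbm_pos : 0 < bm + β * σ0 * lam0)
    (hmom1 : ∀ n, Integrable (fun t => t) (Λ n))
    (hmom2 : ∀ n, Integrable (fun t => t ^ 2) (Λ n))
    (hlam_lim : Tendsto lam atTop (nhds lam0))
    (hm_lim : Tendsto m atTop (nhds 1))
    (hmean_lim : Tendsto (fun n => ∫ t, t ∂(Λ n)) atTop (nhds η0))
    (hsec_lim : Tendsto (fun n => (1/2) * ∫ t, t ^ 2 ∂(Λ n)) atTop (nhds σ0))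
    (hγ_lim : Tendsto (fun n => γ n * (1 - lam n * m n * ∫ t, t ∂(Λ n))) atTop (nhds bm))
    (C₀ : ℝ) (hC₀ : 0 < C₀)
    (Λstar : Measure ℝ) (hstar_prob : IsProbabilityMeasure Λstar)
    (hstar_supp : Λstar (Set.Iio 0) = 0)
    (hstar_mom : Integrable (fun t => t ^ (2 * α)) Λstar)
    (hdom : ∀ n, ∀ t : ℝ, 0 ≤ t → Λbar n t ≤ C₀ * (Λstar (Set.Ioi t)).toReal)
    (Rβ : ℕ → ℝ → ℝ) (hRβ : ∀ n t, Rβ n t = resolventFn (lam n * m n) (Λbarβ n) t)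
 :
    ∀ u : ℝ,
      Tendsto (fun n => ∫ t in Set.Ioi (0:ℝ),
          Complex.exp (Complex.I * u * t) * Complex.ofReal (Rβ n (γ n * t))) atTop
        (nhds (∫ t in Set.Ioi (0:ℝ), Complex.exp (Complex.I * u * t) *
          Complex.ofReal ((1 / (σ0 * lam0)) * Real.exp (-(bm / (σ0 * lam0) + β) * t)))) := by
  intro u
  set a : ℕ → ℝ := fun n => lam n * m n with ha
  have ha_lim : Tendsto a atTop (nhds lam0) := by simpa using hlam_lim.mul hm_lim
  have hstar2 : Integrable (fun t => t ^ (2:ℝ)) Λstar := by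
    have hnn : ∀ᵐ t ∂Λstar, (0:ℝ) ≤ t := by
      rw [ae_iff]
      convert hstar_supp using 2
      ext t; simp
    refine Integrable.mono' ((integrable_const (1:ℝ)).add hstar_mom)
      (Measurable.aestronglyMeasurable (by fun_prop)) ?_
    filter_upwards [hnn] with t ht
    rw [Real.norm_of_nonneg (Real.rpow_nonneg ht _)]
    simp only [Pi.add_apply]
    rcases le_total t 1 with h | h
    · have h1 := Real.rpow_le_one ht h (z := 2) (by norm_num)
      have h2 := Real.rpow_nonneg ht (2 * α)
      linarith
    · have h1 := Real.rpow_le_rpow_of_exponent_le h (y := 2) (z := 2 * α) (by linarith [hα.1])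
      linarith
  have hL := aux_limit Λ hΛprob hΛsupp a γ hγ_pos hγ_top lam0 σ0 bm hmom1 hmom2 ha_lim hsec_lim
    hγ_lim C₀ Λstar hstar_prob hstar_supp hstar2 (fun n t ht => by rw [← hΛbar]; exact hdom n t ht)
  have hL0 := hL (β : ℂ) (by simpa using hβ)
  have hL1 := hL (β - Complex.I * u) (by simpa using hβ)
  have hf0 : ∀ n t, 0 ≤ Λbarβ n t := by
    intro n t
    rw [hΛbarβ, hΛbar]; positivity
  have hfint : ∀ n, IntegrableOn (Λbarβ n) (Ioi 0) := by
    intro n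
    have h1 := (aux_tail (Λ n) (hΛsupp n) 1 one_pos (by simpa using hmom1 n)).1
    simp only [sub_self, Real.rpow_zero, one_mul] at h1
    have e : Λbarβ n = fun t => Real.exp (-(β * t) / γ n) * (Λ n (Ioi t)).toReal := by
      ext t; rw [hΛbarβ, hΛbar]
    rw [e]
    refine Integrable.bdd_mul (c := 1) h1 ?_ ?_
    · exact (Measurable.aestronglyMeasurable (by fun_prop))
    · filter_upwards [ae_restrict_mem measurableSet_Ioi] with t ht
      have ht' : 0 < t := ht
      have hg := hγ_pos n
      rw [Real.norm_of_nonneg (Real.exp_pos _).le, Real.exp_le_one_iff, neg_div]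
      have : 0 ≤ β * t / γ n := by positivity
      linarith
  have hF0 : ∀ n, ∫ t in Ioi (0:ℝ), Complex.exp (-((β:ℂ) * t / γ n)) * ((Λ n (Ioi t)).toReal : ℂ)
      = ((∫ t in Ioi (0:ℝ), Λbarβ n t : ℝ) : ℂ) := by
    intro n
    rw [← integral_complex_ofReal]
    congr 1; ext t
    rw [hΛbarβ, hΛbar, neg_div]; push_cast; rfl
  have hlt : ∀ᶠ n in atTop, a n * (∫ t in Ioi (0:ℝ), Λbarβ n t) < 1 := by
    have hre := (Complex.continuous_re.tendsto _).comp hL0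
    have hpos : 0 < ((bm:ℂ) + lam0 * (β * σ0)).re := by
      have : (bm:ℂ) + lam0 * (β * σ0) = ((bm + β * σ0 * lam0 : ℝ) : ℂ) := by push_cast; ring
      rw [this, Complex.ofReal_re]; exact hbm_pos
    filter_upwards [hre.eventually (lt_mem_nhds hpos)] with n hn
    simp only [Function.comp, hF0] at hn
    rw [← Complex.ofReal_one, ← Complex.ofReal_mul, ← Complex.ofReal_sub, ← Complex.ofReal_mul,
      Complex.ofReal_re] at hn
    have := pos_of_mul_pos_right hn (hγ_pos n).le
    linarith
  set F : ℕ → ℂ := fun n => ∫ t in Ioi (0:ℝ),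
    Complex.exp (-((β - Complex.I * u) * t / γ n)) * ((Λ n (Ioi t)).toReal : ℂ) with hF
  have hF1 : ∀ n, ∫ t in Ioi (0:ℝ), Complex.exp (Complex.I * (u / γ n : ℝ) * t) * (Λbarβ n t : ℂ)
      = F n := by
    intro n
    simp only [hF]
    congr 1; ext t
    rw [hΛbarβ, hΛbar, Complex.ofReal_mul, Complex.ofReal_exp, ← mul_assoc, ← Complex.exp_add]
    congr 2; push_cast; ring
  have hlimne : (bm:ℂ) + lam0 * ((β - Complex.I * u) * σ0) ≠ 0 := by
    intro h
    have := congrArg Complex.re h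
    simp at this
    nlinarith
  have hgi : Tendsto (fun n => ((γ n : ℂ))⁻¹) atTop (nhds 0) := by
    have := (Complex.continuous_ofReal.tendsto _).comp (tendsto_inv_atTop_zero.comp hγ_top)
    simpa [Function.comp_def] using this
  have haF : Tendsto (fun n => (a n : ℂ) * F n) atTop (nhds 1) := by
    have h := (hgi.mul hL1).const_sub 1
    rw [zero_mul, sub_zero] at h
    refine h.congr fun n => ?_
    have hgc : (γ n : ℂ) ≠ 0 := by exact_mod_cast (hγ_pos n).ne'
    rw [inv_mul_cancel_left₀ hgc]
    simp only [hF]; ring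
  have hmain := haF.mul (hL1.inv₀ hlimne)
  have hrhs : ∫ t in Set.Ioi (0:ℝ), Complex.exp (Complex.I * u * t) *
          Complex.ofReal ((1 / (σ0 * lam0)) * Real.exp (-(bm / (σ0 * lam0) + β) * t)) =
      1 * ((bm:ℂ) + lam0 * ((β - Complex.I * u) * σ0))⁻¹ := by
    set c : ℂ := Complex.I * u - (bm / (σ0 * lam0) + β) with hc
    have hcre : c.re < 0 := by
      have : c.re = -(bm / (σ0 * lam0) + β) := by
        have e : c = ((-(bm / (σ0 * lam0) + β) : ℝ) : ℂ) + Complex.I * u := by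
          rw [hc]; push_cast; ring
        rw [e]; simp only [Complex.add_re, Complex.ofReal_re]; simp
      rw [this]
      have e2 : bm / (σ0 * lam0) + β = (bm + β * σ0 * lam0) / (σ0 * lam0) := by field_simp
      rw [e2]
      have : 0 < (bm + β * σ0 * lam0) / (σ0 * lam0) := by positivity
      linarith
    have h1 : ∀ t : ℝ, Complex.exp (Complex.I * u * t) *
          Complex.ofReal ((1 / (σ0 * lam0)) * Real.exp (-(bm / (σ0 * lam0) + β) * t)) =
          (1 / (σ0 * lam0) : ℂ) * Complex.exp (c * t) := by
      intro t
      rw [Complex.ofReal_mul, Complex.ofReal_exp, mul_left_comm, ← Complex.exp_add]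
      congr 1
      · push_cast; ring
      · congr 1; rw [hc]; push_cast; ring
    simp only [h1]
    rw [integral_const_mul, integral_exp_mul_complex_Ioi hcre]
    have hc0 : c ≠ 0 := by intro h; rw [h] at hcre; simp at hcre
    have s0 : (σ0:ℂ) ≠ 0 := by exact_mod_cast hσ0.ne'
    have l0 : (lam0:ℂ) ≠ 0 := by exact_mod_cast hlam0.ne'
    have e3 : (bm:ℂ) + lam0 * ((β - Complex.I * u) * σ0) = (σ0 * lam0) * (-c) := by
      rw [hc]; field_simp; ring
    rw [e3]
    simp only [Complex.ofReal_zero, mul_zero, Complex.exp_zero, one_mul]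
    field_simp
  rw [hrhs]
  refine hmain.congr' ?_
  filter_upwards [hlt] with n hn
  have hg := hγ_pos n
  have hgc : (γ n : ℂ) ≠ 0 := by exact_mod_cast hg.ne'
  have hr := aux_resolvent_s8 (Λbarβ n) (hf0 n) (hfint n) (u / γ n) (a n)
    (mul_pos (hlam_pos n) (hm_pos n)).le hn
  rw [hF1] at hr
  have hcv := integral_comp_mul_left_Ioi (fun s : ℝ => Complex.exp (Complex.I * (u / γ n : ℝ) * s) *
    (resolventFn (a n) (Λbarβ n) s : ℂ)) 0 hg
  rw [mul_zero, hr] at hcv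
  have e4 : ∫ t in Set.Ioi (0:ℝ), Complex.exp (Complex.I * u * t) *
      Complex.ofReal (Rβ n (γ n * t)) = ∫ t in Set.Ioi (0:ℝ),
      Complex.exp (Complex.I * (u / γ n : ℝ) * (γ n * t : ℝ)) *
      (resolventFn (a n) (Λbarβ n) (γ n * t) : ℂ) := by
    congr 1; ext t
    rw [hRβ]
    congr 2
    push_cast; field_simp
  rw [e4, hcv, mul_inv, Complex.real_smul]
  push_cast
  ring
end

section
/- There exist a constant C > 0 and an integer n₀ ≥ 1 such that for every n ≥ n₀, every integer k ≥ 1 and every y = (y₁,…,y_k) ∈ [0,∞)^k, sup_{t ≥ 0} R_β⁽ⁿ⁾(t,k,y) ≤ C Σ_{j=1}^k (1 + y_j). -/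
open MeasureTheory Filter Set

noncomputable def resolventK (lamn γn β : ℝ) (R : ℝ → ℝ) {k : ℕ}
    (y : Fin k → ℝ) (t : ℝ) : ℝ :=
  lamn * Real.exp (-(β * t) / γn) * (∑ j, if t < y j then (1:ℝ) else 0)
    + lamn * ∫ s in (0:ℝ)..t,
        (R (t - s) * Real.exp (-(β * s) / γn) * (∑ j, if s < y j then (1:ℝ) else 0))


noncomputable def Liter (G : ℝ → ENNReal) : ℕ → ℝ → ENNReal
  | 0 => G
  | (k + 1) => fun t => ∫⁻ s, Liter G k (t - s) * G s

lemma Liter_meas (G : ℝ → ENNReal) (hG : Measurable G) (k : ℕ) : Measurable (Liter G k) := by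
  induction k with
  | zero => exact hG
  | succ k ih =>
    simp only [Liter]
    apply Measurable.lintegral_prod_right' (f := fun p : ℝ × ℝ => Liter G k (p.1 - p.2) * G p.2)
    fun_prop

lemma Liter_swap (G : ℝ → ENNReal) (hG : Measurable G) (k : ℕ) (t : ℝ) :
    ∫⁻ x in Iic t, Liter G (k+1) x = ∫⁻ s, Liter G k s * ∫⁻ x in Iic t, G (x - s) := by
  have hL := Liter_meas G hG k
  have h1 : ∀ x, Liter G (k+1) x = ∫⁻ s, Liter G k s * G (x - s) := by
    intro x
    simp only [Liter]
    rw [← lintegral_sub_left_eq_self (fun s => Liter G k s * G (x - s)) x]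
    simp
  simp_rw [h1]
  rw [lintegral_lintegral_swap]
  · congr 1; ext s
    rw [lintegral_const_mul]
    fun_prop
  · apply Measurable.aemeasurable
    fun_prop

lemma Liter_step (G : ℝ → ENNReal) (hG : Measurable G) (hG0 : ∀ t < 0, G t = 0)
    (A : ENNReal) (hA : ∀ t, G t ≤ A) (hint : ∫⁻ t, G t ≤ 1) (h : ℝ)
    (hh : A * ENNReal.ofReal h ≤ 1/2) (k : ℕ) (t : ℝ) :
    (∫⁻ x in Iic t, Liter G (k+1) x) + (1/2) * ∫⁻ x in Ioc (t-h) t, Liter G k x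
      ≤ ∫⁻ x in Iic t, Liter G k x := by
  have hL := Liter_meas G hG k
  rw [Liter_swap G hG, ← lintegral_indicator measurableSet_Ioc,
    ← lintegral_indicator measurableSet_Iic, ← lintegral_const_mul, ← lintegral_add_right]
  · apply lintegral_mono
    intro s
    dsimp only
    by_cases hs : s ≤ t
    · rw [indicator_of_mem (s := Iic t) hs]
      by_cases hs2 : t - h < s
      · rw [indicator_of_mem (s := Ioc (t-h) t) ⟨hs2, hs⟩]
        have : ∫⁻ x in Iic t, G (x - s) ≤ 1/2 := by
          calc ∫⁻ x in Iic t, G (x - s) ≤ ∫⁻ x, (Icc s t).indicator (fun _ => A) x := by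
                rw [← lintegral_indicator measurableSet_Iic]
                apply lintegral_mono
                intro x
                by_cases hx : x ≤ t
                · rw [indicator_of_mem (s := Iic t) hx]
                  by_cases hx2 : s ≤ x
                  · rw [indicator_of_mem (s := Icc s t) ⟨hx2, hx⟩]; exact hA _
                  · rw [hG0 _ (by linarith)]; exact zero_le
                · rw [indicator_of_notMem (s := Iic t) hx]; exact zero_le
            _ = A * ENNReal.ofReal (t - s) := by
                rw [lintegral_indicator measurableSet_Icc]; simp
            _ ≤ A * ENNReal.ofReal h := by gcongr; linarith
            _ ≤ 1/2 := hh
        calc _ ≤ Liter G k s * (1/2) + 1/2 * Liter G k s := by gcongr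
          _ = Liter G k s := by
            rw [mul_comm, ← add_mul, ENNReal.add_halves, one_mul]
      · rw [indicator_of_notMem (s := Ioc (t-h) t) (fun hx => hs2 hx.1)]
        have : ∫⁻ x in Iic t, G (x - s) ≤ 1 := by
          refine (setLIntegral_le_lintegral _ _).trans ?_
          rw [lintegral_sub_right_eq_self (fun x => G x) s]; exact hint
        calc _ ≤ Liter G k s * 1 + 1/2 * 0 := by gcongr
          _ = _ := by simp
    · have : ∫⁻ x in Iic t, G (x - s) = 0 := by
        rw [setLIntegral_congr_fun (g := fun _ => 0) measurableSet_Iic]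
        · simp
        · intro x hx
          have : x ≤ t := hx
          exact hG0 _ (by linarith)
      rw [this, indicator_of_notMem (s := Ioc (t-h) t) (fun hx => hs hx.2)]
      simp
  · exact (hL.indicator measurableSet_Ioc).const_mul _
  · exact hL.indicator measurableSet_Ioc

lemma Liter_sum (G : ℝ → ENNReal) (hG : Measurable G) (hG0 : ∀ t < 0, G t = 0)
    (A : ENNReal) (hA : ∀ t, G t ≤ A) (hint : ∫⁻ t, G t ≤ 1) (h : ℝ)
    (hh : A * ENNReal.ofReal h ≤ 1/2) (t : ℝ) :
    ∫⁻ x in Ioc (t-h) t, ∑' k, Liter G k x ≤ 2 := by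
  rw [lintegral_tsum (fun k => (Liter_meas G hG k).aemeasurable)]
  have key : ∀ N : ℕ, (∫⁻ x in Iic t, Liter G N x) +
      (1/2) * ∑ k ∈ Finset.range N, ∫⁻ x in Ioc (t-h) t, Liter G k x ≤ 1 := by
    intro N
    induction N with
    | zero => 
      simp only [Finset.range_zero, Finset.sum_empty, mul_zero, add_zero, Liter]
      exact (setLIntegral_le_lintegral _ _).trans hint
    | succ N ih =>
      refine le_trans ?_ ih
      rw [Finset.sum_range_succ, mul_add, add_comm ((1/2) * ∑ k ∈ Finset.range N, _), ← add_assoc]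
      gcongr
      exact Liter_step G hG hG0 A hA hint h hh N t
  apply ENNReal.tsum_le_of_sum_range_le
  intro N
  have := le_trans le_add_self (key N)
  calc _ = 2 * ((1/2) * ∑ k ∈ Finset.range N, ∫⁻ x in Ioc (t-h) t, Liter G k x) := by
        rw [← mul_assoc, one_div, ENNReal.mul_inv_cancel (by simp) (by simp), one_mul]
    _ ≤ 2 * 1 := by gcongr
    _ = 2 := by simp

lemma Liter_sum_long (S : ℝ → ENNReal) (h : ℝ) (hS : ∀ t, ∫⁻ x in Ioc (t-h) t, S x ≤ 2)
    (t : ℝ) (N : ℕ) : ∫⁻ x in Ioc (t - N * h) t, S x ≤ 2 * N := by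
  induction N with
  | zero => simp
  | succ N ih =>
    calc _ ≤ ∫⁻ x in Ioc (t - N * h - h) (t - N * h) ∪ Ioc (t - N * h) t, S x := by
          apply lintegral_mono_set
          intro x hx
          push_cast at hx
          by_cases hx2 : x ≤ t - N * h
          · left; exact ⟨by linarith [hx.1], hx2⟩
          · right; exact ⟨by linarith, hx.2⟩
      _ ≤ _ := lintegral_union_le _ _ _
      _ ≤ 2 + 2 * N := by gcongr; exact hS _
      _ = _ := by push_cast; ring

lemma conv_le (a : ℝ) (f : ℝ → ℝ) (k : ℕ) :
    ∀ t : ℝ, 0 ≤ t → ‖a ^ (k+1) * convIter f k t‖ₑ ≤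
      Liter ((Ici (0:ℝ)).indicator (fun t => ‖a * f t‖ₑ)) k t := by
  induction k with
  | zero =>
    intro t ht
    simp only [convIter, Liter]
    rw [indicator_of_mem (s := Ici (0:ℝ)) ht]
    simp
  | succ k ih =>
    intro t ht
    simp only [convIter, Liter]
    rw [intervalIntegral.integral_of_le ht, ← integral_const_mul]
    refine (enorm_integral_le_lintegral_enorm _).trans ?_
    rw [← lintegral_indicator measurableSet_Ioc]
    apply lintegral_mono
    intro s
    by_cases hs : s ∈ Ioc 0 t
    · rw [indicator_of_mem hs]
      have h1 := ih (t - s) (by linarith [hs.2])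
      have h2 : (Ici (0:ℝ)).indicator (fun t => ‖a * f t‖ₑ) s = ‖a * f s‖ₑ :=
        indicator_of_mem (s := Ici (0:ℝ)) hs.1.le _
      dsimp only
      rw [h2]
      calc _ = ‖(a ^ (k+1) * convIter f k (t-s)) * (a * f s)‖ₑ := by
            congr 1; ring
        _ = ‖(a ^ (k+1) * convIter f k (t-s))‖ₑ * ‖(a * f s)‖ₑ := enorm_mul _ _
        _ ≤ _ := by gcongr
    · rw [indicator_of_notMem hs]; exact zero_le

lemma resK_le (a : ℝ) (ha : 0 < a) (f : ℝ → ℝ) (hf : Measurable f)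
    (hf0 : ∀ t, 0 ≤ t → 0 ≤ f t) (hf1 : ∀ t, 0 ≤ t → f t ≤ 1)
    (hint : ∫⁻ t in Ici (0:ℝ), ENNReal.ofReal (a * f t) ≤ 1)
    (h : ℝ) (hh0 : 0 < h) (hh : a * h ≤ 1/2) (lamn γn β : ℝ) (hl : 0 < lamn) (hγ : 0 < γn)
    (hβ : 0 ≤ β) (k : ℕ) (y : Fin k → ℝ) (hy : ∀ j, 0 ≤ y j) (t : ℝ) (ht : 0 ≤ t) :
    resolventK lamn γn β (resolventFn a f) y t ≤ lamn * ∑ j, (1 + 2 * (y j / h + 1)) := by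
  set G : ℝ → ENNReal := (Ici (0:ℝ)).indicator (fun t => ‖a * f t‖ₑ) with hGdef
  have hG : Measurable G := by
    apply Measurable.indicator _ measurableSet_Ici
    fun_prop
  have hG0 : ∀ t < 0, G t = 0 := fun t ht => indicator_of_notMem (by simpa using ht) _
  have hen : ∀ t, 0 ≤ t → ‖a * f t‖ₑ = ENNReal.ofReal (a * f t) := fun t ht =>
    Real.enorm_of_nonneg (mul_nonneg ha.le (hf0 t ht))
  have hA : ∀ t, G t ≤ ENNReal.ofReal a := by
    intro t
    by_cases ht : 0 ≤ t
    · rw [hGdef, indicator_of_mem (s := Ici (0:ℝ)) ht, hen t ht]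
      apply ENNReal.ofReal_le_ofReal
      nlinarith [hf1 t ht]
    · rw [hG0 t (by linarith)]; exact zero_le
  have hG1 : ∫⁻ t, G t ≤ 1 := by
    rw [hGdef, lintegral_indicator measurableSet_Ici]
    rw [setLIntegral_congr_fun measurableSet_Ici (fun t ht => hen t ht)]
    exact hint
  have hh' : ENNReal.ofReal a * ENNReal.ofReal h ≤ 1/2 := by
    rw [← ENNReal.ofReal_mul ha.le]
    refine (ENNReal.ofReal_le_ofReal hh).trans ?_
    rw [ENNReal.ofReal_div_of_pos (by norm_num)]; simp
  set S : ℝ → ENNReal := fun x => ∑' k, Liter G k x with hS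
  have hSm : Measurable S := Measurable.tsum (fun k => Liter_meas G hG k)
  have hS2 : ∀ t, ∫⁻ x in Ioc (t-h) t, S x ≤ 2 := fun t =>
    Liter_sum G hG hG0 _ hA hG1 h hh' t
  have hR : ∀ t, 0 ≤ t → ‖resolventFn a f t‖ₑ ≤ S t := by
    intro t ht
    unfold resolventFn
    refine enorm_tsum_le_tsum_enorm.trans ?_
    exact ENNReal.tsum_le_tsum (fun k => conv_le a f k t ht)
  have hexp : ∀ s, 0 ≤ s → Real.exp (-(β * s) / γn) ≤ 1 := by
    intro s hs
    rw [Real.exp_le_one_iff]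
    apply div_nonpos_of_nonpos_of_nonneg _ hγ.le
    have := mul_nonneg hβ hs
    linarith
  have key : ‖∫ s in (0:ℝ)..t,
        (resolventFn a f (t - s) * Real.exp (-(β * s) / γn) *
          (∑ j, if s < y j then (1:ℝ) else 0))‖ₑ ≤ ENNReal.ofReal (∑ j, 2 * (y j / h + 1)) := by
    rw [intervalIntegral.integral_of_le ht]
    refine (enorm_integral_le_lintegral_enorm _).trans ?_
    calc _ ≤ ∫⁻ s in Ioc 0 t, ∑ j, (Ico 0 (y j)).indicator (fun s => S (t - s)) s := by
          apply setLIntegral_mono' measurableSet_Ioc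
          intro s hs
          rw [enorm_mul, enorm_mul]
          calc _ ≤ S (t - s) * 1 * ∑ j, (Ico 0 (y j)).indicator (fun s => (1:ENNReal)) s := by
                gcongr
                · exact hR _ (by linarith [hs.2])
                · rw [Real.enorm_of_nonneg (Real.exp_pos _).le]
                  simpa using hexp s hs.1.le
                · refine (enorm_sum_le _ _).trans ?_
                  apply Finset.sum_le_sum
                  intro j _
                  by_cases hj : s < y j
                  · rw [indicator_of_mem (s := Ico 0 (y j)) ⟨hs.1.le, hj⟩]; simp [hj]
                  · simp [hj]
            _ = _ := by
                rw [mul_one, Finset.mul_sum]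
                congr 1; ext j
                by_cases hj : s ∈ Ico 0 (y j)
                · rw [indicator_of_mem hj, indicator_of_mem hj, mul_one]
                · rw [indicator_of_notMem hj, indicator_of_notMem hj, mul_zero]
      _ ≤ ∫⁻ s, ∑ j, (Ico 0 (y j)).indicator (fun s => S (t - s)) s :=
          setLIntegral_le_lintegral _ _
      _ = ∑ j, ∫⁻ s, (Ico 0 (y j)).indicator (fun s => S (t - s)) s := by
          apply lintegral_finsetSum
          intro j _
          exact Measurable.indicator (by fun_prop) measurableSet_Ico
      _ ≤ ∑ j, ENNReal.ofReal (2 * (y j / h + 1)) := by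
          apply Finset.sum_le_sum
          intro j _
          have hN := Liter_sum_long S h hS2 t ⌈y j / h⌉₊
          have hNy : y j ≤ ⌈y j / h⌉₊ * h := by
            rw [← div_le_iff₀ hh0]; exact Nat.le_ceil _
          have hyh : 0 ≤ y j / h := div_nonneg (hy j) hh0.le
          calc _ = ∫⁻ s, (Ico 0 (y j)).indicator (fun s => S (t - s)) (t - s) := by
                rw [lintegral_sub_left_eq_self (fun s => (Ico 0 (y j)).indicator (fun s => S (t - s)) s) t]
            _ ≤ ∫⁻ s in Ioc (t - ⌈y j / h⌉₊ * h) t, S s := by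
                rw [← lintegral_indicator measurableSet_Ioc]
                apply lintegral_mono
                intro s
                dsimp only
                by_cases hs : t - s ∈ Ico 0 (y j)
                · rw [indicator_of_mem hs, indicator_of_mem (s := Ioc _ _)
                    ⟨by linarith [hs.2], by linarith [hs.1]⟩]
                  simp
                · rw [indicator_of_notMem hs]; exact zero_le
            _ ≤ _ := hN
            _ = ENNReal.ofReal (2 * ⌈y j / h⌉₊) := by
                rw [ENNReal.ofReal_mul (by norm_num)]; simp
            _ ≤ _ := by
                apply ENNReal.ofReal_le_ofReal
                have := (Nat.ceil_lt_add_one hyh).le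
                linarith
      _ = _ := by
          rw [ENNReal.ofReal_sum_of_nonneg]
          intro j _
          have hyh : 0 ≤ y j / h := div_nonneg (hy j) hh0.le
          positivity
  have hnn : 0 ≤ ∑ j, 2 * (y j / h + 1) := by
    apply Finset.sum_nonneg
    intro j _
    have hyh : 0 ≤ y j / h := div_nonneg (hy j) hh0.le
    positivity
  have key2 : (∫ s in (0:ℝ)..t,
        (resolventFn a f (t - s) * Real.exp (-(β * s) / γn) *
          (∑ j, if s < y j then (1:ℝ) else 0))) ≤ (∑ j, 2 * (y j / h + 1)) := by
    rw [← ofReal_norm, ENNReal.ofReal_le_ofReal_iff hnn] at key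
    exact (Real.le_norm_self _).trans key
  unfold resolventK
  rw [Finset.sum_add_distrib, mul_add]
  have hs0 : 0 ≤ (∑ j, if t < y j then (1:ℝ) else 0) := by
    apply Finset.sum_nonneg; intro j _; split_ifs <;> norm_num
  have hs1 : (∑ j, if t < y j then (1:ℝ) else 0) ≤ ∑ j : Fin k, (1:ℝ) := by
    apply Finset.sum_le_sum; intro j _; split_ifs <;> norm_num
  have : Real.exp (-(β * t) / γn) * (∑ j, if t < y j then (1:ℝ) else 0) ≤ ∑ j : Fin k, (1:ℝ) := by
    have := mul_le_mul_of_nonneg_right (hexp t ht) hs0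
    linarith
  rw [mul_assoc]
  gcongr

lemma tail_facts (μ : Measure ℝ) [IsProbabilityMeasure μ] (hs : μ (Iio 0) = 0)
    (h1 : Integrable (fun t => t) μ) (h2 : Integrable (fun t => t^2) μ) :
    (IntegrableOn (fun t => (μ (Ioi t)).toReal) (Ioi 0)) ∧
    (∫ t in Ioi (0:ℝ), (μ (Ioi t)).toReal = ∫ t, t ∂μ) ∧
    (IntegrableOn (fun t => t * (μ (Ioi t)).toReal) (Ioi 0)) ∧
    (∫ t in Ioi (0:ℝ), t * (μ (Ioi t)).toReal = (1/2) * ∫ t, t^2 ∂μ) := by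
  have hae : 0 ≤ᵐ[μ] (fun t : ℝ => t) := by
    have : ∀ᵐ t ∂μ, t ∉ Iio (0:ℝ) := measure_eq_zero_iff_ae_notMem.1 hs
    filter_upwards [this] with t ht
    simpa using ht
  have hanti : Antitone (fun t => (μ (Ioi t)).toReal) := fun s t hst =>
    ENNReal.toReal_mono (measure_ne_top _ _) (measure_mono (Ioi_subset_Ioi hst))
  have hmeas : Measurable (fun t => (μ (Ioi t)).toReal) := hanti.measurable
  have A1 : ∫⁻ t in Ioi (0:ℝ), ENNReal.ofReal ((μ (Ioi t)).toReal) = ENNReal.ofReal (∫ t, t ∂μ) := by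
    rw [ofReal_integral_eq_lintegral_ofReal h1 hae, lintegral_eq_lintegral_meas_lt μ hae h1.aemeasurable]
    congr 1; ext t
    rw [ENNReal.ofReal_toReal (measure_ne_top _ _)]; rfl
  have A2 : ∫⁻ t in Ioi (0:ℝ), ENNReal.ofReal (t * (μ (Ioi t)).toReal)
      = ENNReal.ofReal ((1/2) * ∫ t, t^2 ∂μ) := by
    have := lintegral_rpow_eq_lintegral_meas_lt_mul μ hae h1.aemeasurable (p := 2) (by norm_num)
    have e : ENNReal.ofReal (∫ t, t^2 ∂μ) = ∫⁻ (ω : ℝ), ENNReal.ofReal (ω ^ (2:ℝ)) ∂μ := by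
      rw [ofReal_integral_eq_lintegral_ofReal h2 (Eventually.of_forall (fun t => sq_nonneg t))]
      simp
    rw [ENNReal.ofReal_mul (by norm_num), e, this, ← mul_assoc, ← ENNReal.ofReal_mul (by norm_num)]
    norm_num
    apply setLIntegral_congr_fun measurableSet_Ioi
    intro t ht
    dsimp only
    rw [ENNReal.ofReal_mul (le_of_lt ht), ENNReal.ofReal_toReal (measure_ne_top _ _), mul_comm]; rfl
  have n1 : 0 ≤ᵐ[volume.restrict (Ioi (0:ℝ))] (fun t => (μ (Ioi t)).toReal) :=
    Eventually.of_forall (fun t => ENNReal.toReal_nonneg)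
  have n2 : 0 ≤ᵐ[volume.restrict (Ioi (0:ℝ))] (fun t => t * (μ (Ioi t)).toReal) := by
    filter_upwards [ae_restrict_mem measurableSet_Ioi] with t ht
    exact mul_nonneg (le_of_lt ht) ENNReal.toReal_nonneg
  have m2 : Measurable (fun t => t * (μ (Ioi t)).toReal) := by fun_prop
  refine ⟨?_, ?_, ?_, ?_⟩
  · refine ⟨hmeas.aestronglyMeasurable, ?_⟩
    rw [hasFiniteIntegral_iff_ofReal n1, A1]; exact ENNReal.ofReal_lt_top
  · rw [integral_eq_lintegral_of_nonneg_ae n1 hmeas.aestronglyMeasurable, A1, ENNReal.toReal_ofReal]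
    exact integral_nonneg_of_ae hae
  · refine ⟨m2.aestronglyMeasurable, ?_⟩
    rw [hasFiniteIntegral_iff_ofReal n2, A2]; exact ENNReal.ofReal_lt_top
  · rw [integral_eq_lintegral_of_nonneg_ae n2 m2.aestronglyMeasurable, A2, ENNReal.toReal_ofReal]
    have : 0 ≤ ∫ t, t^2 ∂μ := integral_nonneg (fun t => sq_nonneg t)
    positivity

lemma psi_bounds (β γ t : ℝ) (hβ : 0 ≤ β) (hγ : 0 < γ) (ht : 0 ≤ t) :
    0 ≤ β * t - γ * (1 - Real.exp (-(β * t) / γ)) ∧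
    β * t - γ * (1 - Real.exp (-(β * t) / γ)) ≤ β * t ∧
    β * t - γ * (1 - Real.exp (-(β * t) / γ)) ≤ (β * t)^2 / γ := by
  have hx : 0 ≤ β * t := mul_nonneg hβ ht
  have h1 : -(β*t)/γ ≤ 0 := div_nonpos_of_nonpos_of_nonneg (by linarith) hγ.le
  have h2 := Real.add_one_le_exp (-(β*t)/γ)
  have h3 := Real.exp_le_one_iff.2 h1
  have h4 : γ * (-(β*t)/γ) = -(β*t) := by field_simp
  have h5 := Real.quadratic_le_exp_of_nonneg (x := β*t/γ) (by positivity)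
  refine ⟨by nlinarith, by nlinarith, ?_⟩
  set x := β*t/γ with hxd
  have e1 : β * t = γ * x := by rw [hxd]; field_simp
  have e2 : -(β*t)/γ = -x := by rw [hxd]; ring
  have hx0 : 0 ≤ x := by positivity
  rw [e2, e1]
  have : Real.exp (-x) ≤ 1 - x + x^2 := by
    rw [Real.exp_neg]
    rw [inv_le_iff_one_le_mul₀ (Real.exp_pos _)]
    nlinarith [Real.add_one_le_exp x, pow_nonneg hx0 3, sq_nonneg x, sq_nonneg (x-1), pow_nonneg hx0 4]
  have e3 : (γ * x)^2/γ = γ * x^2 := by field_simp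
  rw [e3]
  nlinarith

lemma Estar_lim (β C₀ : ℝ) (hβ : 0 ≤ β) (γ : ℕ → ℝ) (hγ_pos : ∀ n, 0 < γ n)
    (hγ_top : Tendsto γ atTop atTop) (μ : Measure ℝ) [IsProbabilityMeasure μ]
    (h3 : IntegrableOn (fun t => t * (μ (Ioi t)).toReal) (Ioi 0)) :
    (∀ n, IntegrableOn (fun t => (β * t - γ n * (1 - Real.exp (-(β * t) / γ n))) *
      (C₀ * (μ (Ioi t)).toReal)) (Ioi 0)) ∧
    Tendsto (fun n => ∫ t in Ioi (0:ℝ), (β * t - γ n * (1 - Real.exp (-(β * t) / γ n))) *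
      (C₀ * (μ (Ioi t)).toReal)) atTop (nhds 0) := by
  have hanti : Antitone (fun t => (μ (Ioi t)).toReal) := fun s t hst =>
    ENNReal.toReal_mono (measure_ne_top _ _) (measure_mono (Ioi_subset_Ioi hst))
  have hmeas : Measurable (fun t => (μ (Ioi t)).toReal) := hanti.measurable
  have hm : ∀ n, AEStronglyMeasurable (fun t => (β * t - γ n * (1 - Real.exp (-(β * t) / γ n))) *
      (C₀ * (μ (Ioi t)).toReal)) (volume.restrict (Ioi (0:ℝ))) := by
    intro n
    apply Measurable.aestronglyMeasurable
    fun_prop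
  have hb : Integrable (fun t => |β * C₀| * (t * (μ (Ioi t)).toReal)) (volume.restrict (Ioi (0:ℝ))) :=
    Integrable.const_mul h3 _
  have hbd : ∀ n, ∀ᵐ t ∂(volume.restrict (Ioi (0:ℝ))),
      ‖(β * t - γ n * (1 - Real.exp (-(β * t) / γ n))) * (C₀ * (μ (Ioi t)).toReal)‖
        ≤ |β * C₀| * (t * (μ (Ioi t)).toReal) := by
    intro n
    filter_upwards [ae_restrict_mem measurableSet_Ioi] with t ht
    have ht0 : 0 ≤ t := le_of_lt ht
    obtain ⟨p1, p2, p3⟩ := psi_bounds β (γ n) t hβ (hγ_pos n) ht0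
    have hn : 0 ≤ (μ (Ioi t)).toReal := ENNReal.toReal_nonneg
    rw [norm_mul, norm_mul, Real.norm_of_nonneg p1, Real.norm_of_nonneg hn, abs_mul,
      abs_of_nonneg hβ, Real.norm_eq_abs]
    calc _ ≤ (β * t) * (|C₀| * (μ (Ioi t)).toReal) := by gcongr
      _ = _ := by ring
  constructor
  · intro n
    exact Integrable.mono' hb (hm n) (hbd n)
  · have := tendsto_integral_of_dominated_convergence (f := fun _ => (0:ℝ)) _ hm hb hbd ?_
    · simpa using this
    · filter_upwards [ae_restrict_mem measurableSet_Ioi] with t ht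
      have ht0 : 0 ≤ t := le_of_lt ht
      rw [show (0:ℝ) = 0 * (C₀ * (μ (Ioi t)).toReal) by ring]
      apply Tendsto.mul_const
      exact squeeze_zero (fun n => (psi_bounds β (γ n) t hβ (hγ_pos n) ht0).1)
        (fun n => (psi_bounds β (γ n) t hβ (hγ_pos n) ht0).2.2)
        (tendsto_const_nhds.div_atTop hγ_top)

lemma mass_lower (β C₀ : ℝ) (hβ : 0 ≤ β) (γ : ℝ) (hγ : 0 < γ) (a : ℝ) (ha : 0 < a)
    (μ : Measure ℝ) [IsProbabilityMeasure μ] (g : ℝ → ℝ)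
    (hs : μ (Iio 0) = 0)
    (h1 : Integrable (fun t => t) μ) (h2 : Integrable (fun t => t^2) μ)
    (hdom : ∀ t : ℝ, 0 ≤ t → (μ (Ioi t)).toReal ≤ g t)
    (hg : IntegrableOn (fun t => (β * t - γ * (1 - Real.exp (-(β * t) / γ))) * g t) (Ioi 0)) :
    IntegrableOn (fun t => Real.exp (-(β * t) / γ) * (μ (Ioi t)).toReal) (Ioi 0) ∧
    γ * (1 - a * ∫ t, t ∂μ) + a * (β * ((1/2) * ∫ t, t^2 ∂μ) -
      ∫ t in Ioi (0:ℝ), (β * t - γ * (1 - Real.exp (-(β * t) / γ))) * g t) ≤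
    γ * (1 - a * ∫ t in Ioi (0:ℝ), Real.exp (-(β * t) / γ) * (μ (Ioi t)).toReal) := by
  obtain ⟨i1, e1, i2, e2⟩ := tail_facts μ hs h1 h2
  have hanti : Antitone (fun t => (μ (Ioi t)).toReal) := fun s t hst =>
    ENNReal.toReal_mono (measure_ne_top _ _) (measure_mono (Ioi_subset_Ioi hst))
  have hmeas : Measurable (fun t => (μ (Ioi t)).toReal) := hanti.measurable
  have i3 : IntegrableOn (fun t => Real.exp (-(β * t) / γ) * (μ (Ioi t)).toReal) (Ioi 0) := by
    refine Integrable.mono' i1 (Measurable.aestronglyMeasurable (by fun_prop)) ?_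
    filter_upwards [ae_restrict_mem measurableSet_Ioi] with t ht
    have ht0 : 0 ≤ t := le_of_lt ht
    have hn : 0 ≤ (μ (Ioi t)).toReal := ENNReal.toReal_nonneg
    rw [norm_mul, Real.norm_of_nonneg (Real.exp_pos _).le, Real.norm_of_nonneg hn]
    have : Real.exp (-(β * t) / γ) ≤ 1 := by
      rw [Real.exp_le_one_iff]
      apply div_nonpos_of_nonpos_of_nonneg _ hγ.le
      have := mul_nonneg hβ ht0
      linarith
    nlinarith
  refine ⟨i3, ?_⟩
  have hle : ∫ t in Ioi (0:ℝ), (β * (t * (μ (Ioi t)).toReal) - γ * (μ (Ioi t)).toReal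
      + γ * (Real.exp (-(β * t) / γ) * (μ (Ioi t)).toReal)) ≤
      ∫ t in Ioi (0:ℝ), (β * t - γ * (1 - Real.exp (-(β * t) / γ))) * g t := by
    apply setIntegral_mono_on _ hg measurableSet_Ioi
    · intro t ht
      have ht0 : 0 ≤ t := le_of_lt ht
      have := mul_le_mul_of_nonneg_left (hdom t ht0) (psi_bounds β γ t hβ hγ ht0).1
      linarith
    · exact ((i2.const_mul β).sub (i1.const_mul γ)).add (i3.const_mul γ)
  have i4 : Integrable (fun t => β * (t * (μ (Ioi t)).toReal) - γ * (μ (Ioi t)).toReal)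
      (volume.restrict (Ioi (0:ℝ))) := (i2.const_mul β).sub (i1.const_mul γ)
  rw [integral_add i4 (i3.const_mul γ),
    integral_sub (i2.const_mul β) (i1.const_mul γ), integral_const_mul, integral_const_mul,
    integral_const_mul, e1, e2] at hle
  nlinarith

theorem stmt9
    (β α : ℝ) (hβ : 0 ≤ β) (hα : α ∈ Set.Ioo (1:ℝ) 2)
    (Λ : ℕ → Measure ℝ) (hΛprob : ∀ n, IsProbabilityMeasure (Λ n))
    (hΛsupp : ∀ n, Λ n (Set.Iio 0) = 0)
    (lam m γ : ℕ → ℝ)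
    (hlam_pos : ∀ n, 0 < lam n) (hm_pos : ∀ n, 0 < m n) (hγ_pos : ∀ n, 0 < γ n)
    (hγ_top : Tendsto γ atTop atTop)
    (Λbar : ℕ → ℝ → ℝ) (hΛbar : ∀ n t, Λbar n t = (Λ n (Set.Ioi t)).toReal)
    (Λbarβ : ℕ → ℝ → ℝ)
    (hΛbarβ : ∀ n t, Λbarβ n t = Real.exp (-(β * t) / γ n) * Λbar n t)
    (ηβ : ℕ → ℝ) (hηβ : ∀ n, ηβ n = ∫ t in Set.Ioi (0:ℝ), Λbarβ n t)
    (lam0 η0 σ0 bm : ℝ) (hlam0 : 0 < lam0) (hη0 : 0 < η0) (hσ0 : 0 < σ0)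
    (hbm_pos : 0 < bm + β * σ0 * lam0)
    (hmom1 : ∀ n, Integrable (fun t => t) (Λ n))
    (hmom2 : ∀ n, Integrable (fun t => t ^ 2) (Λ n))
    (hlam_lim : Tendsto lam atTop (nhds lam0))
    (hm_lim : Tendsto m atTop (nhds 1))
    (hmean_lim : Tendsto (fun n => ∫ t, t ∂(Λ n)) atTop (nhds η0))
    (hsec_lim : Tendsto (fun n => (1/2) * ∫ t, t ^ 2 ∂(Λ n)) atTop (nhds σ0))
    (hγ_lim : Tendsto (fun n => γ n * (1 - lam n * m n * ∫ t, t ∂(Λ n))) atTop (nhds bm))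
    (C₀ : ℝ) (hC₀ : 0 < C₀)
    (Λstar : Measure ℝ) (hstar_prob : IsProbabilityMeasure Λstar)
    (hstar_supp : Λstar (Set.Iio 0) = 0)
    (hstar_mom : Integrable (fun t => t ^ (2 * α)) Λstar)
    (hdom : ∀ n, ∀ t : ℝ, 0 ≤ t → Λbar n t ≤ C₀ * (Λstar (Set.Ioi t)).toReal)
    (Rβ : ℕ → ℝ → ℝ) (hRβ : ∀ n t, Rβ n t = resolventFn (lam n * m n) (Λbarβ n) t)
 :
    ∃ C : ℝ, 0 < C ∧ ∃ n₀ : ℕ, 1 ≤ n₀ ∧ ∀ n : ℕ, n₀ ≤ n → ∀ k : ℕ, 1 ≤ k →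
      ∀ y : Fin k → ℝ, (∀ j, 0 ≤ y j) → ∀ t : ℝ, 0 ≤ t →
        resolventK (lam n) (γ n) β (Rβ n) y t ≤ C * ∑ j, (1 + y j) := by
  have hstar2 : Integrable (fun t => t^2) Λstar := by
    refine Integrable.mono' ((integrable_const (1:ℝ)).add hstar_mom)
      (Measurable.aestronglyMeasurable (by fun_prop)) ?_
    have : ∀ᵐ t ∂Λstar, t ∉ Iio (0:ℝ) := measure_eq_zero_iff_ae_notMem.1 hstar_supp
    filter_upwards [this] with t ht
    have ht0 : 0 ≤ t := by simpa using ht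
    rw [Real.norm_of_nonneg (sq_nonneg t)]
    show t^2 ≤ 1 + t ^ (2 * α)
    by_cases h1 : t ≤ 1
    · have := Real.rpow_nonneg ht0 (2*α)
      nlinarith
    · have : t ^ (2:ℝ) ≤ t ^ (2 * α) :=
        Real.rpow_le_rpow_of_exponent_le (by linarith) (by linarith [hα.1])
      rw [Real.rpow_two] at this
      linarith
  have hstar1 : Integrable (fun t => t) Λstar := by
    refine Integrable.mono' ((integrable_const (1:ℝ)).add hstar2)
      (Measurable.aestronglyMeasurable (by fun_prop)) ?_
    refine Eventually.of_forall (fun t => ?_)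
    show |t| ≤ 1 + t^2
    rw [abs_le]
    constructor <;> nlinarith [sq_nonneg (t-1), sq_nonneg (t+1)]
  obtain ⟨_, _, s3, _⟩ := tail_facts Λstar hstar_supp hstar1 hstar2
  obtain ⟨hgi, hE⟩ := Estar_lim β C₀ hβ γ hγ_pos hγ_top Λstar s3
  have ha_lim : Tendsto (fun n => lam n * m n) atTop (nhds lam0) := by
    simpa using hlam_lim.mul hm_lim
  have hlow : Tendsto (fun n => γ n * (1 - lam n * m n * ∫ t, t ∂(Λ n)) + (lam n * m n) *
      (β * ((1/2) * ∫ t, t ^ 2 ∂(Λ n)) - ∫ t in Ioi (0:ℝ),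
        (β * t - γ n * (1 - Real.exp (-(β * t) / γ n))) * (C₀ * (Λstar (Ioi t)).toReal))) atTop
      (nhds (bm + lam0 * (β * σ0 - 0))) :=
    hγ_lim.add (ha_lim.mul ((hsec_lim.const_mul β).sub hE))
  have ev1 := hlow.eventually (lt_mem_nhds (show (0:ℝ) < bm + lam0 * (β * σ0 - 0) by linarith))
  have ev2 := ha_lim.eventually (gt_mem_nhds (show lam0 < lam0 + 1 by linarith))
  have ev3 := hlam_lim.eventually (gt_mem_nhds (show lam0 < lam0 + 1 by linarith))
  obtain ⟨N, hN⟩ := eventually_atTop.1 (ev1.and (ev2.and ev3))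
  set h : ℝ := 1 / (2 * (lam0 + 1)) with hh
  have hh0 : 0 < h := by positivity
  refine ⟨(lam0 + 1) * (3 + 2 / h), by positivity, max N 1, le_max_right _ _, ?_⟩
  intro n hn k _ y hy t ht
  obtain ⟨e1, e2, e3⟩ := hN n (le_trans (le_max_left _ _) hn)
  have ha : 0 < lam n * m n := mul_pos (hlam_pos n) (hm_pos n)
  have := hΛprob n
  obtain ⟨i3, hlow⟩ := mass_lower β C₀ hβ (γ n) (hγ_pos n) (lam n * m n) ha (Λ n)
    (fun t => C₀ * (Λstar (Ioi t)).toReal) (hΛsupp n) (hmom1 n) (hmom2 n)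
    (fun t ht => by rw [← hΛbar n t]; exact hdom n t ht) (hgi n)
  have hpos := lt_of_lt_of_le e1 hlow
  have hM : 0 < 1 - lam n * m n * ∫ t in Ioi (0:ℝ),
    Real.exp (-(β * t) / γ n) * (Λ n (Ioi t)).toReal := pos_of_mul_pos_right hpos (hγ_pos n).le
  have hfeq : Λbarβ n = fun t => Real.exp (-(β * t) / γ n) * (Λ n (Ioi t)).toReal := by
    ext t; rw [hΛbarβ, hΛbar]
  have hReq : Rβ n = resolventFn (lam n * m n) (Λbarβ n) := by
    ext t; rw [hRβ]
  have hanti : Antitone (fun t => (Λ n (Ioi t)).toReal) := fun s t hst =>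
    ENNReal.toReal_mono (measure_ne_top _ _) (measure_mono (Ioi_subset_Ioi hst))
  have hmeas : Measurable (fun t => (Λ n (Ioi t)).toReal) := hanti.measurable
  rw [hReq, hfeq]
  have hmain := resK_le (lam n * m n) ha
    (fun t => Real.exp (-(β * t) / γ n) * (Λ n (Ioi t)).toReal) (by fun_prop)
    (fun t _ => mul_nonneg (Real.exp_pos _).le ENNReal.toReal_nonneg)
    (fun t ht => by
      have h1 : Real.exp (-(β * t) / γ n) ≤ 1 := by
        rw [Real.exp_le_one_iff]
        apply div_nonpos_of_nonpos_of_nonneg _ (hγ_pos n).le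
        have := mul_nonneg hβ ht
        linarith
      have h2 : (Λ n (Ioi t)).toReal ≤ 1 := measureReal_le_one
      exact mul_le_one₀ h1 ENNReal.toReal_nonneg h2)
    (by
      rw [setLIntegral_congr Ioi_ae_eq_Ici.symm, ← ofReal_integral_eq_lintegral_ofReal
        (i3.const_mul _) (Eventually.of_forall (fun t => mul_nonneg ha.le
          (mul_nonneg (Real.exp_pos _).le ENNReal.toReal_nonneg))), integral_const_mul]
      rw [← ENNReal.ofReal_one]
      apply ENNReal.ofReal_le_ofReal
      linarith)
    h hh0 (by
      rw [hh, mul_one_div, div_le_div_iff₀ (by positivity) (by norm_num)]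
      linarith)
    (lam n) (γ n) β (hlam_pos n) (hγ_pos n) hβ k y hy t ht
  refine hmain.trans ?_
  rw [mul_assoc, Finset.mul_sum Finset.univ _ (3 + 2 / h)]
  have hS : ∑ j, (1 + 2 * (y j / h + 1)) ≤ ∑ j, (3 + 2 / h) * (1 + y j) := by
    apply Finset.sum_le_sum
    intro j _
    have e : 2 * (y j / h + 1) = 2 / h * y j + 2 := by ring
    have := hy j
    have : 0 < 2 / h := by positivity
    rw [e]
    nlinarith
  have hS0 : 0 ≤ ∑ j, (1 + 2 * (y j / h + 1)) := by
    apply Finset.sum_nonneg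
    intro j _
    have := div_nonneg (hy j) hh0.le
    positivity
  exact mul_le_mul e3.le hS hS0 (by linarith)
end

section
/- For every integer k ≥ 1 and every y = (y₁,…,y_k) ∈ [0,∞)^k, lim_{n→∞} ∫₀^∞ R_β⁽ⁿ⁾(γₙ t, k, y) dt = λ (Σ_{j=1}^k y_j) / (b+m+βσλ), which is finite. Moreover, there exist a constant C > 0 and an integer n₀ ≥ 1 such that for every n > n₀, every real κ ≥ 1, every k ≥ 1 and every y ∈ [0,∞)^k, ∫₀^∞ (R_β⁽ⁿ⁾(γₙ t, k, y))^κ dt ≤ C^κ (Σ_{j=1}^k (1 + y_j))^κ. -/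
open MeasureTheory Filter Set

open scoped ENNReal

lemma lint_lconv {f g : ℝ → ℝ≥0∞} (hf : Measurable f) (hg : Measurable g) :
    ∫⁻ t, (f ⋆ₗ g) t = (∫⁻ t, f t) * ∫⁻ t, g t := by
  simp only [lconvolution_def]
  rw [lintegral_lintegral_swap (by fun_prop)]
  have : ∀ y, ∫⁻ x, f y * g (-y + x) = f y * ∫⁻ t, g t := by
    intro y
    rw [lintegral_const_mul _ (by fun_prop), lintegral_add_left_eq_self]
  simp_rw [this]
  rw [lintegral_mul_const _ hf]

noncomputable def fK (f : ℝ → ℝ≥0∞) : ℕ → ℝ → ℝ≥0∞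
  | 0 => f
  | (k + 1) => f ⋆ₗ fK f k

lemma fK_meas {f : ℝ → ℝ≥0∞} (hf : Measurable f) (k : ℕ) : Measurable (fK f k) := by
  induction k with
  | zero => exact hf
  | succ k ih => exact measurable_lconvolution _ hf ih

lemma fK_lint {f : ℝ → ℝ≥0∞} (hf : Measurable f) (k : ℕ) :
    ∫⁻ t, fK f k t = (∫⁻ t, f t) ^ (k + 1) := by
  induction k with
  | zero => simp [fK]
  | succ k ih => rw [fK, lint_lconv hf (fK_meas hf k), ih]; ring

lemma fK_le {f : ℝ → ℝ≥0∞} (hf : Measurable f) (h1 : ∀ t, f t ≤ 1) (k : ℕ) (t : ℝ) :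
    fK f k t ≤ (∫⁻ t, f t) ^ k := by
  induction k generalizing t with
  | zero => simpa [fK] using h1 t
  | succ k ih =>
    rw [fK, lconvolution_def, pow_succ', ← lintegral_mul_const _ hf]
    exact lintegral_mono fun s => by gcongr; exact ih _

lemma lconv_supp {f g : ℝ → ℝ≥0∞} (hf : ∀ t < 0, f t = 0) (hg : ∀ t < 0, g t = 0) :
    ∀ t < 0, (f ⋆ₗ g) t = 0 := by
  intro t ht
  rw [lconvolution_def]
  have : ∀ s, f s * g (-s + t) = 0 := by
    intro s
    rcases lt_or_ge s 0 with h | h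
    · simp [hf s h]
    · rw [hg (-s + t) (by linarith), mul_zero]
  simp [this]

lemma fK_supp {f : ℝ → ℝ≥0∞} (h0 : ∀ t < 0, f t = 0) (k : ℕ) : ∀ t < 0, fK f k t = 0 := by
  induction k with
  | zero => exact h0
  | succ k ih => exact lconv_supp h0 ih

noncomputable def RE (A : ℝ≥0∞) (f : ℝ → ℝ≥0∞) (t : ℝ) : ℝ≥0∞ :=
  ∑' k : ℕ, A ^ (k + 1) * fK f k t

lemma RE_meas (A : ℝ≥0∞) {f : ℝ → ℝ≥0∞} (hf : Measurable f) : Measurable (RE A f) := by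
  unfold RE
  exact Measurable.tsum fun k => (fK_meas hf k).const_mul _

lemma RE_supp (A : ℝ≥0∞) {f : ℝ → ℝ≥0∞} (h0 : ∀ t < 0, f t = 0) : ∀ t < 0, RE A f t = 0 := by
  intro t ht
  simp [RE, fK_supp h0 _ t ht]

lemma RE_lint (A : ℝ≥0∞) {f : ℝ → ℝ≥0∞} (hf : Measurable f) :
    1 + ∫⁻ t, RE A f t = (1 - A * ∫⁻ t, f t)⁻¹ := by
  unfold RE
  have geo := ENNReal.tsum_geometric (A * ∫⁻ t, f t)
  rw [tsum_eq_zero_add' ENNReal.summable] at geo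
  rw [lintegral_tsum fun k => ((fK_meas hf k).const_mul _).aemeasurable, ← geo]
  congr 1
  · simp
  · congr 1; ext k
    rw [lintegral_const_mul _ (fK_meas hf k), fK_lint hf, mul_pow]

lemma RE_eq (A : ℝ≥0∞) {f : ℝ → ℝ≥0∞} (hf : Measurable f) (t : ℝ) :
    RE A f t = A * f t + A * (f ⋆ₗ RE A f) t := by
  have : (f ⋆ₗ RE A f) t = ∑' k : ℕ, A ^ (k + 1) * fK f (k + 1) t := by
    rw [lconvolution_def]
    simp only [RE, ← ENNReal.tsum_mul_left]
    have hm := fK_meas hf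
    rw [lintegral_tsum fun k => by fun_prop]
    congr 1; ext k
    rw [fK, lconvolution_def, ← lintegral_const_mul _ (by fun_prop)]
    congr 1; ext s; ring
  rw [this, RE, tsum_eq_zero_add' ENNReal.summable, ← ENNReal.tsum_mul_left]
  congr 1
  · simp [fK]
  · congr 1; ext k; ring

lemma lconv_add_left {f g h : ℝ → ℝ≥0∞} (hf : Measurable f) (hh : Measurable h) (t : ℝ) :
    ((fun t => f t + g t) ⋆ₗ h) t = (f ⋆ₗ h) t + (g ⋆ₗ h) t := by
  simp only [lconvolution_def, add_mul]
  rw [lintegral_add_left (by fun_prop)]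

lemma lconv_const_left {f h : ℝ → ℝ≥0∞} (A : ℝ≥0∞) (hf : Measurable f) (hh : Measurable h) (t : ℝ) :
    ((fun t => A * f t) ⋆ₗ h) t = A * (f ⋆ₗ h) t := by
  simp only [lconvolution_def, mul_assoc]
  rw [lintegral_const_mul _ (by fun_prop)]

lemma lconv_mono_left {f g h : ℝ → ℝ≥0∞} (hfg : ∀ t, f t ≤ g t) (t : ℝ) :
    (f ⋆ₗ h) t ≤ (g ⋆ₗ h) t := by
  simp only [lconvolution_def]
  exact lintegral_mono fun s => by gcongr; exact hfg s

lemma lconv_le_of_le_one {f h : ℝ → ℝ≥0∞} (hh : ∀ t, h t ≤ 1) (t : ℝ) :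
    (f ⋆ₗ h) t ≤ ∫⁻ t, f t := by
  simp only [lconvolution_def]
  exact lintegral_mono fun s => by simpa using mul_le_mul_right (hh (-s + t)) (f s)

/-- renewal window bound -/
lemma RE_window {A : ℝ≥0∞} {f : ℝ → ℝ≥0∞} (hf : Measurable f) (h1 : ∀ t, f t ≤ 1)
    (h0 : ∀ t < 0, f t = 0) (hp : A * ∫⁻ t, f t < 1)
    {h : ℝ} (hh : A * ENNReal.ofReal h ≤ 2⁻¹) (t : ℝ) :
    ((indicator (Ico 0 h) 1) ⋆ₗ RE A f) t ≤ 2 := by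
  set H : ℝ → ℝ≥0∞ := indicator (Ici 0) 1 with hH
  have mH : Measurable H := measurable_one.indicator measurableSet_Ici
  have H1 : ∀ t, H t ≤ 1 := fun t => by
    rw [hH]; by_cases ht : t ∈ Ici (0:ℝ) <;> simp [ht]
  have H0 : ∀ t < 0, H t = 0 := fun t ht => by simp [hH, ht]
  have mR := RE_meas A hf
  set c : ℝ → ℝ≥0∞ := fun t => A * (f ⋆ₗ H) t with hc
  have mc : Measurable c := by fun_prop
  have c1 : ∀ t, c t ≤ 1 := fun t =>
    le_trans (by simp only [hc]; gcongr; exact lconv_le_of_le_one H1 t) hp.le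
  have c0 : ∀ t < 0, c t = 0 := fun t ht => by simp [hc, lconv_supp h0 H0 t ht]
  have ch : ∀ t ∈ Ico 0 h, c t ≤ 2⁻¹ := by
    intro t ht
    refine le_trans ?_ hh
    simp only [hc, lconvolution_def]
    gcongr
    calc ∫⁻ s, f s * H (-s + t) ≤ ∫⁻ s, indicator (Icc 0 t) 1 s := by
          refine lintegral_mono fun s => ?_
          by_cases hs : s ∈ Icc 0 t
          · simpa [hs] using mul_le_mul' (h1 s) (H1 (-s + t))
          · rw [mem_Icc, not_and_or, not_le, not_le] at hs
            rcases hs with hs | hs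
            · simp [h0 s hs]
            · simp [H0 (-s + t) (by linarith)]
      _ = ENNReal.ofReal t := by
          rw [lintegral_indicator_one measurableSet_Icc]; simp
      _ ≤ _ := by gcongr; exact ht.2.le
  set G : ℝ → ℝ≥0∞ := fun t => H t - c t with hG
  have mG : Measurable G := by fun_prop
  have hGH : H = fun t => G t + c t := by
    ext t
    rcases lt_or_ge t 0 with ht | ht
    · simp [hG, H0 t ht, c0 t ht]
    · have : H t = 1 := by simp [hH, ht]
      simp only [hG, this]
      exact (tsub_add_cancel_of_le (c1 t)).symm
  have hfin : (c ⋆ₗ RE A f) t ≠ ∞ := by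
    rw [lconvolution_comm]
    refine ne_top_of_le_ne_top ?_ (lconv_le_of_le_one c1 t)
    have := RE_lint A hf
    intro htop
    rw [htop] at this
    simp only [add_top] at this
    have h2 := ENNReal.inv_eq_top.1 this.symm
    rw [tsub_eq_zero_iff_le] at h2
    exact absurd hp (not_lt.2 h2)
  have e1 : (H ⋆ₗ RE A f) t = (G ⋆ₗ RE A f) t + (c ⋆ₗ RE A f) t := by
    conv_lhs => rw [hGH]
    exact lconv_add_left mG mR t
  have e2 : (H ⋆ₗ RE A f) t = c t + (c ⋆ₗ RE A f) t := by
    rw [lconvolution_comm]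
    have : RE A f = fun t => A * f t + A * (f ⋆ₗ RE A f) t := funext (RE_eq A hf)
    conv_lhs => rw [this]
    rw [lconv_add_left (by fun_prop) mH, lconv_const_left A hf mH,
      lconv_const_left A (by fun_prop) mH, hc, lconv_const_left A (by fun_prop) mR]
    congr 2
    rw [← lconvolution_assoc hf mR mH, lconvolution_comm (f := RE A f),
      lconvolution_assoc hf mH mR]
  have e3 : (G ⋆ₗ RE A f) t ≤ 1 := by
    rw [e2] at e1
    have := (ENNReal.add_left_inj hfin).1 e1
    rw [← this]; exact c1 t
  calc _ ≤ ((fun t => 2 * G t) ⋆ₗ RE A f) t := by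
        refine lconv_mono_left (fun s => ?_) t
        by_cases hs : s ∈ Ico 0 h
        · have : H s = 1 := by simp [hH, hs.1]
          simp only [hs, indicator_of_mem, Pi.one_apply, hG, this]
          have h3 : (2⁻¹ : ℝ≥0∞) ≤ 1 - c s := by
            calc (2⁻¹ : ℝ≥0∞) = 1 - 2⁻¹ := by rw [ENNReal.one_sub_inv_two]
              _ ≤ _ := tsub_le_tsub_left (ch s hs) _
          calc (1 : ℝ≥0∞) = 2 * 2⁻¹ := (ENNReal.mul_inv_cancel (by simp) (by simp)).symm
            _ ≤ _ := by gcongr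
        · simp [hs]
    _ = 2 * (G ⋆ₗ RE A f) t := lconv_const_left 2 mG mR t
    _ ≤ 2 * 1 := by gcongr
    _ = 2 := by simp

lemma lconv_shift {R : ℝ → ℝ≥0∞} (u h t : ℝ) :
    ((indicator (Ico u (u + h)) 1) ⋆ₗ R) t = ((indicator (Ico 0 h) 1) ⋆ₗ R) (t - u) := by
  simp only [lconvolution_def]
  rw [← lintegral_add_left_eq_self _ u]
  congr 1; ext s
  have : (u + s ∈ Ico u (u + h)) ↔ s ∈ Ico 0 h := by simp
  congr 1
  · by_cases hs : s ∈ Ico 0 h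
    · rw [indicator_of_mem hs, indicator_of_mem (this.2 hs)]; simp
    · rw [indicator_of_notMem hs, indicator_of_notMem (fun h => hs (this.1 h))]
  · congr 1; ring

lemma lconv_windows {R : ℝ → ℝ≥0∞} (hR : Measurable R) {h : ℝ} (hh : 0 < h)
    (hw : ∀ t, ((indicator (Ico 0 h) 1) ⋆ₗ R) t ≤ 2) (N : ℕ) (t : ℝ) :
    ((indicator (Ico 0 (N * h)) 1) ⋆ₗ R) t ≤ 2 * N := by
  induction N with
  | zero => simp [lconvolution_def]
  | succ N ih =>
    have hm : ∀ a b : ℝ, Measurable (indicator (Ico a b) (1 : ℝ → ℝ≥0∞)) := fun a b =>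
      measurable_one.indicator measurableSet_Ico
    have : indicator (Ico 0 ((N + 1 : ℕ) * h)) (1 : ℝ → ℝ≥0∞) =
        fun t => indicator (Ico 0 (N * h)) 1 t + indicator (Ico (N * h) (N * h + h)) 1 t := by
      rw [← Ico_union_Ico_eq_Ico (b := N * h) (by positivity) (by push_cast; nlinarith),
        indicator_union_of_disjoint]
      · ext s; congr 3; push_cast; ring
      · rw [Set.disjoint_left]; intro s h1 h2
        exact absurd h1.2 (not_lt.2 h2.1)
    rw [this, lconv_add_left (hm _ _) hR, lconv_shift]
    calc _ ≤ 2 * (N : ℝ≥0∞) + 2 := add_le_add ih (hw _)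
      _ = _ := by push_cast; ring

lemma lconv_Ico_le {R : ℝ → ℝ≥0∞} (hR : Measurable R) {h : ℝ} (hh : 0 < h)
    (hw : ∀ t, ((indicator (Ico 0 h) 1) ⋆ₗ R) t ≤ 2) {y : ℝ} (hy : 0 ≤ y) (t : ℝ) :
    ((indicator (Ico 0 y) 1) ⋆ₗ R) t ≤ ENNReal.ofReal (2 * (y / h + 1)) := by
  have hN := Nat.le_ceil (y / h)
  calc _ ≤ ((indicator (Ico 0 (⌈y / h⌉₊ * h)) 1) ⋆ₗ R) t := by
        refine lconv_mono_left (fun s => ?_) t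
        refine indicator_le_indicator_of_subset ?_ (fun _ => by simp) s
        apply Ico_subset_Ico_right
        rwa [← div_le_iff₀ hh]
    _ ≤ 2 * (⌈y / h⌉₊ : ℝ≥0∞) := lconv_windows hR hh hw _ t
    _ = ENNReal.ofReal (2 * ⌈y / h⌉₊) := by
        rw [ENNReal.ofReal_mul (by norm_num)]; simp
    _ ≤ _ := by
        gcongr
        exact (Nat.ceil_lt_add_one (by positivity)).le


lemma conv_toReal {f R : ℝ → ℝ≥0∞} (hf : Measurable f) (hR : Measurable R)
    (f0 : ∀ t < 0, f t = 0) (R0 : ∀ t < 0, R t = 0) (ff : ∀ t, f t ≠ ∞)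
    (Rf : ∀ᵐ t, R t ≠ ∞) {t : ℝ} (ht : 0 ≤ t) :
    ∫ s in (0:ℝ)..t, (R (t - s)).toReal * (f s).toReal = ((f ⋆ₗ R) t).toReal := by
  rw [intervalIntegral.integral_of_le ht, ← integral_Icc_eq_integral_Ioc]
  simp_rw [← ENNReal.toReal_mul]
  rw [integral_toReal (by fun_prop), lconvolution_def]
  · congr 1
    rw [← lintegral_indicator measurableSet_Icc]
    congr 1; ext s
    by_cases hs : s ∈ Icc 0 t
    · rw [indicator_of_mem hs, mul_comm]; congr 2; ring
    · rw [indicator_of_notMem hs]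
      rw [mem_Icc, not_and_or, not_le, not_le] at hs
      rcases hs with hs | hs
      · simp [f0 s hs]
      · simp [R0 (-s + t) (by linarith)]
  · refine ae_restrict_of_ae ?_
    have : ∀ᵐ s : ℝ, R (t - s) ≠ ∞ :=
      (Measure.measurePreserving_sub_left (volume : Measure ℝ) t).quasiMeasurePreserving.ae Rf
    filter_upwards [this] with s hs
    exact ENNReal.mul_lt_top hs.lt_top (ff s).lt_top

noncomputable def extE (f : ℝ → ℝ) : ℝ → ℝ≥0∞ := indicator (Ici 0) (fun t => ENNReal.ofReal (f t))

lemma extE_meas {f : ℝ → ℝ} (hf : Measurable f) : Measurable (extE f) :=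
  (ENNReal.measurable_ofReal.comp hf).indicator measurableSet_Ici

lemma extE_neg (f : ℝ → ℝ) : ∀ t < 0, extE f t = 0 := fun t ht => by simp [extE, ht]

lemma extE_nonneg (f : ℝ → ℝ) {t : ℝ} (ht : 0 ≤ t) : extE f t = ENNReal.ofReal (f t) := by
  simp [extE, ht]

lemma extE_ne_top (f : ℝ → ℝ) (t : ℝ) : extE f t ≠ ∞ := by
  rcases lt_or_ge t 0 with h | h
  · simp [extE_neg f t h]
  · simp [extE_nonneg f h]

lemma extE_le_one {f : ℝ → ℝ} (f1 : ∀ t, 0 ≤ t → f t ≤ 1) (t : ℝ) : extE f t ≤ 1 := by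
  rcases lt_or_ge t 0 with h | h
  · simp [extE_neg f t h]
  · simpa [extE_nonneg f h] using f1 t h

lemma lint_extE (f : ℝ → ℝ) : ∫⁻ t, extE f t = ∫⁻ t in Ioi 0, ENNReal.ofReal (f t) := by
  rw [extE, lintegral_indicator measurableSet_Ici, restrict_Ioi_eq_restrict_Ici]

lemma convIter_eq {f : ℝ → ℝ} (hf : Measurable f) (f0 : ∀ t, 0 ≤ f t)
    (f1 : ∀ t, 0 ≤ t → f t ≤ 1) (hI : ∫⁻ t, extE f t ≠ ∞) (k : ℕ) {t : ℝ} (ht : 0 ≤ t) :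
    convIter f k t = (fK (extE f) k t).toReal := by
  induction k generalizing t with
  | zero => simp [convIter, fK, extE_nonneg f ht, f0]
  | succ k ih =>
    rw [convIter, fK, ← conv_toReal (extE_meas hf) (fK_meas (extE_meas hf) k) (extE_neg f)
      (fK_supp (extE_neg f) k) (extE_ne_top f) (ae_of_all _ fun t => ?_) ht]
    · refine intervalIntegral.integral_congr fun s hs => ?_
      rw [uIcc_of_le ht] at hs
      rw [ih (by linarith [hs.2]), extE_nonneg f hs.1, ENNReal.toReal_ofReal (f0 s)]
    · exact ne_top_of_le_ne_top (ENNReal.pow_ne_top hI) (fK_le (extE_meas hf) (extE_le_one f1) k t)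

lemma resolventFn_eq {a : ℝ} (ha : 0 ≤ a) {f : ℝ → ℝ} (hf : Measurable f) (f0 : ∀ t, 0 ≤ f t)
    (f1 : ∀ t, 0 ≤ t → f t ≤ 1) (hI : ∫⁻ t, extE f t ≠ ∞) {t : ℝ} (ht : 0 ≤ t) :
    resolventFn a f t = (RE (ENNReal.ofReal a) (extE f) t).toReal := by
  rw [resolventFn, RE, ENNReal.tsum_toReal_eq]
  · congr 1; ext k
    rw [convIter_eq hf f0 f1 hI k ht, ENNReal.toReal_mul, ENNReal.toReal_pow,
      ENNReal.toReal_ofReal ha]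
  · intro k
    refine ENNReal.mul_ne_top (by simp) ?_
    exact ne_top_of_le_ne_top (ENNReal.pow_ne_top hI) (fK_le (extE_meas hf) (extE_le_one f1) k t)

lemma lconv_sum_le {k : ℕ} {g : ℝ → ℝ≥0∞} {e : Fin k → ℝ → ℝ≥0∞} {R : ℝ → ℝ≥0∞}
    (hR : Measurable R) (he : ∀ j, Measurable (e j)) (hg : ∀ t, g t ≤ ∑ j, e j t) (t : ℝ) :
    (g ⋆ₗ R) t ≤ ∑ j, (e j ⋆ₗ R) t := by
  refine (lconv_mono_left hg t).trans ?_
  simp only [lconvolution_def, Finset.sum_mul]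
  rw [lintegral_finsetSum _ (fun j _ => by have := he j; fun_prop)]

lemma main_fixed {lamn a γn β : ℝ} (hl : 0 < lamn) (ha : 0 < a) (hγ : 0 < γn) (hβ : 0 ≤ β)
    {f : ℝ → ℝ} (hf : Measurable f) (f0 : ∀ t, 0 ≤ f t)
    (f1 : ∀ t, 0 ≤ t → f t ≤ 1) (hfi : IntegrableOn f (Ioi 0))
    (hp : a * ∫ t in Ioi 0, f t < 1) {k : ℕ} (y : Fin k → ℝ) (hy : ∀ j, 0 ≤ y j) :
    ∃ K : ℝ → ℝ, (∀ t, 0 ≤ t → resolventK lamn γn β (resolventFn a f) y t = K t) ∧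
      (∀ t, 0 ≤ K t) ∧ (∀ t, K t ≤ lamn * ∑ j, (3 + 4 * a * y j)) ∧ Integrable K ∧
      ∃ J, ∑ j, y j * Real.exp (-(β * y j) / γn) ≤ J ∧ J ≤ ∑ j, y j ∧
        ∫ t in Ioi 0, K t = lamn * J / (1 - a * ∫ t in Ioi 0, f t) := by
  have hI' : ∫⁻ t, extE f t = ENNReal.ofReal (∫ t in Ioi 0, f t) := by
    rw [lint_extE, ofReal_integral_eq_lintegral_ofReal hfi (ae_of_all _ f0)]
  have hI : ∫⁻ t, extE f t ≠ ∞ := by simp [hI']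
  have hint0 : 0 ≤ ∫ t in Ioi 0, f t := integral_nonneg f0
  have hpE : ENNReal.ofReal a * ∫⁻ t, extE f t = ENNReal.ofReal (a * ∫ t in Ioi 0, f t) := by
    rw [hI', ENNReal.ofReal_mul ha.le]
  have hp' : ENNReal.ofReal a * ∫⁻ t, extE f t < 1 := by
    rw [hpE]; exact ENNReal.ofReal_lt_one.2 hp
  set p := a * ∫ t in Ioi 0, f t with hpdef
  have hmE := extE_meas hf
  set R := RE (ENNReal.ofReal a) (extE f) with hR
  have mR : Measurable R := RE_meas _ hmE
  have R0 : ∀ t < 0, R t = 0 := RE_supp _ (extE_neg f)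
  have hRint : 1 + ∫⁻ t, R t = ENNReal.ofReal ((1 - p)⁻¹) := by
    rw [hR, RE_lint _ hmE, hpE, ENNReal.ofReal_inv_of_pos (by linarith),
      ENNReal.ofReal_sub _ (by positivity), ENNReal.ofReal_one]
  have hRfin : ∀ᵐ t, R t ≠ ∞ := by
    have : ∫⁻ t, R t ≠ ∞ := by
      intro h; rw [h] at hRint; simp at hRint
    filter_upwards [ae_lt_top mR this] with t ht using ht.ne
  set g : ℝ → ℝ := fun s => Real.exp (-(β * s) / γn) * ∑ j, if s < y j then (1:ℝ) else 0 with hg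
  have mg : Measurable g := by
    refine Measurable.mul (by fun_prop) (Finset.measurable_sum _ fun j _ => ?_)
    exact Measurable.ite measurableSet_Iio measurable_const measurable_const
  have g0 : ∀ t, 0 ≤ g t := fun t => by
    refine mul_nonneg (Real.exp_pos _).le (Finset.sum_nonneg fun j _ => ?_)
    split_ifs <;> norm_num
  have mgE := extE_meas mg
  have mInd : ∀ j, Measurable (indicator (Ico 0 (y j)) (1 : ℝ → ℝ≥0∞)) := fun j =>
    measurable_one.indicator measurableSet_Ico
  have gsum : ∀ t, 0 ≤ t → ∑ j, indicator (Ico 0 (y j)) (1 : ℝ → ℝ≥0∞) t =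
      ENNReal.ofReal (∑ j, if t < y j then (1:ℝ) else 0) := by
    intro t ht
    rw [ENNReal.ofReal_sum_of_nonneg (fun j _ => by split_ifs <;> norm_num)]
    congr 1; ext j
    by_cases h : t < y j <;> simp [h, ht]
  have gle : ∀ t, extE g t ≤ ∑ j, indicator (Ico 0 (y j)) (1 : ℝ → ℝ≥0∞) t := by
    intro t
    rcases lt_or_ge t 0 with h | h
    · simp [extE_neg g t h]
    · rw [extE_nonneg g h, gsum t h]
      refine ENNReal.ofReal_le_ofReal ?_
      refine mul_le_of_le_one_left (Finset.sum_nonneg fun j _ => by split_ifs <;> norm_num) ?_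
      rw [Real.exp_le_one_iff, neg_div, neg_nonpos]
      positivity
  have gge : ∀ t, ∑ j, ENNReal.ofReal (Real.exp (-(β * y j) / γn)) *
      indicator (Ico 0 (y j)) (1 : ℝ → ℝ≥0∞) t ≤ extE g t := by
    intro t
    rcases lt_or_ge t 0 with h | h
    · simp [extE_neg g t h, h]
    · rw [extE_nonneg g h, hg, ENNReal.ofReal_mul (Real.exp_pos _).le, ← gsum t h,
        Finset.mul_sum]
      refine Finset.sum_le_sum fun j _ => ?_
      by_cases ht : t ∈ Ico 0 (y j)
      · gcongr
        exact ht.2.le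
      · simp [ht]
  have lInd : ∀ j, ∫⁻ t, indicator (Ico 0 (y j)) (1 : ℝ → ℝ≥0∞) t = ENNReal.ofReal (y j) := by
    intro j
    rw [lintegral_indicator_one measurableSet_Ico]; simp
  have Jle : ∫⁻ t, extE g t ≤ ENNReal.ofReal (∑ j, y j) := by
    refine (lintegral_mono gle).trans ?_
    rw [lintegral_finsetSum _ fun j _ => mInd j, ENNReal.ofReal_sum_of_nonneg fun j _ => hy j]
    simp [lInd]
  have Jge : ENNReal.ofReal (∑ j, y j * Real.exp (-(β * y j) / γn)) ≤ ∫⁻ t, extE g t := by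
    refine le_trans ?_ (lintegral_mono gge)
    rw [lintegral_finsetSum _ fun j _ => (mInd j).const_mul _, ENNReal.ofReal_sum_of_nonneg
      fun j _ => mul_nonneg (hy j) (Real.exp_pos _).le]
    refine Finset.sum_le_sum fun j _ => ?_
    rw [lintegral_const_mul _ (mInd j), lInd, ENNReal.ofReal_mul (hy j), mul_comm]
  have Jfin : ∫⁻ t, extE g t ≠ ∞ := ne_top_of_le_ne_top (by simp) Jle
  -- sup bound
  have win : ∀ t, ((indicator (Ico 0 (1 / (2 * a))) 1) ⋆ₗ R) t ≤ 2 := by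
    intro t
    refine RE_window hmE (extE_le_one f1) (extE_neg f) hp' ?_ t
    rw [← ENNReal.ofReal_mul ha.le, show a * (1 / (2 * a)) = 2⁻¹ by field_simp,
      ENNReal.ofReal_inv_of_pos (by norm_num)]
    simp
  have supb : ∀ t, extE g t + (extE g ⋆ₗ R) t ≤ ENNReal.ofReal (∑ j, (3 + 4 * a * y j)) := by
    intro t
    have h1 : extE g t ≤ ∑ j : Fin k, 1 := (gle t).trans (Finset.sum_le_sum fun j _ => by
      by_cases h : t ∈ Ico 0 (y j) <;> simp [h])
    have h2 := lconv_sum_le mR mInd gle t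
    have h3 : ∑ j, ((indicator (Ico 0 (y j)) (1 : ℝ → ℝ≥0∞)) ⋆ₗ R) t ≤
        ∑ j, ENNReal.ofReal (2 * (y j / (1 / (2 * a)) + 1)) :=
      Finset.sum_le_sum fun j _ => lconv_Ico_le mR (by positivity) win (hy j) t
    refine (add_le_add h1 (h2.trans h3)).trans ?_
    rw [← Finset.sum_add_distrib, ENNReal.ofReal_sum_of_nonneg fun j _ => by
      have := hy j; positivity]
    refine Finset.sum_le_sum fun j _ => ?_
    have := hy j
    rw [← ENNReal.ofReal_one, ← ENNReal.ofReal_add (by norm_num) (by positivity)]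
    refine ENNReal.ofReal_le_ofReal (le_of_eq ?_)
    field_simp; ring
  have cfin : ∀ t, (extE g ⋆ₗ R) t ≠ ∞ := fun t =>
    ne_top_of_le_ne_top (by simp) (le_add_self.trans (supb t))
  set KE : ℝ → ℝ≥0∞ := fun t => ENNReal.ofReal lamn * (extE g t + (extE g ⋆ₗ R) t) with hKE
  have mKE : Measurable KE := by fun_prop
  have sum0 : 0 ≤ ∑ j, (3 + 4 * a * y j) := Finset.sum_nonneg fun j _ => by
    have := hy j; positivity
  have lKE : ∫⁻ t, KE t = ENNReal.ofReal lamn * ((∫⁻ t, extE g t) *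
      ENNReal.ofReal ((1 - p)⁻¹)) := by
    rw [hKE, lintegral_const_mul _ (by fun_prop), lintegral_add_left mgE, lint_lconv mgE mR,
      ← hRint]
    ring
  have KE0 : ∀ t < 0, KE t = 0 := by
    intro t ht
    simp [hKE, extE_neg g t ht, lconv_supp (extE_neg g) R0 t ht]
  have KEfin : ∀ t, KE t < ∞ := fun t => by
    rw [hKE]
    exact ENNReal.mul_lt_top (by simp) ((supb t).trans_lt (by simp))
  refine ⟨fun t => (KE t).toReal, ?_, fun t => ENNReal.toReal_nonneg, ?_, ?_,
    (∫⁻ t, extE g t).toReal, ?_, ?_, ?_⟩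
  · intro t ht
    simp only [hKE]
    rw [ENNReal.toReal_mul, ENNReal.toReal_ofReal hl.le, ENNReal.toReal_add (extE_ne_top g t)
      (cfin t), ← conv_toReal mgE mR (extE_neg g) R0 (extE_ne_top g) hRfin ht,
      extE_nonneg g ht, ENNReal.toReal_ofReal (g0 t), resolventK, mul_add]
    congr 1
    · simp only [hg]; ring
    · congr 1
      refine intervalIntegral.integral_congr fun s hs => ?_
      rw [uIcc_of_le ht] at hs
      rw [resolventFn_eq ha.le hf f0 f1 hI (by linarith [hs.2]), extE_nonneg g hs.1,
        ENNReal.toReal_ofReal (g0 s), hg, mul_assoc]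
  · intro t
    refine ENNReal.toReal_le_of_le_ofReal (by positivity) ?_
    rw [ENNReal.ofReal_mul hl.le]
    simp only [hKE]
    gcongr
    exact supb t
  · refine integrable_toReal_of_lintegral_ne_top mKE.aemeasurable ?_
    rw [lKE]
    exact ENNReal.mul_ne_top (by simp) (ENNReal.mul_ne_top Jfin (by simp))
  · refine (ENNReal.ofReal_le_iff_le_toReal Jfin).1 Jge
  · exact ENNReal.toReal_le_of_le_ofReal (Finset.sum_nonneg fun j _ => hy j) Jle
  · rw [← integral_Ici_eq_integral_Ioi, setIntegral_eq_integral_of_forall_compl_eq_zero,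
      integral_toReal mKE.aemeasurable (ae_of_all _ KEfin), lKE, ENNReal.toReal_mul,
      ENNReal.toReal_mul, ENNReal.toReal_ofReal hl.le, ENNReal.toReal_ofReal]
    · ring
    · exact (inv_pos.2 (by linarith)).le
    · intro t ht
      rw [mem_Ici, not_le] at ht
      simp [KE0 t ht]


lemma tail_moment (μ : Measure ℝ) [IsProbabilityMeasure μ] (h0 : μ (Iio 0) = 0) (i : ℕ)
    (hi : Integrable (fun t => t ^ (i + 1)) μ) :
    IntegrableOn (fun t => t ^ i * (μ (Ioi t)).toReal) (Ioi 0) ∧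
      ∫ t in Ioi 0, t ^ i * (μ (Ioi t)).toReal = (∫ t, t ^ (i + 1) ∂μ) / (i + 1) := by
  have hnn : ∀ᵐ t ∂μ, (0:ℝ) ≤ t := by
    rw [ae_iff]; simp only [not_le]; exact h0
  have key := lintegral_comp_eq_lintegral_meas_lt_mul (f := fun t : ℝ => t) (g := fun t => t ^ i)
    μ hnn measurable_id.aemeasurable
    (fun t _ => (continuous_pow i).intervalIntegrable 0 t)
    ((ae_restrict_iff' measurableSet_Ioi).2 (ae_of_all _ fun t (ht : 0 < t) => by positivity))
  have hmeas : Measurable (fun t => (μ (Ioi t)).toReal) := by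
    refine Antitone.measurable fun s t hst => ?_
    exact ENNReal.toReal_mono (measure_ne_top _ _) (measure_mono (Ioi_subset_Ioi hst))
  have hmm : Measurable (fun t : ℝ => t ^ i * (μ (Ioi t)).toReal) := by fun_prop
  have hnn2 : ∀ᵐ t ∂(volume.restrict (Ioi (0:ℝ))), 0 ≤ t ^ i * (μ (Ioi t)).toReal :=
    (ae_restrict_iff' measurableSet_Ioi).2 (ae_of_all _ fun t (ht : 0 < t) => by positivity)
  have e1 : ∫⁻ t in Ioi (0:ℝ), ENNReal.ofReal (t ^ i * (μ (Ioi t)).toReal) =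
      ENNReal.ofReal ((∫ t, t ^ (i + 1) ∂μ) / (i + 1)) := by
    have : ∫⁻ t in Ioi (0:ℝ), ENNReal.ofReal (t ^ i * (μ (Ioi t)).toReal) =
        ∫⁻ t in Ioi (0:ℝ), μ {a | t < a} * ENNReal.ofReal (t ^ i) := by
      refine setLIntegral_congr_fun measurableSet_Ioi fun t (ht : 0 < t) => ?_
      rw [ENNReal.ofReal_mul (by positivity), ENNReal.ofReal_toReal (measure_ne_top _ _), mul_comm]
      rfl
    rw [this, ← key, ← integral_div, ofReal_integral_eq_lintegral_ofReal (hi.div_const _)]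
    · simp
    · filter_upwards [hnn] with t ht
      simp only [Pi.zero_apply]; positivity
  refine ⟨⟨hmm.aestronglyMeasurable, ?_⟩, ?_⟩
  · rw [hasFiniteIntegral_iff_ofReal hnn2, e1]; simp
  · rw [integral_eq_lintegral_of_nonneg_ae hnn2 hmm.aestronglyMeasurable, e1,
      ENNReal.toReal_ofReal]
    have : 0 ≤ ∫ t, t ^ (i + 1) ∂μ := integral_nonneg_of_ae (by
      filter_upwards [hnn] with t ht
      simp only [Pi.zero_apply]; positivity)
    positivity

lemma err_bounds {x g : ℝ} (hx : 0 ≤ x) (hg : 0 < g) :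
    0 ≤ x - g * (1 - Real.exp (-x / g)) ∧ x - g * (1 - Real.exp (-x / g)) ≤ x ∧
      x - g * (1 - Real.exp (-x / g)) ≤ x ^ 2 / g := by
  obtain ⟨u, rfl⟩ : ∃ u, x = g * u := ⟨x / g, by field_simp⟩
  have hu : 0 ≤ u := by
    by_contra h; push Not at h; nlinarith
  have e : -(g * u) / g = -u := by field_simp
  rw [e]
  have h1 := Real.add_one_le_exp (-u)
  have h2 : Real.exp (-u) ≤ 1 := by simpa using hu
  have h3 : Real.exp (-u) ≤ 1 - u + u ^ 2 := by
    rw [Real.exp_neg]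
    have := Real.add_one_le_exp u
    calc (Real.exp u)⁻¹ ≤ (u + 1)⁻¹ := by gcongr
      _ ≤ _ := by
        rw [inv_le_iff_one_le_mul₀ (by positivity)]
        nlinarith [pow_nonneg hu 3]
  have e2 : (g * u) ^ 2 / g = g * u ^ 2 := by field_simp
  rw [e2]
  refine ⟨by nlinarith, by nlinarith, by nlinarith⟩

lemma err_tendsto {β : ℝ} (hβ : 0 ≤ β) {γ : ℕ → ℝ} (hγ : ∀ n, 0 < γ n)
    (hγ_top : Tendsto γ atTop atTop) {w : ℝ → ℝ} (w0 : ∀ t, 0 ≤ w t) (mw : Measurable w)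
    (hw : IntegrableOn (fun t => t * w t) (Ioi 0)) :
    Tendsto (fun n => ∫ t in Ioi 0,
      (β * t - γ n * (1 - Real.exp (-(β * t) / γ n))) * w t) atTop (nhds 0) := by
  rw [show nhds (0:ℝ) = nhds (∫ _t in Ioi (0:ℝ), (0:ℝ)) by simp]
  refine tendsto_integral_of_dominated_convergence (f := fun _ => (0:ℝ)) (fun t => β * (t * w t)) ?_ (hw.const_mul β) ?_ ?_
  · intro n; exact Measurable.aestronglyMeasurable (by fun_prop)
  · intro n
    refine (ae_restrict_iff' measurableSet_Ioi).2 (ae_of_all _ fun t (ht : 0 < t) => ?_)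
    obtain ⟨h1, h2, h3⟩ := err_bounds (x := β * t) (by positivity) (hγ n)
    rw [Real.norm_eq_abs, abs_of_nonneg (mul_nonneg h1 (w0 t)), ← mul_assoc]
    exact mul_le_mul_of_nonneg_right h2 (w0 t)
  · refine (ae_restrict_iff' measurableSet_Ioi).2 (ae_of_all _ fun t (ht : 0 < t) => ?_)
    have h0 : Tendsto (fun n => (β * t) ^ 2 / γ n) atTop (nhds 0) :=
      tendsto_const_nhds.div_atTop hγ_top
    have : Tendsto (fun n => β * t - γ n * (1 - Real.exp (-(β * t) / γ n))) atTop (nhds 0) :=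
      squeeze_zero (fun n => (err_bounds (x := β * t) (by positivity) (hγ n)).1)
        (fun n => (err_bounds (x := β * t) (by positivity) (hγ n)).2.2) h0
    simpa using this.mul_const (w t)

theorem stmt10
    (β α : ℝ) (hβ : 0 ≤ β) (hα : α ∈ Set.Ioo (1:ℝ) 2)
    (Λ : ℕ → Measure ℝ) (hΛprob : ∀ n, IsProbabilityMeasure (Λ n))
    (hΛsupp : ∀ n, Λ n (Set.Iio 0) = 0)
    (lam m γ : ℕ → ℝ)
    (hlam_pos : ∀ n, 0 < lam n) (hm_pos : ∀ n, 0 < m n) (hγ_pos : ∀ n, 0 < γ n)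
    (hγ_top : Tendsto γ atTop atTop)
    (Λbar : ℕ → ℝ → ℝ) (hΛbar : ∀ n t, Λbar n t = (Λ n (Set.Ioi t)).toReal)
    (Λbarβ : ℕ → ℝ → ℝ)
    (hΛbarβ : ∀ n t, Λbarβ n t = Real.exp (-(β * t) / γ n) * Λbar n t)
    (ηβ : ℕ → ℝ) (hηβ : ∀ n, ηβ n = ∫ t in Set.Ioi (0:ℝ), Λbarβ n t)
    (lam0 η0 σ0 bm : ℝ) (hlam0 : 0 < lam0) (hη0 : 0 < η0) (hσ0 : 0 < σ0)
    (hbm_pos : 0 < bm + β * σ0 * lam0)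
    (hmom1 : ∀ n, Integrable (fun t => t) (Λ n))
    (hmom2 : ∀ n, Integrable (fun t => t ^ 2) (Λ n))
    (hlam_lim : Tendsto lam atTop (nhds lam0))
    (hm_lim : Tendsto m atTop (nhds 1))
    (hmean_lim : Tendsto (fun n => ∫ t, t ∂(Λ n)) atTop (nhds η0))
    (hsec_lim : Tendsto (fun n => (1/2) * ∫ t, t ^ 2 ∂(Λ n)) atTop (nhds σ0))
    (hγ_lim : Tendsto (fun n => γ n * (1 - lam n * m n * ∫ t, t ∂(Λ n))) atTop (nhds bm))
    (C₀ : ℝ) (hC₀ : 0 < C₀)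
    (Λstar : Measure ℝ) (hstar_prob : IsProbabilityMeasure Λstar)
    (hstar_supp : Λstar (Set.Iio 0) = 0)
    (hstar_mom : Integrable (fun t => t ^ (2 * α)) Λstar)
    (hdom : ∀ n, ∀ t : ℝ, 0 ≤ t → Λbar n t ≤ C₀ * (Λstar (Set.Ioi t)).toReal)
    (Rβ : ℕ → ℝ → ℝ) (hRβ : ∀ n t, Rβ n t = resolventFn (lam n * m n) (Λbarβ n) t)
 :
    (∀ k : ℕ, 1 ≤ k → ∀ y : Fin k → ℝ, (∀ j, 0 ≤ y j) →
      Tendsto (fun n => ∫ t in Set.Ioi (0:ℝ),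
          resolventK (lam n) (γ n) β (Rβ n) y (γ n * t)) atTop
        (nhds (lam0 * (∑ j, y j) / (bm + β * σ0 * lam0)))) ∧
      ∃ C : ℝ, 0 < C ∧ ∃ n₀ : ℕ, 1 ≤ n₀ ∧ ∀ n : ℕ, n₀ < n → ∀ κ : ℝ, 1 ≤ κ →
        ∀ k : ℕ, 1 ≤ k → ∀ y : Fin k → ℝ, (∀ j, 0 ≤ y j) →
          (∫ t in Set.Ioi (0:ℝ), (resolventK (lam n) (γ n) β (Rβ n) y (γ n * t)) ^ κ)
            ≤ C ^ κ * (∑ j, (1 + y j)) ^ κ := by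
  have mbar : ∀ n, Measurable (Λbar n) := by
    intro n
    refine Antitone.measurable fun s t hst => ?_
    rw [hΛbar, hΛbar]
    exact ENNReal.toReal_mono (measure_ne_top _ _) (measure_mono (Ioi_subset_Ioi hst))
  have bar0 : ∀ n t, 0 ≤ Λbar n t := fun n t => by rw [hΛbar]; exact ENNReal.toReal_nonneg
  have bar1 : ∀ n t, Λbar n t ≤ 1 := fun n t => by
    rw [hΛbar]; exact ENNReal.toReal_le_of_le_ofReal (by norm_num) (by simpa using prob_le_one)
  have hbar1 : ∀ n, IntegrableOn (Λbar n) (Ioi 0) ∧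
      ∫ t in Ioi 0, Λbar n t = ∫ t, t ∂(Λ n) := by
    intro n
    have := tail_moment (Λ n) (hΛsupp n) 0 (by simpa using hmom1 n)
    simp_rw [← hΛbar] at this
    simpa using this
  have hbar2 : ∀ n, IntegrableOn (fun t => t * Λbar n t) (Ioi 0) ∧
      ∫ t in Ioi 0, t * Λbar n t = (1/2) * ∫ t, t ^ 2 ∂(Λ n) := by
    intro n
    have := tail_moment (Λ n) (hΛsupp n) 1 (by simpa using hmom2 n)
    simp_rw [← hΛbar] at this
    norm_num at this
    refine ⟨this.1, by rw [this.2]; ring⟩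
  set ws : ℝ → ℝ := fun t => (Λstar (Ioi t)).toReal with hws
  have mws : Measurable ws := by
    refine Antitone.measurable fun s t hst => ?_
    exact ENNReal.toReal_mono (measure_ne_top _ _) (measure_mono (Ioi_subset_Ioi hst))
  have ws0 : ∀ t, 0 ≤ ws t := fun t => ENNReal.toReal_nonneg
  have hstar2 : Integrable (fun t : ℝ => t ^ 2) Λstar := by
    refine ((integrable_const (1:ℝ)).add hstar_mom).mono'
      (by fun_prop) ?_
    have hnn : ∀ᵐ t ∂Λstar, (0:ℝ) ≤ t := by
      rw [ae_iff]; simp only [not_le]; exact hstar_supp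
    filter_upwards [hnn] with t ht
    rw [Real.norm_eq_abs, abs_of_nonneg (by positivity)]
    simp only [Pi.add_apply]
    have hp := Real.rpow_nonneg ht (2 * α)
    rcases le_total t 1 with h | h
    · nlinarith
    · have : t ^ (2:ℝ) ≤ t ^ (2 * α) := Real.rpow_le_rpow_of_exponent_le h (by linarith [hα.1])
      rw [Real.rpow_two] at this
      linarith
  have hws2 : IntegrableOn (fun t => t * ws t) (Ioi 0) := by
    have := (tail_moment Λstar hstar_supp 1 (by simpa using hstar2)).1
    simpa using this
  -- properties of the kernel
  have expm : ∀ n t, 0 ≤ t → Real.exp (-(β * t) / γ n) ≤ 1 := by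
    intro n t ht
    rw [Real.exp_le_one_iff, neg_div, neg_nonpos]
    have := hγ_pos n
    positivity
  have fdef : ∀ n, Λbarβ n = fun t => Real.exp (-(β * t) / γ n) * Λbar n t :=
    fun n => funext (hΛbarβ n)
  have mf : ∀ n, Measurable (Λbarβ n) := fun n => by
    rw [fdef]; have := mbar n; fun_prop
  have f0 : ∀ n t, 0 ≤ Λbarβ n t := fun n t => by
    rw [hΛbarβ]; exact mul_nonneg (Real.exp_pos _).le (bar0 n t)
  have fle : ∀ n t, 0 ≤ t → Λbarβ n t ≤ Λbar n t := fun n t ht => by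
    rw [hΛbarβ]; exact mul_le_of_le_one_left (bar0 n t) (expm n t ht)
  have f1 : ∀ n t, 0 ≤ t → Λbarβ n t ≤ 1 := fun n t ht => (fle n t ht).trans (bar1 n t)
  have fint : ∀ n, IntegrableOn (Λbarβ n) (Ioi 0) := by
    intro n
    refine (hbar1 n).1.mono' (mf n).aestronglyMeasurable ?_
    refine (ae_restrict_iff' measurableSet_Ioi).2 (ae_of_all _ fun t (ht : 0 < t) => ?_)
    rw [Real.norm_eq_abs, abs_of_nonneg (f0 n t)]
    exact fle n t ht.le
  -- the key limit
  set L := bm + β * σ0 * lam0 with hL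
  set err : ℕ → ℝ := fun n => ∫ t in Ioi 0,
      (β * t - γ n * (1 - Real.exp (-(β * t) / γ n))) * Λbar n t with herr
  have err_lim : Tendsto err atTop (nhds 0) := by
    have h1 := (err_tendsto hβ hγ_pos hγ_top ws0 mws hws2).const_mul C₀
    rw [mul_zero] at h1
    have hpos : ∀ n (t : ℝ), 0 < t → 0 ≤ β * t - γ n * (1 - Real.exp (-(β * t) / γ n)) :=
      fun n t ht => (err_bounds (x := β * t) (by positivity) (hγ_pos n)).1
    refine squeeze_zero (fun n => ?_) (fun n => ?_) h1
    · refine setIntegral_nonneg measurableSet_Ioi fun t (ht : 0 < t) => ?_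
      exact mul_nonneg (hpos n t ht) (bar0 n t)
    · rw [← integral_const_mul]
      refine integral_mono_of_nonneg ?_ ?_ ?_
      · refine (ae_restrict_iff' measurableSet_Ioi).2 (ae_of_all _ fun t (ht : 0 < t) => ?_)
        exact mul_nonneg (hpos n t ht) (bar0 n t)
      · refine Integrable.const_mul ?_ C₀
        refine (hws2.const_mul β).mono' (Measurable.aestronglyMeasurable (by fun_prop)) ?_
        refine (ae_restrict_iff' measurableSet_Ioi).2 (ae_of_all _ fun t (ht : 0 < t) => ?_)
        obtain ⟨h1, h2, h3⟩ := err_bounds (x := β * t) (by positivity) (hγ_pos n)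
        rw [Real.norm_eq_abs, abs_of_nonneg (mul_nonneg h1 (ws0 t)), ← mul_assoc]
        exact mul_le_mul_of_nonneg_right h2 (ws0 t)
      · refine (ae_restrict_iff' measurableSet_Ioi).2 (ae_of_all _ fun t (ht : 0 < t) => ?_)
        have := mul_le_mul_of_nonneg_left (hdom n t ht.le) (hpos n t ht)
        simp only
        linarith
  have err_eq : ∀ n, err n = β * ((1/2) * ∫ t, t ^ 2 ∂(Λ n)) -
      γ n * ((∫ t, t ∂(Λ n)) - ∫ t in Ioi 0, Λbarβ n t) := by
    intro n
    have i3 : IntegrableOn (fun t => γ n * (Λbar n t - Λbarβ n t)) (Ioi 0) :=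
      ((hbar1 n).1.sub (fint n)).const_mul _
    rw [← (hbar2 n).2, ← (hbar1 n).2, ← integral_sub (hbar1 n).1 (fint n), ← integral_const_mul,
      ← integral_const_mul, ← integral_sub ((hbar2 n).1.const_mul _) i3, herr]
    refine integral_congr_ae (ae_of_all _ fun t => ?_)
    simp only [hΛbarβ]
    ring
  set a : ℕ → ℝ := fun n => lam n * m n with ha
  have a_pos : ∀ n, 0 < a n := fun n => mul_pos (hlam_pos n) (hm_pos n)
  have a_lim : Tendsto a atTop (nhds lam0) := by simpa using hlam_lim.mul hm_lim
  set q : ℕ → ℝ := fun n => γ n * (1 - a n * ∫ t in Ioi 0, Λbarβ n t) with hq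
  have q_lim : Tendsto q atTop (nhds L) := by
    have h1 := hγ_lim.add (a_lim.mul ((hsec_lim.const_mul β).sub err_lim))
    have e : bm + lam0 * (β * σ0 - 0) = L := by rw [hL]; ring
    rw [e] at h1
    refine h1.congr fun n => ?_
    rw [err_eq, hq]
    simp only [ha]
    ring
  have Rfun : ∀ n, Rβ n = resolventFn (a n) (Λbarβ n) := fun n => funext (hRβ n)
  -- fixed n consequences
  have fixed : ∀ n, 0 < q n → ∀ k : ℕ, ∀ y : Fin k → ℝ, (∀ j, 0 ≤ y j) →
      ∃ K : ℝ → ℝ, (∀ t ∈ Ioi (0:ℝ), resolventK (lam n) (γ n) β (Rβ n) y (γ n * t) = K t) ∧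
      (∀ t, 0 ≤ K t) ∧ (∀ t, K t ≤ lam n * ∑ j, (3 + 4 * a n * y j)) ∧ IntegrableOn K (Ioi 0) ∧
      ∃ J, ∑ j, y j * Real.exp (-(β * y j) / γ n) ≤ J ∧ J ≤ ∑ j, y j ∧
        ∫ t in Ioi 0, K t = lam n * J / q n := by
    intro n hqn k y hy
    have hγn := hγ_pos n
    have hp : a n * ∫ t in Ioi 0, Λbarβ n t < 1 := by
      have := pos_of_mul_pos_right hqn hγn.le
      linarith
    obtain ⟨K, hK, K0, Kb, Ki, J, J1, J2, hJ⟩ := main_fixed (hlam_pos n) (a_pos n) hγn hβ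
      (mf n) (f0 n) (f1 n) (fint n) hp y hy
    refine ⟨fun t => K (γ n * t), ?_, fun t => K0 _, fun t => Kb _, ?_, J, J1, J2, ?_⟩
    · intro t (ht : 0 < t)
      rw [Rfun]; exact hK _ (by positivity)
    · exact (Ki.comp_mul_left' hγn.ne').integrableOn
    · rw [integral_comp_mul_left_Ioi K 0 hγn, mul_zero, hJ, hq]
      have : 1 - a n * ∫ t in Ioi 0, Λbarβ n t ≠ 0 := by linarith
      simp only [smul_eq_mul]
      field_simp
  have q_ev : ∀ᶠ n in atTop, L / 2 < q n := q_lim.eventually (lt_mem_nhds (by linarith))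
  constructor
  · intro k hk y hy
    have lo : Tendsto (fun n => lam n * (∑ j, y j * Real.exp (-(β * y j) / γ n)) / q n) atTop
        (nhds (lam0 * (∑ j, y j) / L)) := by
      refine (hlam_lim.mul ?_).div q_lim hbm_pos.ne'
      refine tendsto_finsetSum _ fun j _ => ?_
      have h0 : Tendsto (fun n => -(β * y j) / γ n) atTop (nhds 0) :=
        tendsto_const_nhds.div_atTop hγ_top
      have := ((Real.continuous_exp.tendsto 0).comp h0).const_mul (y j)
      simpa using this
    have hi : Tendsto (fun n => lam n * (∑ j, y j) / q n) atTop
        (nhds (lam0 * (∑ j, y j) / L)) :=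
      (hlam_lim.mul tendsto_const_nhds).div q_lim hbm_pos.ne'
    refine tendsto_of_tendsto_of_tendsto_of_le_of_le' lo hi ?_ ?_
    · filter_upwards [q_ev] with n hn
      have hqn : 0 < q n := by linarith
      obtain ⟨K, hK, K0, Kb, Ki, J, J1, J2, hJ⟩ := fixed n hqn k y hy
      rw [setIntegral_congr_fun measurableSet_Ioi hK, hJ]
      have := hlam_pos n
      gcongr
    · filter_upwards [q_ev] with n hn
      have hqn : 0 < q n := by linarith
      obtain ⟨K, hK, K0, Kb, Ki, J, J1, J2, hJ⟩ := fixed n hqn k y hy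
      rw [setIntegral_congr_fun measurableSet_Ioi hK, hJ]
      have := hlam_pos n
      gcongr
  · have l_ev : ∀ᶠ n in atTop, lam n < lam0 + 1 :=
      hlam_lim.eventually (gt_mem_nhds (by linarith))
    have a_ev : ∀ᶠ n in atTop, a n < lam0 + 1 :=
      a_lim.eventually (gt_mem_nhds (by linarith))
    obtain ⟨N, hN⟩ := eventually_atTop.1 (q_ev.and (l_ev.and a_ev))
    set M := (lam0 + 1) * (3 + 4 * (lam0 + 1)) with hM
    set D := (lam0 + 1) / (L / 2) with hD
    have M0 : 0 < M := by positivity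
    have D0 : 0 < D := by positivity
    refine ⟨M + D, by positivity, N + 1, by omega, ?_⟩
    intro n hn κ hκ k hk y hy
    obtain ⟨hqn', hln, han⟩ := hN n (by omega)
    have hqn : 0 < q n := by linarith
    obtain ⟨K, hK, K0, Kb, Ki, J, J1, J2, hJ⟩ := fixed n hqn k y hy
    have hln0 := hlam_pos n
    have han0 := a_pos n
    set S := ∑ j, (1 + y j) with hS
    have S0 : 0 ≤ S := Finset.sum_nonneg fun j _ => by linarith [hy j]
    have J0 : 0 ≤ J := le_trans (Finset.sum_nonneg fun j _ =>
      mul_nonneg (hy j) (Real.exp_pos _).le) J1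
    have JS : J ≤ S := J2.trans (Finset.sum_le_sum fun j _ => by linarith)
    have KM : ∀ t, K t ≤ (M + D) * S := by
      intro t
      refine (Kb t).trans ?_
      calc lam n * ∑ j, (3 + 4 * a n * y j)
          ≤ (lam0 + 1) * ∑ j, (3 + 4 * (lam0 + 1)) * (1 + y j) := by
            gcongr with j
            · exact Finset.sum_nonneg fun j _ => by have := hy j; positivity
            · have := hy j
              nlinarith [mul_le_mul_of_nonneg_right han.le this]
        _ = M * S := by rw [← Finset.mul_sum, hM, hS]; ring
        _ ≤ _ := by gcongr; linarith
    have hint : ∫ t in Ioi 0, K t ≤ (M + D) * S := by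
      rw [hJ]
      calc lam n * J / q n ≤ (lam0 + 1) * S / (L / 2) := by gcongr
        _ = D * S := by rw [hD]; ring
        _ ≤ _ := by gcongr; linarith
    have CS0 : 0 ≤ (M + D) * S := by positivity
    have split : ∀ x : ℝ, 0 ≤ x → x ^ κ = x ^ (κ - 1) * x := by
      intro x hx
      have := Real.rpow_add_of_nonneg hx (y := κ - 1) (z := 1) (by linarith) (by norm_num)
      simpa using this
    rw [setIntegral_congr_fun (g := fun t => K t ^ κ) measurableSet_Ioi
      fun t ht => by simp only [hK t ht]]
    calc ∫ t in Ioi 0, K t ^ κ ≤ ∫ t in Ioi 0, ((M + D) * S) ^ (κ - 1) * K t := by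
          refine integral_mono_of_nonneg (ae_of_all _ fun t => Real.rpow_nonneg (K0 t) _)
            (Ki.const_mul _) (ae_of_all _ fun t => ?_)
          simp only
          rw [split _ (K0 t)]
          exact mul_le_mul_of_nonneg_right
            (Real.rpow_le_rpow (K0 t) (KM t) (by linarith)) (K0 t)
      _ = ((M + D) * S) ^ (κ - 1) * ∫ t in Ioi 0, K t := integral_const_mul _ _
      _ ≤ ((M + D) * S) ^ (κ - 1) * ((M + D) * S) := by
          gcongr
      _ = ((M + D) * S) ^ κ := (split _ CS0).symm
      _ = _ := Real.mul_rpow (by positivity) S0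
end
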